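/- arXiv:2512.00578 — 10 statements merged into one kernel-verified Lean document; each statement's English description precedes it below -/
import Mathlib

section
/- There exists a nonzero polynomial h in the polynomial ring ℂ[q_1,…,q_k] such that for every q = (q_1,…,q_k) ∈ ℂ^k with q_j ≠ 0 for all j and h(q) ≠ 0, the set of tuples z = (z_{s,j}) ∈ ℂ^{|r|} satisfying the system (P_q) is finite and has cardinality exactly ∏_{j=1}^k r_{j+1}^{r_j}. -/
open PrimeSpectrum Topology in
/-- A constructible subset of the spectrum of a domain, or its complement, contains a nonempty
basic open set. -/
theorem PrimeSpectrum.exists_basicOpen_subset_or_subset_compl {R : Type*} [CommRing R] [IsDomain R]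
    {s : Set (PrimeSpectrum R)} (hs : IsConstructible s) :
    ∃ h : R, h ≠ 0 ∧ ((basicOpen h : Set (PrimeSpectrum R)) ⊆ s ∨
      (basicOpen h : Set (PrimeSpectrum R)) ⊆ sᶜ) := by
  induction hs using IsConstructible.empty_union_induction with
  | open_retrocompact U hU _ =>
    rcases U.eq_empty_or_nonempty with rfl | ⟨x, hx⟩
    · exact ⟨1, one_ne_zero, .inr (by simp)⟩
    · obtain ⟨_, ⟨h, rfl⟩, hxh, hhU⟩ := isTopologicalBasis_basic_opens.exists_subset_of_mem_open hx hU
      refine ⟨h, ?_, .inl hhU⟩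
      rintro rfl
      simp at hxh
  | union s _ t _ ihs iht =>
    obtain ⟨f, hf, hfs⟩ := ihs
    obtain ⟨g, hg, hgt⟩ := iht
    rcases hfs with hfs | hfs
    · exact ⟨f, hf, .inl (hfs.trans Set.subset_union_left)⟩
    rcases hgt with hgt | hgt
    · exact ⟨g, hg, .inl (hgt.trans Set.subset_union_right)⟩
    refine ⟨f * g, mul_ne_zero hf hg, .inr ?_⟩
    rw [basicOpen_mul, Set.compl_union]
    exact Set.inter_subset_inter hfs hgt
  | compl s _ ih =>
    obtain ⟨f, hf, hfs⟩ := ih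
    exact ⟨f, hf, by rw [compl_compl]; exact hfs.symm⟩

namespace MvPolynomial

variable {κ σ τ ι : Type*}

open PrimeSpectrum Topology in
/-- Over a nonempty Zariski open set of parameters `q`, a polynomial system either always or never
has a solution. -/
theorem exists_generic_exists_zero_or_not [Finite κ] [Finite τ] [Finite ι]
    (Q : ι → MvPolynomial (κ ⊕ τ) ℂ) :
    ∃ h : MvPolynomial κ ℂ, h ≠ 0 ∧
      ((∀ q, eval q h ≠ 0 → ∃ y, ∀ i, eval (Sum.elim q y) (Q i) = 0) ∨
        ∀ q, eval q h ≠ 0 → ¬ ∃ y, ∀ i, eval (Sum.elim q y) (Q i) = 0) := by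
  let f : MvPolynomial κ ℂ →+* MvPolynomial (κ ⊕ τ) ℂ := (rename Sum.inl).toRingHom
  have hf : f.FinitePresentation := by
    refine RingHom.FinitePresentation.of_finiteType.1 ?_
    refine RingHom.FiniteType.of_comp_finiteType (f := C) ?_
    have : f.comp C = algebraMap ℂ (MvPolynomial (κ ⊕ τ) ℂ) := by
      ext x; simp [f, algebraMap_eq]
    rw [this]
    exact RingHom.finiteType_algebraMap.2 inferInstance
  let Z := PrimeSpectrum.zeroLocus (Set.range Q)
  have hZ : IsConstructible Z := by
    rw [← isConstructible_compl]
    refine IsCompact.isConstructible ?_ (isClosed_zeroLocus _).isOpen_compl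
    exact TopologicalSpace.NoetherianSpace.isCompact _
  have key (q : κ → ℂ) : (pointToPoint q : PrimeSpectrum (MvPolynomial κ ℂ)) ∈
      PrimeSpectrum.comap f '' Z ↔
      ∃ y, ∀ i, eval (Sum.elim q y) (Q i) = 0 := by
    constructor
    · rintro ⟨P, hP, hPq⟩
      obtain ⟨M, hM, hPM⟩ := P.asIdeal.exists_le_maximal P.isPrime.ne_top
      obtain ⟨x, rfl⟩ := isMaximal_iff_eq_vanishingIdeal_singleton.1 hM
      have hq : x ∘ Sum.inl = q := by
        ext a
        have h1 : (X a - C (q a) : MvPolynomial κ ℂ) ∈ (PrimeSpectrum.comap f P).asIdeal := by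
          rw [hPq]
          show _ ∈ vanishingIdeal ℂ {q}
          simp
        have h2 := hPM h1
        simp only [f, mem_vanishingIdeal_singleton_iff] at h2
        simpa [sub_eq_zero] using h2
      refine ⟨x ∘ Sum.inr, fun i => ?_⟩
      rw [← hq, Sum.elim_comp_inl_inr]
      have := hPM (hP ⟨i, rfl⟩)
      simpa [mem_vanishingIdeal_singleton_iff, aeval_eq_eval] using this
    · rintro ⟨y, hy⟩
      refine ⟨pointToPoint (Sum.elim q y), ?_, ?_⟩
      · rintro _ ⟨i, rfl⟩
        show _ ∈ vanishingIdeal ℂ {_}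
        simpa [mem_vanishingIdeal_singleton_iff, aeval_eq_eval] using hy i
      · ext p
        show f p ∈ vanishingIdeal ℂ {_} ↔ p ∈ vanishingIdeal ℂ {_}
        simp [f, aeval_rename]
  have hD (q : κ → ℂ) (h : MvPolynomial κ ℂ) (hq : eval q h ≠ 0) :
      (pointToPoint q : PrimeSpectrum (MvPolynomial κ ℂ)) ∈ basicOpen h := by
    rw [mem_basicOpen]
    show h ∉ vanishingIdeal ℂ {_}
    simpa [mem_vanishingIdeal_singleton_iff, aeval_eq_eval] using hq
  obtain ⟨h, hh, hs | hs⟩ :=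
    exists_basicOpen_subset_or_subset_compl (isConstructible_comap_image hf hZ)
  · exact ⟨h, hh, .inl fun q hq => (key q).1 (hs (hD q h hq))⟩
  · exact ⟨h, hh, .inr fun q hq => fun hy => hs (hD q h hq) ((key q).2 hy)⟩

/-- Over a nonempty Zariski open set of parameters `q`, a polynomial system either always or never
has at least `m` solutions. -/
theorem exists_generic_le_encard_or_lt [Finite κ] [Finite σ] [Finite ι]
    (Q : ι → MvPolynomial (κ ⊕ σ) ℂ) (m : ℕ) :
    ∃ h : MvPolynomial κ ℂ, h ≠ 0 ∧
      ((∀ q, eval q h ≠ 0 → m ≤ {y | ∀ i, eval (Sum.elim q y) (Q i) = 0}.encard) ∨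
        ∀ q, eval q h ≠ 0 → {y | ∀ i, eval (Sum.elim q y) (Q i) = 0}.encard < m) := by
  have := Fintype.ofFinite σ
  let D := {p : Fin m × Fin m // p.1 ≠ p.2}
  -- `m` solutions, with certificates `∑ a, u a * (y₁ a - y₂ a) = 1` that they are distinct
  let Q' : (Fin m × ι) ⊕ D → MvPolynomial (κ ⊕ ((Fin m × σ) ⊕ (D × σ))) ℂ :=
    Sum.elim (fun p => rename (Sum.map id (fun a => Sum.inl (p.1, a))) (Q p.2))
      (fun d => ∑ a, X (.inr (.inr (d, a))) *
        (X (.inr (.inl (d.1.1, a))) - X (.inr (.inl (d.1.2, a)))) - 1)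
  have key (q : κ → ℂ) : (∃ y, ∀ i, eval (Sum.elim q y) (Q' i) = 0) ↔
      m ≤ {y | ∀ i, eval (Sum.elim q y) (Q i) = 0}.encard := by
    have comp (y : (Fin m × σ) ⊕ (D × σ) → ℂ) (c : Fin m) :
        Sum.elim q y ∘ Sum.map id (fun a => Sum.inl (c, a)) =
          Sum.elim q fun a => y (.inl (c, a)) := by
      ext (a | a) <;> rfl
    constructor
    · rintro ⟨y, hy⟩
      let g : Fin m → {y | ∀ i, eval (Sum.elim q y) (Q i) = 0} := fun c =>
        ⟨fun a => y (.inl (c, a)), fun i => by simpa [Q', eval_rename, comp] using hy (.inl (c, i))⟩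
      have hg : Function.Injective g := by
        intro c d hcd
        by_contra hne
        have h1 := hy (.inr ⟨(c, d), hne⟩)
        have h2 (a : σ) : y (.inl (c, a)) = y (.inl (d, a)) := congrFun (congrArg Subtype.val hcd) a
        simp [Q', h2] at h1
      have := ENat.card_le_card_of_injective hg
      rwa [ENat.card_eq_coe_fintype_card, Fintype.card_fin] at this
    · intro hm
      obtain ⟨t, hts, htm⟩ := Set.exists_subset_encard_eq hm
      have htf : t.Finite := Set.finite_of_encard_eq_coe htm
      have := htf.fintype
      have hcard : Fintype.card t = m := by
        rw [← Set.coe_fintypeCard] at htm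
        exact_mod_cast htm
      let e := (Fintype.equivFinOfCardEq hcard).symm
      have hne (d : D) : ∃ a, (e d.1.1).1 a - (e d.1.2).1 a ≠ 0 := by
        by_contra! hd
        have h1 : (e d.1.1).1 = (e d.1.2).1 := by
          ext a
          exact sub_eq_zero.1 (hd a)
        exact d.2 (e.injective (Subtype.ext h1))
      choose a ha using hne
      classical
      refine ⟨Sum.elim (fun p => (e p.1).1 p.2)
        (fun p => if p.2 = a p.1 then ((e p.1.1.1).1 p.2 - (e p.1.1.2).1 p.2)⁻¹ else 0), ?_⟩
      rintro (⟨c, i⟩ | d)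
      · simpa [Q', eval_rename, comp] using hts (e c).2 i
      · simp [Q', ha]
  obtain ⟨h, hh, hs⟩ := exists_generic_exists_zero_or_not Q'
  refine ⟨h, hh, ?_⟩
  simpa only [key, not_le] using hs

/-- If a polynomial system has exactly `N` solutions for a Zariski dense set of parameters, then it
has exactly `N` solutions for generic parameters. -/
theorem exists_generic_encard_eq [Finite κ] [Finite σ] [Finite ι]
    (Q : ι → MvPolynomial (κ ⊕ σ) ℂ) (N : ℕ)
    (hN : ∀ g : MvPolynomial κ ℂ, g ≠ 0 → ∃ q, eval q g ≠ 0 ∧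
      {y | ∀ i, eval (Sum.elim q y) (Q i) = 0}.encard = N) :
    ∃ h : MvPolynomial κ ℂ, h ≠ 0 ∧
      ∀ q, eval q h ≠ 0 → {y | ∀ i, eval (Sum.elim q y) (Q i) = 0}.encard = N := by
  obtain ⟨f, hf, hfN | hfN⟩ := exists_generic_le_encard_or_lt Q N
  swap
  · obtain ⟨q, hq, hqN⟩ := hN f hf
    exact absurd (hfN q hq) hqN.not_lt
  obtain ⟨g, hg, hgN | hgN⟩ := exists_generic_le_encard_or_lt Q (N + 1)
  · obtain ⟨q, hq, hqN⟩ := hN g hg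
    have := hgN q hq
    rw [hqN] at this
    exact absurd this (by norm_cast; omega)
  refine ⟨f * g, mul_ne_zero hf hg, fun q hq => ?_⟩
  rw [map_mul] at hq
  refine le_antisymm ?_ (hfN q (left_ne_zero_of_mul hq))
  exact Order.le_of_lt_add_one (by exact_mod_cast hgN q (right_ne_zero_of_mul hq))

end MvPolynomial

open Topology Filter in
/-- If the zeros of `f (·, 0)` are finitely many and nondegenerate, and the zeros of `f (·, t)` stay
in a compact set as `t → 0`, then the number of zeros of `f (·, t)` is constant near `t = 0`. -/
theorem eventually_encard_zeros_eq {E F : Type*} [NormedAddCommGroup E] [NormedSpace ℂ E]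
    [CompleteSpace E] [NormedAddCommGroup F] [NormedSpace ℂ F] {f : E × ℂ → F} (hf : Continuous f)
    {S : Finset E} (hS : ∀ x, f (x, 0) = 0 ↔ x ∈ S)
    (hder : ∀ x ∈ S, ∃ f' : (E × ℂ) ≃L[ℂ] (F × ℂ),
      HasStrictFDerivAt (fun p => (f p, p.2)) (f' : (E × ℂ) →L[ℂ] (F × ℂ)) (x, 0))
    {K : Set E} (hK : IsCompact K) (hfK : ∀ᶠ t in 𝓝 (0 : ℂ), ∀ x, f (x, t) = 0 → x ∈ K) :
    ∀ᶠ t in 𝓝 (0 : ℂ), {x | f (x, t) = 0}.encard = S.card := by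
  obtain ⟨U, hU, hUdisj⟩ := S.finite_toSet.t2_separation
  have local_unique (x : E) (hx : x ∈ S) : ∃ W ⊆ U x, IsOpen W ∧ x ∈ W ∧
      ∀ᶠ t in 𝓝 (0 : ℂ), ∃! y, y ∈ W ∧ f (y, t) = 0 := by
    obtain ⟨f', hf'⟩ := hder x hx
    let e := hf'.toOpenPartialHomeomorph
    have hsource : e.source ∈ 𝓝 ((x, 0) : E × ℂ) :=
      e.open_source.mem_nhds hf'.mem_toOpenPartialHomeomorph_source
    rw [nhds_prod_eq, mem_prod_iff] at hsource
    obtain ⟨A, hA, T, hT, hAT⟩ := hsource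
    obtain ⟨W, hWA, hWo, hxW⟩ := mem_nhds_iff.1 (inter_mem hA ((hU x).2.mem_nhds (hU x).1))
    refine ⟨W, fun y hy => (hWA hy).2, hWo, hxW, ?_⟩
    have himage : (fun p : E × ℂ => (f p, p.2)) '' (W ×ˢ Set.univ) ∈ 𝓝 ((0, 0) : F × ℂ) := by
      have h1 := hf'.map_nhds_eq_of_equiv
      rw [(hS x).2 hx] at h1
      rw [← h1]
      exact image_mem_map (prod_mem_nhds (hWo.mem_nhds hxW) univ_mem)
    have hex : ∀ᶠ t in 𝓝 (0 : ℂ), ((0, t) : F × ℂ) ∈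
        (fun p : E × ℂ => (f p, p.2)) '' (W ×ˢ Set.univ) :=
      (Continuous.prodMk_right (0 : F)).continuousAt.eventually_mem himage
    filter_upwards [hex, hT] with t ht htT
    obtain ⟨⟨y, t'⟩, ⟨hyW, -⟩, hy⟩ := ht
    obtain ⟨hy0, rfl⟩ := Prod.mk.inj hy
    refine ⟨y, ⟨hyW, hy0⟩, fun z ⟨hzW, hz⟩ => ?_⟩
    have := e.injOn (hAT ⟨(hWA hzW).1, htT⟩ : (z, t') ∈ e.source)
      (hAT ⟨(hWA hyW).1, htT⟩ : (y, t') ∈ e.source)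
      (show ((f (z, t'), t') : F × ℂ) = (f (y, t'), t') by rw [hz, hy0])
    exact congrArg Prod.fst this
  choose! W hWU hWo hxW hW using local_unique
  have hout : ∀ᶠ t in 𝓝 (0 : ℂ), ∀ y ∈ K \ ⋃ x ∈ S, W x, f (y, t) ≠ 0 := by
    refine IsCompact.eventually_forall_of_forall_eventually
      (hK.diff (isOpen_biUnion fun x hx => hWo x hx)) fun y hy => ?_
    have hy0 : f (y, 0) ≠ 0 := fun h0 =>
      hy.2 (Set.mem_biUnion ((hS y).1 h0) (hxW y ((hS y).1 h0)))
    have : Continuous fun p : ℂ × E => f (p.2, p.1) := hf.comp continuous_swap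
    exact this.continuousAt.eventually_ne hy0
  have hall : ∀ᶠ t in 𝓝 (0 : ℂ), ∀ x ∈ S, ∃! y, y ∈ W x ∧ f (y, t) = 0 :=
    (eventually_all_finset S).2 hW
  filter_upwards [hfK, hout, hall] with t hK hout hall
  choose! φ hφ hφu using hall
  have himage : {x | f (x, t) = 0} = φ '' S := by
    ext y
    constructor
    · intro hy
      by_contra hne
      refine hout y ⟨hK y hy, fun hyW => hne ?_⟩ hy
      obtain ⟨x, hx, hyx⟩ := Set.mem_iUnion₂.1 hyW
      exact ⟨x, hx, (hφu x hx y ⟨hyx, hy⟩).symm⟩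
    · rintro ⟨x, hx, rfl⟩
      exact (hφ x hx).2
  have hinj : Set.InjOn φ S := by
    intro x hx x' hx' heq
    by_contra hne
    refine Set.disjoint_left.1 (hUdisj hx hx' hne) (hWU x hx (hφ x hx).1) ?_
    rw [heq]
    exact hWU x' hx' (hφ x' hx').1
  rw [himage, hinj.encard_image, Set.encard_coe_eq_coe_finsetCard]

/-- The pairs `(j, s)` with `1 ≤ j ≤ k` and `1 ≤ s ≤ r j`, which index the unknowns. -/
abbrev LevelIndex (k : ℕ) (r : ℕ → ℕ) : Type :=
  {p : ℕ × ℕ // 1 ≤ p.1 ∧ p.1 ≤ k ∧ 1 ≤ p.2 ∧ p.2 ≤ r p.1}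

namespace LevelIndex

variable {k : ℕ} {r : ℕ → ℕ}

instance : Finite (LevelIndex k r) :=
  Finite.of_injective (β := Σ j : Fin (k + 1), Fin (r j + 1))
    (fun p => ⟨⟨p.1.1, Nat.lt_succ_of_le p.2.2.1⟩, ⟨p.1.2, Nat.lt_succ_of_le p.2.2.2.2⟩⟩) <| by
      rintro ⟨⟨j, s⟩, h⟩ ⟨⟨j', s'⟩, h'⟩ heq
      obtain ⟨h1, h2⟩ := Sigma.mk.inj heq
      obtain rfl : j = j' := congrArg Fin.val h1
      obtain rfl : s = s' := congrArg Fin.val (eq_of_heq h2)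
      rfl

noncomputable instance : Fintype (LevelIndex k r) := Fintype.ofFinite _

open Classical in
/-- Extension by zero of a tuple indexed by `LevelIndex k r` to all pairs of natural numbers. -/
noncomputable def extend {A : Type*} [Zero A] (z : LevelIndex k r → A) (j s : ℕ) : A :=
  if h : 1 ≤ j ∧ j ≤ k ∧ 1 ≤ s ∧ s ≤ r j then z ⟨(j, s), h⟩ else 0

variable {A B : Type*} [Zero A] [Zero B]

@[simp]
theorem extend_apply (z : LevelIndex k r → A) (p : LevelIndex k r) :
    extend z p.1.1 p.1.2 = z p :=
  dif_pos p.2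

theorem extend_of_not (z : LevelIndex k r → A) {j s : ℕ}
    (h : ¬(1 ≤ j ∧ j ≤ k ∧ 1 ≤ s ∧ s ≤ r j)) : extend z j s = 0 :=
  dif_neg h

theorem extend_injective : Function.Injective (extend : (LevelIndex k r → A) → ℕ → ℕ → A) :=
  fun z w h => funext fun p => by rw [← extend_apply z, h, extend_apply]

theorem extend_restrict {z : ℕ → ℕ → A}
    (hz : ∀ j s : ℕ, ¬(1 ≤ j ∧ j ≤ k ∧ 1 ≤ s ∧ s ≤ r j) → z j s = 0) :
    extend (fun p : LevelIndex k r => z p.1.1 p.1.2) = z := by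
  funext j s
  by_cases h : 1 ≤ j ∧ j ≤ k ∧ 1 ≤ s ∧ s ≤ r j
  · exact dif_pos h
  · rw [extend_of_not _ h, hz j s h]

theorem map_extend {G : Type*} [FunLike G A B] [ZeroHomClass G A B] (φ : G)
    (z : LevelIndex k r → A) (j s : ℕ) : φ (extend z j s) = extend (fun p => φ (z p)) j s := by
  by_cases h : 1 ≤ j ∧ j ≤ k ∧ 1 ≤ s ∧ s ≤ r j
  · rw [extend, dif_pos h, extend, dif_pos h]
  · rw [extend_of_not _ h, extend_of_not _ h, map_zero]

theorem extend_mul {R : Type*} [MulZeroClass R] (w : ℕ → R) (z : LevelIndex k r → R) (j s : ℕ) :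
    extend (fun p => w p.1.1 * z p) j s = w j * extend z j s := by
  by_cases h : 1 ≤ j ∧ j ≤ k ∧ 1 ≤ s ∧ s ≤ r j
  · rw [extend, dif_pos h, extend, dif_pos h]
  · rw [extend_of_not _ h, extend_of_not _ h, mul_zero]

theorem extend_eq_zero_of_level {z : LevelIndex k r → A} {j : ℕ}
    (hz : ∀ p : LevelIndex k r, p.1.1 = j → z p = 0) (s : ℕ) : extend z j s = 0 := by
  by_cases h : 1 ≤ j ∧ j ≤ k ∧ 1 ≤ s ∧ s ≤ r j
  · rw [extend, dif_pos h]
    exact hz _ rfl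
  · exact extend_of_not _ h

theorem contDiff_extend (j s : ℕ) {n : WithTop ℕ∞} :
    ContDiff ℂ n fun z : LevelIndex k r → ℂ => extend z j s := by
  by_cases h : 1 ≤ j ∧ j ≤ k ∧ 1 ≤ s ∧ s ≤ r j
  · simp only [extend, dif_pos h]
    fun_prop
  · simp only [extend_of_not _ h]
    fun_prop

end LevelIndex

open LevelIndex Finset

/-- The left hand sides of a two-parameter deformation of the system: it is the original one at
`t = u = 1`, it is triangular at `t = 0`, and `u` homogenizes it. -/
noncomputable def deformedSystem {k : ℕ} {r : ℕ → ℕ} (c : ℕ → ℂ) (t u : ℂ) (z : LevelIndex k r → ℂ)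
    (p : LevelIndex k r) : ℂ :=
  ∏ a ∈ Icc 1 (r (p.1.1 + 1)), (z p - t * extend z (p.1.1 + 1) a) -
    c p.1.1 * u ^ (r (p.1.1 + 1) - r (p.1.1 - 1)) *
      ∏ b ∈ Icc 1 (r (p.1.1 - 1)), (t * z p - extend z (p.1.1 - 1) b)

section

variable {k : ℕ} {r : ℕ → ℕ}

theorem contDiff_deformedSystem (c : ℕ → ℂ) {n : WithTop ℕ∞} :
    ContDiff ℂ n fun x : (LevelIndex k r → ℂ) × ℂ × ℂ => deformedSystem c x.2.1 x.2.2 x.1 := by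
  rw [contDiff_pi]
  intro p
  have hext (j s : ℕ) :
      ContDiff ℂ n fun x : (LevelIndex k r → ℂ) × ℂ × ℂ => extend x.1 j s :=
    (contDiff_extend j s).comp contDiff_fst
  unfold deformedSystem
  have h1 (q : LevelIndex k r) : ContDiff ℂ n fun x : (LevelIndex k r → ℂ) × ℂ × ℂ => x.1 q := by
    fun_prop
  have h2 : ContDiff ℂ n fun x : (LevelIndex k r → ℂ) × ℂ × ℂ => x.2.1 := by fun_prop
  have h3 : ContDiff ℂ n fun x : (LevelIndex k r → ℂ) × ℂ × ℂ => x.2.2 := by fun_prop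
  refine ContDiff.sub (contDiff_prod fun a _ => (h1 p).sub (h2.mul (hext _ _))) ?_
  exact (contDiff_const.mul (h3.pow _)).mul
    (contDiff_prod fun b _ => (h2.mul (h1 p)).sub (hext _ _))

theorem deformedSystem_smul (hle : ∀ j, 1 ≤ j → j ≤ k → r (j - 1) ≤ r (j + 1))
    (c : ℕ → ℂ) (t u v : ℂ) (z : LevelIndex k r → ℂ) (p : LevelIndex k r) :
    deformedSystem c t (v * u) (v • z) p = v ^ r (p.1.1 + 1) * deformedSystem c t u z p := by
  have hext (j s : ℕ) : extend (v • z) j s = v * extend z j s := extend_mul (fun _ => v) z j s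
  have h1 (a : ℕ) : v * z p - t * (v * extend z (p.1.1 + 1) a) =
    v * (z p - t * extend z (p.1.1 + 1) a) := by ring
  have h2 (a : ℕ) : t * (v * z p) - v * extend z (p.1.1 - 1) a =
    v * (t * z p - extend z (p.1.1 - 1) a) := by ring
  simp only [deformedSystem, hext, Pi.smul_apply, smul_eq_mul, h1, h2, prod_mul_distrib, prod_const,
    Nat.card_Icc, Nat.add_sub_cancel, mul_pow]
  obtain ⟨d, hd⟩ := Nat.exists_eq_add_of_le (hle p.1.1 p.2.1 p.2.2.1)
  rw [hd, Nat.add_sub_cancel_left, pow_add]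
  ring

theorem deformedSystem_rescale (hle : ∀ j, 1 ≤ j → j ≤ k → r (j - 1) ≤ r (j + 1))
    (c : ℕ → ℂ) (t : ℂ) (z : LevelIndex k r → ℂ) (p : LevelIndex k r) :
    deformedSystem (fun j => c j * t ^ (j * r (j + 1) - (j - 1) * r (j - 1))) 1 1
        (fun p => t ^ p.1.1 * z p) p =
      t ^ (p.1.1 * r (p.1.1 + 1)) * deformedSystem c t 1 z p := by
  obtain ⟨⟨j, s⟩, hp⟩ := p
  obtain ⟨i, rfl⟩ : ∃ i, j = i + 1 := ⟨j - 1, by have := hp.1; omega⟩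
  have hle' := hle _ hp.1 hp.2.1
  have hext (j s : ℕ) : extend (fun p : LevelIndex k r => t ^ p.1.1 * z p) j s =
    t ^ j * extend z j s := extend_mul (fun j => t ^ j) z j s
  have h1 (x y : ℂ) : t ^ (i + 1) * x - 1 * (t ^ (i + 1 + 1) * y) =
    t ^ (i + 1) * (x - t * y) := by ring
  have h2 (x y : ℂ) : 1 * (t ^ (i + 1) * x) - t ^ i * y = t ^ i * (t * x - y) := by ring
  simp only [deformedSystem, hext, Nat.add_sub_cancel, one_pow, h1, h2, prod_mul_distrib,
    prod_const, Nat.card_Icc]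
  simp only [Nat.add_sub_cancel] at hle'
  obtain ⟨d, hd⟩ := Nat.exists_eq_add_of_le
    (Nat.mul_le_mul i.le_succ hle' : i * r i ≤ (i + 1) * r (i + 1 + 1))
  rw [← pow_mul, ← pow_mul, hd, Nat.add_sub_cancel_left, pow_add]
  ring

end

section

variable {k : ℕ} {r : ℕ → ℕ}

theorem eq_zero_of_deformedSystem_zero_zero
    (hpos : ∀ j, 1 ≤ j → j ≤ k + 1 → 0 < r j) (hr0 : r 0 = 0) (c : ℕ → ℂ)
    {z : LevelIndex k r → ℂ} (hz : deformedSystem c 0 0 z = 0) : z = 0 := by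
  have key (j : ℕ) : ∀ p : LevelIndex k r, p.1.1 = j → z p = 0 := by
    induction j with
    | zero => intro p hp; have := p.2.1; omega
    | succ i ih =>
      rintro ⟨⟨j, s⟩, hp⟩ rfl
      have h := congrFun hz ⟨(i + 1, s), hp⟩
      have hterm : (0 : ℂ) ^ (r (i + 1 + 1) - r i) * ∏ b ∈ Icc 1 (r i), -extend z i b = 0 := by
        rcases Nat.eq_zero_or_pos i with rfl | hi
        · have := hpos (0 + 1 + 1) (by omega) (by have := hp.2.1; simp only at this; omega)
          rw [hr0, zero_pow (by omega), zero_mul]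
        · refine mul_eq_zero_of_right _ (prod_eq_zero (i := 1) ?_ ?_)
          · have := hpos i hi (by have := hp.2.1; simp only at this; omega)
            simp only [mem_Icc]
            omega
          · rw [extend_eq_zero_of_level ih, neg_zero]
      simp only [deformedSystem, zero_mul, sub_zero, zero_sub, Nat.add_sub_cancel, mul_assoc, hterm,
        mul_zero, prod_const, Nat.card_Icc, Pi.zero_apply] at h
      exact eq_zero_of_pow_eq_zero h
  exact funext fun p => key _ p rfl

open Topology Filter in
/-- The solutions of the deformed system stay bounded as `t → 0`. -/
theorem exists_bound_zeros_deformedSystem (hle : ∀ j, 1 ≤ j → j ≤ k → r (j - 1) ≤ r (j + 1))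
    (hpos : ∀ j, 1 ≤ j → j ≤ k + 1 → 0 < r j) (hr0 : r 0 = 0) (c : ℕ → ℂ) :
    ∃ M : ℝ, ∀ᶠ t in 𝓝 (0 : ℂ), ∀ z : LevelIndex k r → ℂ,
      deformedSystem c t 1 z = 0 → z ∈ Metric.closedBall 0 M := by
  have hsphere : ∀ᶠ x in 𝓝 ((0, 0) : ℂ × ℂ),
      ∀ z ∈ Metric.sphere (0 : LevelIndex k r → ℂ) 1, deformedSystem c x.1 x.2 z ≠ 0 := by
    refine (isCompact_sphere _ _).eventually_forall_of_forall_eventually fun z hz => ?_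
    have hcont : Continuous fun x : (ℂ × ℂ) × (LevelIndex k r → ℂ) =>
        deformedSystem c x.1.1 x.1.2 x.2 :=
      (contDiff_deformedSystem c (n := 0)).continuous.comp continuous_swap
    refine hcont.continuousAt.eventually_ne fun h0 => ?_
    obtain rfl : z = 0 := eq_zero_of_deformedSystem_zero_zero hpos hr0 c h0
    simp at hz
  rw [nhds_prod_eq, eventually_prod_iff] at hsphere
  obtain ⟨P, hP, Q, hQ, hPQ⟩ := hsphere
  obtain ⟨ε, hε, hεQ⟩ := Metric.eventually_nhds_iff.1 hQ
  refine ⟨ε⁻¹, hP.mono fun t ht z hz => ?_⟩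
  rw [mem_closedBall_zero_iff]
  by_contra! hlt
  have hnorm : 0 < ‖z‖ := (inv_pos.2 hε).trans hlt
  have hv : ‖((‖z‖⁻¹ : ℝ) : ℂ)‖ = ‖z‖⁻¹ := by
    rw [Complex.norm_real, norm_inv, norm_norm]
  refine hPQ ht (y := ((‖z‖⁻¹ : ℝ) : ℂ)) (hεQ ?_) (((‖z‖⁻¹ : ℝ) : ℂ) • z) ?_ ?_
  · rw [dist_zero_right, hv]
    exact inv_lt_of_inv_lt₀ hε hlt
  · rw [mem_sphere_zero_iff_norm, norm_smul, hv, inv_mul_cancel₀ hnorm.ne']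
  · funext p
    have := deformedSystem_smul hle c t 1 ((‖z‖⁻¹ : ℝ) : ℂ) z p
    rw [mul_one] at this
    exact this.trans (by rw [hz, Pi.zero_apply, mul_zero])

theorem deformedSystem_zero_one (c : ℕ → ℂ) (z : LevelIndex k r → ℂ) (p : LevelIndex k r) :
    deformedSystem c 0 1 z p = z p ^ r (p.1.1 + 1) -
      c p.1.1 * ∏ b ∈ Icc 1 (r (p.1.1 - 1)), -extend z (p.1.1 - 1) b := by
  simp [deformedSystem]

theorem ne_zero_of_deformedSystem_zero_one (hpos : ∀ j, 1 ≤ j → j ≤ k + 1 → 0 < r j)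
    (hr0 : r 0 = 0) {c : ℕ → ℂ} (hc : ∀ j, 1 ≤ j → j ≤ k → c j ≠ 0)
    {z : LevelIndex k r → ℂ} (hz : deformedSystem c 0 1 z = 0) (p : LevelIndex k r) :
    z p ≠ 0 := by
  have key (j : ℕ) : ∀ p : LevelIndex k r, p.1.1 = j → z p ≠ 0 := by
    induction j with
    | zero => intro p hp; have := p.2.1; omega
    | succ i ih =>
      rintro ⟨⟨j, s⟩, hp⟩ rfl h0
      have h := congrFun hz ⟨(i + 1, s), hp⟩
      have hp2 : i + 1 ≤ k := hp.2.1
      rw [deformedSystem_zero_one, h0, zero_pow (hpos _ (by simp) (by simpa using hp2)).ne',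
        zero_sub] at h
      refine neg_ne_zero.2 (mul_ne_zero (hc _ hp.1 hp.2.1) (prod_ne_zero_iff.2 fun b hb => ?_)) h
      simp only [Nat.add_sub_cancel, mem_Icc] at hb
      have hi : 1 ≤ i := by
        by_contra! hi
        obtain rfl : i = 0 := by omega
        omega
      exact neg_ne_zero.2 ((extend_apply z ⟨(i, b), hi, by omega, hb⟩).symm ▸
        ih ⟨(i, b), hi, by omega, hb⟩ rfl)
  exact key _ p rfl

/-- The solutions of the triangular system at `t = 0` are nondegenerate. -/
theorem exists_hasStrictFDerivAt_deformedSystem (hpos : ∀ j, 1 ≤ j → j ≤ k + 1 → 0 < r j)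
    (hr0 : r 0 = 0) {c : ℕ → ℂ} (hc : ∀ j, 1 ≤ j → j ≤ k → c j ≠ 0)
    {z : LevelIndex k r → ℂ} (hz : deformedSystem c 0 1 z = 0) :
    ∃ f' : ((LevelIndex k r → ℂ) × ℂ) ≃L[ℂ] ((LevelIndex k r → ℂ) × ℂ),
      HasStrictFDerivAt (fun x : (LevelIndex k r → ℂ) × ℂ => (deformedSystem c x.2 1 x.1, x.2))
        (f' : ((LevelIndex k r → ℂ) × ℂ) →L[ℂ] ((LevelIndex k r → ℂ) × ℂ)) (z, 0) := by
  let G : (LevelIndex k r → ℂ) × ℂ → (LevelIndex k r → ℂ) × ℂ :=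
    fun x => (deformedSystem c x.2 1 x.1, x.2)
  have hG : ContDiff ℂ 1 G :=
    ((contDiff_deformedSystem c).comp
      (contDiff_fst.prodMk (contDiff_snd.prodMk contDiff_const))).prodMk contDiff_snd
  have hG' := hG.contDiffAt.hasStrictFDerivAt (x := (z, 0)) one_ne_zero
  have hinj : Function.Injective (fderiv ℂ G (z, 0)) := by
    refine (injective_iff_map_eq_zero _).2 fun ⟨v, τ⟩ hv => ?_
    have hline : HasDerivAt (fun x : ℂ => ((z, 0) : (LevelIndex k r → ℂ) × ℂ) + x • (v, τ))
        (v, τ) 0 := by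
      simpa using ((hasDerivAt_id (0 : ℂ)).smul_const (v, τ)).const_add
        ((z, 0) : (LevelIndex k r → ℂ) × ℂ)
    have hcomp : HasDerivAt (fun x : ℂ => G ((z, 0) + x • (v, τ))) 0 0 := by
      have h1 : HasFDerivAt G (fderiv ℂ G (z, 0)) ((z, 0) + (0 : ℂ) • (v, τ)) := by
        simpa using hG'.hasFDerivAt
      have h2 := h1.comp_hasDerivAt (0 : ℂ) hline
      rw [hv] at h2
      exact h2
    have hτ : τ = 0 := by
      have h1 : HasDerivAt (fun x : ℂ => 0 + x * τ) 0 0 := hcomp.snd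
      have h2 : HasDerivAt (fun x : ℂ => 0 + x * τ) τ 0 := by
        simpa using ((hasDerivAt_id (0 : ℂ)).mul_const τ).const_add 0
      exact h2.unique h1
    subst hτ
    have key (j : ℕ) : ∀ p : LevelIndex k r, p.1.1 = j → v p = 0 := by
      induction j with
      | zero => intro p hp; have := p.2.1; omega
      | succ i ih =>
        rintro p hp
        have h1 : HasDerivAt (fun x : ℂ => deformedSystem c (0 + x * 0) 1 (z + x • v) p) 0 0 :=
          hasDerivAt_pi.1 hcomp.fst p
        have hext (x : ℂ) (s : ℕ) : extend (z + x • v) i s = extend z i s := by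
          by_cases h : 1 ≤ i ∧ i ≤ k ∧ 1 ≤ s ∧ s ≤ r i
          · simp [extend, dif_pos h, ih ⟨(i, s), h⟩ rfl]
          · rw [extend_of_not _ h, extend_of_not _ h]
        simp only [mul_zero, add_zero, deformedSystem_zero_one, hp, Nat.add_sub_cancel, hext,
          Pi.add_apply, Pi.smul_apply, smul_eq_mul] at h1
        have h2 := (((((hasDerivAt_id (0 : ℂ)).mul_const (v p)).const_add (z p)).pow
          (r (i + 1 + 1))).sub_const (c (i + 1) * ∏ b ∈ Icc 1 (r i), -extend z i b)).unique h1
        have hr := hpos (i + 1 + 1) (by omega) (by have := p.2.2.1; omega)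
        simpa [hr.ne', ne_zero_of_deformedSystem_zero_one hpos hr0 hc hz p] using h2
    rw [show v = 0 from funext fun p => key _ p rfl]
    rfl
  refine ⟨(LinearEquiv.ofInjectiveEndo (fderiv ℂ G (z, 0) : _ →ₗ[ℂ] _)
    hinj).toContinuousLinearEquiv, ?_⟩
  exact hG'

theorem Complex.card_nthRootsFinset {n : ℕ} (hn : 0 < n) {d : ℂ} (hd : d ≠ 0) :
    (Polynomial.nthRootsFinset n d).card = n := by
  classical
  have : NeZero n := ⟨hn.ne'⟩
  have hζ := Complex.isPrimitiveRoot_exp n hn.ne'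
  rw [Polynomial.nthRootsFinset_def, Multiset.toFinset_card_of_nodup (hζ.nthRoots_nodup hd),
    hζ.card_nthRoots, if_pos (IsAlgClosed.exists_pow_nat_eq d hn)]

/-- The first `m` levels of the triangular system at `t = 0` have `∏ j ≤ m, r (j + 1) ^ r j`
solutions. -/
theorem exists_finset_triangular (hr0 : r 0 = 0) {c : ℕ → ℂ} (m : ℕ)
    (hpos : ∀ j, 1 ≤ j → j ≤ m + 1 → 0 < r j) (hc : ∀ j, 1 ≤ j → j ≤ m → c j ≠ 0) :
    ∃ S : Finset (ℕ → ℕ → ℂ),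
      (∀ z : ℕ → ℕ → ℂ, z ∈ S ↔
        (∀ j s : ℕ, ¬(1 ≤ j ∧ j ≤ m ∧ 1 ≤ s ∧ s ≤ r j) → z j s = 0) ∧
        ∀ j s : ℕ, (1 ≤ j ∧ j ≤ m ∧ 1 ≤ s ∧ s ≤ r j) →
          z j s ^ r (j + 1) = c j * ∏ b ∈ Icc 1 (r (j - 1)), -z (j - 1) b) ∧
      (∀ z ∈ S, ∀ s ∈ Icc 1 (r m), z m s ≠ 0) ∧
      S.card = ∏ j ∈ Icc 1 m, r (j + 1) ^ r j := by
  classical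
  induction m with
  | zero =>
    refine ⟨{0}, fun z => ?_, by simp [hr0], by simp⟩
    constructor
    · rintro hz
      rw [mem_singleton.1 hz]
      exact ⟨fun _ _ _ => rfl, fun j s h => by omega⟩
    · rintro ⟨h, -⟩
      exact mem_singleton.2 (funext₂ fun j s => h j s (by omega))
  | succ m ih =>
    obtain ⟨S, hS, hS0, hcard⟩ := ih (fun j h1 h2 => hpos j h1 (by omega))
      (fun j h1 h2 => hc j h1 (by omega))
    have hr := hpos (m + 1 + 1) (by omega) (by omega)
    let d : (ℕ → ℕ → ℂ) → ℂ := fun z => c (m + 1) * ∏ b ∈ Icc 1 (r m), -z m b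
    have hd (z) (hz : z ∈ S) : d z ≠ 0 :=
      mul_ne_zero (hc _ (by omega) le_rfl)
        (prod_ne_zero_iff.2 fun b hb => neg_ne_zero.2 (hS0 z hz b hb))
    let T : Finset (Σ _ : ℕ → ℕ → ℂ, ∀ s ∈ Icc 1 (r (m + 1)), ℂ) :=
      S.sigma fun z => (Icc 1 (r (m + 1))).pi fun _ =>
        Polynomial.nthRootsFinset (r (m + 1 + 1)) (d z)
    let glue : (Σ _ : ℕ → ℕ → ℂ, ∀ s ∈ Icc 1 (r (m + 1)), ℂ) → ℕ → ℕ → ℂ := fun x j s =>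
      if j = m + 1 then (if h : s ∈ Icc 1 (r (m + 1)) then x.2 s h else 0) else x.1 j s
    have glue_of_ne (x j s) (h : j ≠ m + 1) : glue x j s = x.1 j s := if_neg h
    have glue_top (x s) (h : s ∈ Icc 1 (r (m + 1))) : glue x (m + 1) s = x.2 s h :=
      (if_pos rfl).trans (dif_pos h)
    have hinj : Set.InjOn glue T := by
      rintro ⟨z, w⟩ hx ⟨z', w'⟩ hx' heq
      have hz := ((hS z).1 (mem_sigma.1 hx).1).1
      have hz' := ((hS z').1 (mem_sigma.1 hx').1).1
      obtain rfl : z = z' := by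
        funext j s
        by_cases h : j = m + 1
        · rw [hz j s (by omega), hz' j s (by omega)]
        · exact (glue_of_ne ⟨z, w⟩ j s h).symm.trans
            (heq ▸ glue_of_ne ⟨z', w'⟩ j s h)
      obtain rfl : w = w' := by
        funext s hs
        exact (glue_top ⟨z, w⟩ s hs).symm.trans (heq ▸ glue_top ⟨z, w'⟩ s hs)
      rfl
    have hmem (z : ℕ → ℕ → ℂ) : z ∈ T.image glue ↔
        (∀ j s : ℕ, ¬(1 ≤ j ∧ j ≤ m + 1 ∧ 1 ≤ s ∧ s ≤ r j) → z j s = 0) ∧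
        ∀ j s : ℕ, (1 ≤ j ∧ j ≤ m + 1 ∧ 1 ≤ s ∧ s ≤ r j) →
          z j s ^ r (j + 1) = c j * ∏ b ∈ Icc 1 (r (j - 1)), -z (j - 1) b := by
      constructor
      · intro hz
        obtain ⟨⟨y, w⟩, hx, rfl⟩ := mem_image.1 hz
        obtain ⟨hy, hw⟩ := mem_sigma.1 hx
        obtain ⟨hy0, hyeq⟩ := (hS y).1 hy
        constructor
        · intro j s h
          by_cases hj : j = m + 1
          · subst hj
            exact (if_pos rfl).trans (dif_neg (by simp only [mem_Icc]; omega))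
          · rw [glue_of_ne _ _ _ hj]
            exact hy0 j s (by omega)
        · intro j s h
          by_cases hj : j = m + 1
          · subst hj
            have hs : s ∈ Icc 1 (r (m + 1)) := mem_Icc.2 h.2.2
            rw [glue_top _ _ hs, (Polynomial.mem_nthRootsFinset hr _).1 (mem_pi.1 hw s hs)]
            simp [d, glue]
          · rw [glue_of_ne _ _ _ hj, hyeq j s (by omega)]
            simp only [glue_of_ne _ (j - 1) _ (by omega : j - 1 ≠ m + 1)]
      · rintro ⟨hz0, hzeq⟩
        let y : ℕ → ℕ → ℂ := fun j s => if j = m + 1 then 0 else z j s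
        have hy_of_ne (j s) (h : j ≠ m + 1) : y j s = z j s := if_neg h
        have hy : y ∈ S := by
          refine (hS y).2 ⟨fun j s h => ?_, fun j s h => ?_⟩
          · by_cases hj : j = m + 1
            · exact if_pos hj
            · rw [hy_of_ne _ _ hj]
              exact hz0 j s (by omega)
          · rw [hy_of_ne _ _ (by omega), hzeq j s (by omega)]
            simp only [hy_of_ne (j - 1) _ (by omega)]
        refine mem_image.2 ⟨⟨y, fun s _ => z (m + 1) s⟩, mem_sigma.2 ⟨hy, mem_pi.2 fun s hs => ?_⟩, ?_⟩
        · rw [Polynomial.mem_nthRootsFinset hr, hzeq (m + 1) s ⟨by omega, le_rfl, mem_Icc.1 hs⟩]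
          simp [d, y]
        · funext j s
          by_cases hj : j = m + 1
          · subst hj
            by_cases hs : s ∈ Icc 1 (r (m + 1))
            · rw [glue_top _ _ hs]
            · rw [hz0 _ _ (by simp only [mem_Icc] at hs; omega)]
              exact (if_pos rfl).trans (dif_neg hs)
          · rw [glue_of_ne _ _ _ hj]
            exact hy_of_ne _ _ hj
    refine ⟨T.image glue, hmem, fun z hz s hs => ?_, ?_⟩
    · obtain ⟨⟨y, w⟩, hx, rfl⟩ := mem_image.1 hz
      obtain ⟨hy, hw⟩ := mem_sigma.1 hx
      have hpow := (Polynomial.mem_nthRootsFinset hr _).1 (mem_pi.1 hw s hs)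
      rw [glue_top _ _ hs]
      exact ne_zero_pow hr.ne' (hpow ▸ hd y hy)
    · have hfiber (z) (hz : z ∈ S) : ((Icc 1 (r (m + 1))).pi fun _ =>
          Polynomial.nthRootsFinset (r (m + 1 + 1)) (d z)).card = r (m + 1 + 1) ^ r (m + 1) := by
        rw [card_pi, prod_const, Complex.card_nthRootsFinset hr (hd z hz), Nat.card_Icc,
          Nat.add_sub_cancel]
      rw [card_image_of_injOn hinj, card_sigma, sum_congr rfl hfiber, sum_const, smul_eq_mul,
        hcard, prod_Icc_succ_top (by omega)]

end

section

variable {k : ℕ} {r : ℕ → ℕ}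

/-- The triangular system at `t = 0` has `∏ j, r (j + 1) ^ r j` solutions. -/
theorem exists_finset_deformedSystem_zero_one (hpos : ∀ j, 1 ≤ j → j ≤ k + 1 → 0 < r j)
    (hr0 : r 0 = 0) {c : ℕ → ℂ} (hc : ∀ j, 1 ≤ j → j ≤ k → c j ≠ 0) :
    ∃ S : Finset (LevelIndex k r → ℂ), (∀ z, deformedSystem c 0 1 z = 0 ↔ z ∈ S) ∧
      S.card = ∏ j ∈ Icc 1 k, r (j + 1) ^ r j := by
  classical
  obtain ⟨S, hS, -, hcard⟩ := exists_finset_triangular hr0 k hpos hc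
  refine ⟨S.preimage extend extend_injective.injOn, fun z => ?_, ?_⟩
  · rw [mem_preimage, hS]
    refine ⟨fun hz => ⟨fun j s h => extend_of_not z h, fun j s h => ?_⟩, fun hz => ?_⟩
    · have := congrFun hz ⟨(j, s), h⟩
      rw [deformedSystem_zero_one, Pi.zero_apply, sub_eq_zero] at this
      rw [← this]
      exact congrArg (· ^ _) (extend_apply z ⟨(j, s), h⟩)
    · funext p
      rw [deformedSystem_zero_one, Pi.zero_apply, sub_eq_zero, ← hz.2 p.1.1 p.1.2 p.2, extend_apply]
  · rw [← hcard, card_preimage, filter_true_of_mem]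
    exact fun z hz => ⟨_, extend_restrict ((hS z).1 hz).1⟩

/-- For small `t` the deformed system has `∏ j, r (j + 1) ^ r j` solutions. -/
theorem eventually_encard_deformedSystem (hle : ∀ j, 1 ≤ j → j ≤ k → r (j - 1) ≤ r (j + 1))
    (hpos : ∀ j, 1 ≤ j → j ≤ k + 1 → 0 < r j) (hr0 : r 0 = 0) {c : ℕ → ℂ}
    (hc : ∀ j, 1 ≤ j → j ≤ k → c j ≠ 0) :
    ∀ᶠ t in nhds (0 : ℂ), {z : LevelIndex k r → ℂ | deformedSystem c t 1 z = 0}.encard =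
      (∏ j ∈ Icc 1 k, r (j + 1) ^ r j : ℕ) := by
  obtain ⟨S, hS, hcard⟩ := exists_finset_deformedSystem_zero_one hpos hr0 hc
  obtain ⟨M, hM⟩ := exists_bound_zeros_deformedSystem hle hpos hr0 c
  rw [← hcard]
  refine eventually_encard_zeros_eq
    (f := fun x : (LevelIndex k r → ℂ) × ℂ => deformedSystem c x.2 1 x.1) ?_ hS
    (fun z hz => exists_hasStrictFDerivAt_deformedSystem hpos hr0 hc ((hS z).2 hz))
    (isCompact_closedBall 0 M) hM
  exact ((contDiff_deformedSystem c (n := 0)).comp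
    (contDiff_fst.prodMk (contDiff_snd.prodMk contDiff_const))).continuous

/-- The parameters `q 1, …, q k`, given by a tuple indexed by `Fin k`, as a sequence. -/
noncomputable def parameterSeq {A : Type*} [Zero A] (q : Fin k → A) (j : ℕ) : A :=
  if h : j - 1 < k then q ⟨j - 1, h⟩ else 0

theorem parameterSeq_of_le {A : Type*} [Zero A] (q : Fin k → A) {j : ℕ} (h1 : 1 ≤ j) (hj : j ≤ k) :
    parameterSeq q j = q ⟨j - 1, by omega⟩ :=
  dif_pos (by omega)

open MvPolynomial in
/-- The equations of the system as polynomials in the parameters and the unknowns. -/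
noncomputable def systemPolynomial (p : LevelIndex k r) :
    MvPolynomial (Fin k ⊕ LevelIndex k r) ℂ :=
  ∏ a ∈ Icc 1 (r (p.1.1 + 1)),
      (X (.inr p) - extend (fun p : LevelIndex k r => X (.inr p)) (p.1.1 + 1) a) -
    parameterSeq (fun i => X (.inl i)) p.1.1 * ∏ b ∈ Icc 1 (r (p.1.1 - 1)),
      (X (.inr p) - extend (fun p : LevelIndex k r => X (.inr p)) (p.1.1 - 1) b)

theorem eval_systemPolynomial (q : Fin k → ℂ) (z : LevelIndex k r → ℂ) (p : LevelIndex k r) :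
    MvPolynomial.eval (Sum.elim q z) (systemPolynomial p) =
      deformedSystem (parameterSeq q) 1 1 z p := by
  simp [systemPolynomial, deformedSystem, map_extend,
    parameterSeq_of_le _ p.2.1 p.2.2.1]

open Topology Filter in
/-- The set of parameters for which the system has `∏ j, r (j + 1) ^ r j` solutions is Zariski
dense. -/
theorem exists_parameter_encard_eq (hle : ∀ j, 1 ≤ j → j ≤ k → r (j - 1) ≤ r (j + 1))
    (hpos : ∀ j, 1 ≤ j → j ≤ k + 1 → 0 < r j) (hr0 : r 0 = 0)
    {g : MvPolynomial (Fin k) ℂ} (hg : g ≠ 0) :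
    ∃ q : Fin k → ℂ, MvPolynomial.eval q g ≠ 0 ∧
      {z : LevelIndex k r → ℂ | deformedSystem (parameterSeq q) 1 1 z = 0}.encard =
        (∏ j ∈ Icc 1 k, r (j + 1) ^ r j : ℕ) := by
  obtain ⟨c, hcg⟩ : ∃ c, MvPolynomial.eval c (g * ∏ i, MvPolynomial.X i) ≠ 0 := by
    by_contra! h
    have hne : g * ∏ i, (MvPolynomial.X i : MvPolynomial (Fin k) ℂ) ≠ 0 :=
      mul_ne_zero hg (prod_ne_zero_iff.2 fun i _ => MvPolynomial.X_ne_zero i)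
    exact hne (MvPolynomial.funext fun c => by rw [h c, map_zero])
  rw [map_mul] at hcg
  have hci (i : Fin k) : c i ≠ 0 := by
    have := right_ne_zero_of_mul hcg
    rw [map_prod, prod_ne_zero_iff] at this
    simpa using this i (mem_univ i)
  have hc (j : ℕ) (h1 : 1 ≤ j) (hj : j ≤ k) : parameterSeq c j ≠ 0 := by
    rw [parameterSeq_of_le c h1 hj]
    exact hci _
  let e : ℕ → ℕ := fun j => j * r (j + 1) - (j - 1) * r (j - 1)
  let q : ℂ → Fin k → ℂ := fun t i => c i * t ^ e (i + 1)
  let P : Polynomial ℂ :=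
    MvPolynomial.aeval (fun i : Fin k => Polynomial.C (c i) * Polynomial.X ^ e (i + 1)) g
  have hP (t : ℂ) : P.eval t = MvPolynomial.eval (q t) g := by
    have : (Polynomial.aeval t).comp (MvPolynomial.aeval fun i : Fin k =>
        Polynomial.C (c i) * Polynomial.X ^ e (i + 1)) = MvPolynomial.aeval (R := ℂ) (q t) :=
      MvPolynomial.algHom_ext fun i => by simp [q]
    simpa [Polynomial.coe_aeval_eq_eval, MvPolynomial.aeval_eq_eval] using DFunLike.congr_fun this g
  have hP0 : P ≠ 0 := by
    intro h0
    have := hP 1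
    rw [h0, Polynomial.eval_zero] at this
    exact left_ne_zero_of_mul hcg (by simpa [q] using this.symm)
  have hPev : ∀ᶠ t in 𝓝[≠] (0 : ℂ), P.eval t ≠ 0 := by
    have hfin : ({t | P.IsRoot t} \ {0}).Finite := (Polynomial.finite_setOfPred_isRoot hP0).sdiff
    filter_upwards [nhdsWithin_le_nhds (hfin.isClosed.isOpen_compl.mem_nhds (x := 0) (by simp)),
      self_mem_nhdsWithin] with t ht ht0 htP
    exact ht ⟨htP, ht0⟩
  obtain ⟨t, htP, htN, ht0⟩ := (hPev.and
    (((eventually_encard_deformedSystem hle hpos hr0 hc).filter_mono nhdsWithin_le_nhds).and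
      self_mem_nhdsWithin)).exists
  replace ht0 : t ≠ 0 := ht0
  refine ⟨q t, hP t ▸ htP, ?_⟩
  rw [← htN]
  let φ : (LevelIndex k r → ℂ) → LevelIndex k r → ℂ := fun z p => t ^ p.1.1 * z p
  have hφ : Function.Bijective φ := by
    refine Function.bijective_iff_has_inverse.2
      ⟨fun z p => (t ^ p.1.1)⁻¹ * z p, fun z => ?_, fun z => ?_⟩ <;>
    · funext p
      have : t ^ p.1.1 ≠ 0 := pow_ne_zero _ ht0
      simp [φ, this]
  have hiff (z : LevelIndex k r → ℂ) : deformedSystem (parameterSeq (q t)) 1 1 (φ z) = 0 ↔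
      deformedSystem (parameterSeq c) t 1 z = 0 := by
    rw [funext_iff, funext_iff]
    refine forall_congr' fun p => ?_
    have h1 := deformedSystem_rescale hle (parameterSeq c) t z p
    have h2 : deformedSystem (parameterSeq (q t)) 1 1 (φ z) p =
        t ^ (p.1.1 * r (p.1.1 + 1)) * deformedSystem (parameterSeq c) t 1 z p := by
      rw [← h1]
      simp only [deformedSystem, parameterSeq_of_le _ p.2.1 p.2.2.1, q, e,
        Nat.sub_add_cancel p.2.1, φ]
    rw [h2]
    simp [ht0]
  rw [← Set.encard_preimage_of_bijective hφ]
  congr 1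
  ext z
  exact hiff z

end

/-- For generic nonzero `q = (q_1,…,q_k)`, the system `(P_q)` has exactly
`∏_{j=1}^k r_{j+1}^{r_j}` solutions. -/
theorem stmt_0 (k n : ℕ) (hk : 1 ≤ k) (r : ℕ → ℕ)
    (hr0 : r 0 = 0) (hr1 : 0 < r 1)
    (hmono : ∀ j, 1 ≤ j → j ≤ k → r j ≤ r (j + 1))
    (hrn : r (k + 1) = n) :
    ∃ h : MvPolynomial (Fin k) ℂ, h ≠ 0 ∧
      ∀ q : ℕ → ℂ, (∀ j ∈ Finset.Icc 1 k, q j ≠ 0) →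
        MvPolynomial.eval (fun i : Fin k => q (i.1 + 1)) h ≠ 0 →
        ∃ S : Finset (ℕ → ℕ → ℂ),
          (∀ z : ℕ → ℕ → ℂ, z ∈ S ↔
            ((∀ j s : ℕ, ¬(1 ≤ j ∧ j ≤ k ∧ 1 ≤ s ∧ s ≤ r j) → z j s = 0) ∧
             ∀ j ∈ Finset.Icc 1 k, ∀ s ∈ Finset.Icc 1 (r j),
               (∏ a ∈ Finset.Icc 1 (r (j + 1)), (z j s - z (j + 1) a)) -
                 q j * ∏ b ∈ Finset.Icc 1 (r (j - 1)), (z j s - z (j - 1) b) = 0)) ∧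
          S.card = ∏ j ∈ Finset.Icc 1 k, r (j + 1) ^ r j := by
  classical
  have hpos (j : ℕ) (h1 : 1 ≤ j) (hj : j ≤ k + 1) : 0 < r j := by
    induction j, h1 using Nat.le_induction with
    | base => exact hr1
    | succ i hi ih => exact (ih (by omega)).trans_le (hmono i hi (by omega))
  have hle (j : ℕ) (h1 : 1 ≤ j) (hj : j ≤ k) : r (j - 1) ≤ r (j + 1) := by
    rcases h1.eq_or_lt with rfl | h1
    · simp [hr0]
    · have := hmono (j - 1) (by omega) (by omega)
      rw [Nat.sub_add_cancel (by omega)] at this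
      exact this.trans (hmono j (by omega) hj)
  obtain ⟨h, hh, hN⟩ := MvPolynomial.exists_generic_encard_eq
    (systemPolynomial : LevelIndex k r → _) (∏ j ∈ Icc 1 k, r (j + 1) ^ r j) fun g hg => by
      obtain ⟨q, hq, hqN⟩ := exists_parameter_encard_eq hle hpos hr0 hg
      refine ⟨q, hq, ?_⟩
      simpa only [eval_systemPolynomial, funext_iff, Pi.zero_apply] using hqN
  refine ⟨h, hh, fun q _ hq => ?_⟩
  have hqN := hN _ hq
  have hfin := Set.finite_of_encard_eq_coe hqN
  refine ⟨hfin.toFinset.image extend, fun z => ?_, ?_⟩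
  · have hiff (w : LevelIndex k r → ℂ) : w ∈ hfin.toFinset ↔
        ∀ j ∈ Icc 1 k, ∀ s ∈ Icc 1 (r j),
          (∏ a ∈ Icc 1 (r (j + 1)), (extend w j s - extend w (j + 1) a)) -
            q j * ∏ b ∈ Icc 1 (r (j - 1)), (extend w j s - extend w (j - 1) b) = 0 := by
      have hw (p : LevelIndex k r) : MvPolynomial.eval (Sum.elim (fun i : Fin k => q (i.1 + 1)) w)
          (systemPolynomial p) = (∏ a ∈ Icc 1 (r (p.1.1 + 1)),
            (extend w p.1.1 p.1.2 - extend w (p.1.1 + 1) a)) - q p.1.1 *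
              ∏ b ∈ Icc 1 (r (p.1.1 - 1)), (extend w p.1.1 p.1.2 - extend w (p.1.1 - 1) b) := by
        simp [eval_systemPolynomial, deformedSystem, parameterSeq_of_le _ p.2.1 p.2.2.1,
          Nat.sub_add_cancel p.2.1]
      simp only [Set.Finite.mem_toFinset, Set.mem_ofPred_eq, hw]
      refine ⟨fun hp j hj s hs => ?_, fun hp p => ?_⟩
      · exact hp ⟨(j, s), (mem_Icc.1 hj).1, (mem_Icc.1 hj).2, mem_Icc.1 hs⟩
      · exact hp _ (mem_Icc.2 ⟨p.2.1, p.2.2.1⟩) _ (mem_Icc.2 p.2.2.2)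
    rw [mem_image]
    constructor
    · rintro ⟨w, hw, rfl⟩
      exact ⟨fun j s => extend_of_not w, (hiff w).1 hw⟩
    · rintro ⟨hz0, hz⟩
      refine ⟨fun p => z p.1.1 p.1.2, (hiff _).2 ?_, extend_restrict hz0⟩
      rwa [extend_restrict hz0]
  · rw [card_image_of_injective _ extend_injective]
    rw [hfin.encard_eq_coe_toFinset_card] at hqN
    exact_mod_cast hqN
end

section
/- There exists a nonzero polynomial h in the polynomial ring ℂ[q_1,…,q_k] such that for every q = (q_1,…,q_k) ∈ ℂ^k with q_j ≠ 0 for all j and h(q) ≠ 0, the set of tuples z = (z_{s,j}) ∈ ℂ^{|r|} satisfying the system (P_q) and moreover satisfying z_{s,j} ≠ z_{u,j} for every 1 ≤ j ≤ k and all 1 ≤ s ≠ u ≤ r_j, is finite and has cardinality exactly ∏_{j=1}^k r_{j+1}! / (r_{j+1} − r_j)!. -/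
/-- A finite type algebra into which `ℂ[q₁, …, qₖ]` injects has a complex point over every `q`
outside some hypersurface. -/
theorem MvPolynomial.exists_ne_zero_forall_exists_ringHom_comp_eq_eval {σ S : Type} [Finite σ]
    [CommRing S] [Algebra (MvPolynomial σ ℂ) S] [Algebra.FiniteType (MvPolynomial σ ℂ) S]
    (hinj : Function.Injective (algebraMap (MvPolynomial σ ℂ) S)) :
    ∃ f : MvPolynomial σ ℂ, f ≠ 0 ∧ ∀ q : σ → ℂ, MvPolynomial.eval q f ≠ 0 →
      ∃ φ : S →+* ℂ, φ.comp (algebraMap (MvPolynomial σ ℂ) S) = MvPolynomial.eval q := by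
  have hfp : (algebraMap (MvPolynomial σ ℂ) S).FinitePresentation :=
    RingHom.finitePresentation_algebraMap.mpr (Algebra.FinitePresentation.of_finiteType.mp ‹_›)
  obtain ⟨D, hD⟩ := PrimeSpectrum.exists_constructibleSetData_iff.mpr
    (PrimeSpectrum.isConstructible_range_comap hfp)
  have hbot : (⊥ : PrimeSpectrum (MvPolynomial σ ℂ)) ∈ D.toSet := by
    obtain ⟨P, hP, hPe⟩ := Ideal.exists_comap_eq_of_mem_minimalPrimes_of_injective hinj ⊥
      (by rw [IsDomain.minimalPrimes_eq_singleton_bot]; rfl)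
    rw [hD]
    exact ⟨⟨P, hP⟩, PrimeSpectrum.ext hPe⟩
  simp only [PrimeSpectrum.ConstructibleSetData.toSet, Set.mem_iUnion] at hbot
  obtain ⟨C, hC, hg, hf⟩ := hbot
  have hg0 : ∀ i, C.g i = 0 := fun i => by simpa using hg ⟨i, rfl⟩
  refine ⟨C.f, fun h => hf (by simp [h]), fun q hq => ?_⟩
  have hprime : (RingHom.ker (MvPolynomial.eval q)).IsPrime := RingHom.ker_isPrime _
  have hmem : (⟨_, hprime⟩ : PrimeSpectrum (MvPolynomial σ ℂ)) ∈ D.toSet := by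
    simp only [PrimeSpectrum.ConstructibleSetData.toSet, Set.mem_iUnion]
    refine ⟨C, hC, ?_, fun h => hq (by simpa using h)⟩
    rintro _ ⟨i, rfl⟩
    simp [hg0]
  rw [hD] at hmem
  obtain ⟨P, hP⟩ := hmem
  obtain ⟨M, hM, hPM⟩ := Ideal.exists_le_maximal P.asIdeal P.isPrime.ne_top
  have hker : ∀ p, MvPolynomial.eval q p = 0 → algebraMap (MvPolynomial σ ℂ) S p ∈ M :=
    fun p hp => hPM <| by
      have : p ∈ (PrimeSpectrum.comap (algebraMap (MvPolynomial σ ℂ) S) P).asIdeal := by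
        rw [hP]; exact hp
      exact this
  let _ := Ideal.Quotient.field M
  let _ : Algebra ℂ (S ⧸ M) :=
    ((algebraMap (MvPolynomial σ ℂ) (S ⧸ M)).comp (algebraMap ℂ (MvPolynomial σ ℂ))).toAlgebra
  have : IsScalarTower ℂ (MvPolynomial σ ℂ) (S ⧸ M) := IsScalarTower.of_algebraMap_eq' rfl
  have : Algebra.FiniteType (MvPolynomial σ ℂ) (S ⧸ M) :=
    Algebra.FiniteType.trans (S := S) inferInstance inferInstance
  have : Algebra.FiniteType ℂ (S ⧸ M) :=
    Algebra.FiniteType.trans (S := MvPolynomial σ ℂ) inferInstance inferInstance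
  have : Module.Finite ℂ (S ⧸ M) := finite_of_finite_type_of_isJacobsonRing ℂ (S ⧸ M)
  have hbij : Function.Bijective (algebraMap ℂ (S ⧸ M)) :=
    IsAlgClosed.algebraMap_bijective_of_isIntegral
  let e := RingEquiv.ofBijective _ hbij
  refine ⟨(e.symm : (S ⧸ M) →+* ℂ).comp (Ideal.Quotient.mk M), RingHom.ext fun p => ?_⟩
  change e.symm (Ideal.Quotient.mk M (algebraMap _ S p)) = _
  rw [RingEquiv.symm_apply_eq]
  change _ = Ideal.Quotient.mk M (algebraMap _ S (MvPolynomial.C (MvPolynomial.eval q p)))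
  rw [Ideal.Quotient.eq, ← map_sub]
  exact hker _ (by simp)

open Polynomial in
/-- If `∏ (X - yᵢ)` divides a monic polynomial of degree `d` over (the image of) a finite
`ℂ`-algebra `D`, then all the `yᵢ` lie in the image of an algebra of dimension at most
`dim D * d (d - 1) ⋯`. -/
theorem exists_algHom_mem_range_of_prod_X_sub_C_mul {G ι : Type} [CommRing G] [Algebra ℂ G]
    (y : ι → G) (s : Finset ι) :
    ∀ (D : Type) [CommRing D] [Algebra ℂ D] [Module.Finite ℂ D] (φ : D →ₐ[ℂ] G) (F : D[X])
      (Q : G[X]), F.Monic → (∏ i ∈ s, (X - C (y i))) * Q = F.map (φ : D →+* G) →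
      ∃ (D' : Type) (_ : CommRing D') (_ : Algebra ℂ D') (_ : Module.Finite ℂ D')
        (φ' : D' →ₐ[ℂ] G),
        Module.finrank ℂ D' ≤ Module.finrank ℂ D * F.natDegree.descFactorial s.card ∧
        φ.range ≤ φ'.range ∧ ∀ i ∈ s, y i ∈ φ'.range := by
  classical
  induction s using Finset.induction_on with
  | empty =>
    intro D _ _ _ φ F Q hF h
    exact ⟨D, _, _, ‹_›, φ, by simp, le_rfl, by simp⟩
  | insert i s his ih =>
    intro D _ _ _ φ F Q hF h
    have hroot : F.eval₂ (φ : D →+* G) (y i) = 0 := by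
      rw [← eval_map, ← h, Finset.prod_insert his]
      simp
    have : Module.Finite D (AdjoinRoot F) := hF.finite_adjoinRoot
    have : Module.Free D (AdjoinRoot F) := hF.free_adjoinRoot
    have : Module.Finite ℂ (AdjoinRoot F) := Module.Finite.trans D _
    let φ₁ : AdjoinRoot F →ₐ[ℂ] G := AdjoinRoot.liftAlgHom F φ (y i) hroot
    have hle : φ.range ≤ φ₁.range := by
      rintro _ ⟨d, rfl⟩
      exact ⟨AdjoinRoot.of F d, by simp [φ₁]⟩
    have hy : y i ∈ φ₁.range := ⟨AdjoinRoot.root F, by simp [φ₁]⟩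
    rcases subsingleton_or_nontrivial (AdjoinRoot F) with hsub | hnt
    · have : Subsingleton G := by
        refine subsingleton_of_zero_eq_one ?_
        rw [← map_zero φ₁, ← map_one φ₁, Subsingleton.elim (0 : AdjoinRoot F) 1]
      refine ⟨AdjoinRoot F, _, _, ‹_›, φ₁, ?_, hle, fun j _ => ?_⟩
      · rw [Module.finrank_zero_of_subsingleton]; exact Nat.zero_le _
      · rw [Subsingleton.elim (y j) 0]; exact zero_mem _
    have : Nontrivial D := (AdjoinRoot.of F).domain_nontrivial
    have hdvd : (X - C (AdjoinRoot.root F)) ∣ F.map (AdjoinRoot.of F) := by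
      rw [dvd_iff_isRoot]
      exact AdjoinRoot.isRoot_root F
    obtain ⟨F₁, hF₁⟩ := hdvd
    have hmon : F₁.Monic :=
      Monic.of_mul_monic_left (monic_X_sub_C _) (by rw [← hF₁]; exact hF.map _)
    have hdeg : F.natDegree = F₁.natDegree + 1 := by
      rw [← hF.natDegree_map (AdjoinRoot.of F), hF₁, (monic_X_sub_C _).natDegree_mul hmon,
        natDegree_X_sub_C, add_comm]
    have hmap : (∏ j ∈ s, (X - C (y j))) * Q = F₁.map (φ₁ : AdjoinRoot F →+* G) := by
      refine (monic_X_sub_C (y i)).isRegular.left ?_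
      have hcomp : F.map (φ : D →+* G) =
          (F.map (AdjoinRoot.of F)).map (φ₁ : AdjoinRoot F →+* G) := by
        rw [Polynomial.map_map]
        congr 1
        ext d
        simp [φ₁]
      change (X - C (y i)) * _ = (X - C (y i)) * _
      rw [← mul_assoc, ← Finset.prod_insert (f := fun j => X - C (y j)) his, h, hcomp, hF₁]
      simp [φ₁]
    obtain ⟨D', i₁, i₂, i₃, φ', hfr, hle', hmem⟩ := ih (AdjoinRoot F) φ₁ F₁ Q hmon hmap
    refine ⟨D', i₁, i₂, i₃, φ', ?_, hle.trans hle', ?_⟩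
    · refine hfr.trans (le_of_eq ?_)
      rw [← Module.finrank_mul_finrank ℂ D (AdjoinRoot F), Finset.card_insert_of_notMem his, hdeg,
        Nat.succ_descFactorial_succ, ← hdeg, mul_assoc,
        show Module.finrank D (AdjoinRoot F) = F.natDegree from
          (AdjoinRoot.powerBasis' hF).finrank]
    · intro j hj
      rcases Finset.mem_insert.mp hj with rfl | hj
      · exact hle' hy
      · exact hmem j hj

open Polynomial in
/-- Successive divisibilities `∏ (X - y j s) ∣ ∏ (X - y (j + 1) a)` starting from
`y (k + 1) = 0` bound the dimension of the algebra generated by the `y j s`. -/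
theorem exists_algHom_mem_range_of_prod_dvd {G : Type} [CommRing G] [Algebra ℂ G] (k : ℕ)
    (r : ℕ → ℕ) (y : ℕ → ℕ → G) (htop : ∀ a, y (k + 1) a = 0)
    (hdvd : ∀ j ∈ Finset.Icc 1 k, (∏ s ∈ Finset.Icc 1 (r j), (X - C (y j s))) ∣
      ∏ a ∈ Finset.Icc 1 (r (j + 1)), (X - C (y (j + 1) a))) :
    ∃ (D : Type) (_ : CommRing D) (_ : Algebra ℂ D) (_ : Module.Finite ℂ D) (φ : D →ₐ[ℂ] G),
      Module.finrank ℂ D ≤ ∏ j ∈ Finset.Icc 1 k, (r (j + 1)).descFactorial (r j) ∧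
      ∀ j ∈ Finset.Icc 1 k, ∀ s ∈ Finset.Icc 1 (r j), y j s ∈ φ.range := by
  suffices H : ∀ i ≤ k, ∃ (D : Type) (_ : CommRing D) (_ : Algebra ℂ D) (_ : Module.Finite ℂ D)
      (φ : D →ₐ[ℂ] G),
      Module.finrank ℂ D ≤ ∏ j ∈ Finset.Icc (i + 1) k, (r (j + 1)).descFactorial (r j) ∧
      ∀ j ∈ Finset.Icc (i + 1) (k + 1), ∀ s ∈ Finset.Icc 1 (r j), y j s ∈ φ.range by
    obtain ⟨D, i₁, i₂, i₃, φ, h₁, h₂⟩ := H 0 (Nat.zero_le k)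
    exact ⟨D, i₁, i₂, i₃, φ, h₁, fun j hj => h₂ j (by simp at hj ⊢; omega)⟩
  intro i hi
  induction hi using Nat.decreasingInduction with
  | self =>
    refine ⟨ℂ, _, _, inferInstance, Algebra.ofId ℂ G, by simp, fun j hj s _ => ?_⟩
    obtain rfl : j = k + 1 := by simpa using hj
    rw [htop]
    exact zero_mem _
  | of_succ i hi ih =>
    obtain ⟨D, i₁, i₂, i₃, φ, hfr, hmem⟩ := ih
    obtain ⟨Q, hQ⟩ := hdvd (i + 1) (by simp; omega)
    have hm : ∀ s ∈ Finset.Icc 1 (r (i + 1 + 1)), ∃ d : D, φ d = y (i + 1 + 1) s :=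
      fun s hs => hmem (i + 1 + 1) (by simp; omega) s hs
    choose! d hd using hm
    rcases subsingleton_or_nontrivial D with hsub | hnt
    · have : Subsingleton G := by
        refine subsingleton_of_zero_eq_one ?_
        rw [← map_zero φ, ← map_one φ, Subsingleton.elim (0 : D) 1]
      refine ⟨D, i₁, i₂, i₃, φ, ?_, fun j _ s _ => ?_⟩
      · rw [Module.finrank_zero_of_subsingleton]; exact Nat.zero_le _
      · rw [Subsingleton.elim (y j s) 0]; exact zero_mem _
    obtain ⟨D', i₁', i₂', i₃', φ', hfr', hle, hmem'⟩ :=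
      exists_algHom_mem_range_of_prod_X_sub_C_mul (y (i + 1)) (Finset.Icc 1 (r (i + 1))) D φ
        (∏ a ∈ Finset.Icc 1 (r (i + 1 + 1)), (X - C (d a))) Q (monic_prod_X_sub_C _ _) (by
          rw [← hQ, Polynomial.map_prod]
          refine Finset.prod_congr rfl fun a ha => ?_
          simp [hd a ha])
    refine ⟨D', i₁', i₂', i₃', φ', ?_, fun j hj s hs => ?_⟩
    · refine hfr'.trans ?_
      rw [natDegree_prod_of_monic _ _ fun a _ => monic_X_sub_C _,
        ← Finset.insert_Icc_add_one_left_eq_Icc (show i + 1 ≤ k from hi),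
        Finset.prod_insert (by simp), mul_comm]
      simpa using Nat.mul_le_mul_left _ hfr
    · rcases eq_or_ne j (i + 1) with rfl | hne
      · exact hmem' s hs
      · exact hle (hmem j (by simp at hj ⊢; omega) s hs)

open Polynomial in
/-- Roots whose pairwise differences are nonzerodivisors divide out simultaneously. -/
theorem Polynomial.prod_X_sub_C_dvd_of_mem_nonZeroDivisors {R ι : Type*} [CommRing R]
    (s : Finset ι) (y : ι → R) (F : R[X]) (hroot : ∀ i ∈ s, F.eval (y i) = 0)
    (hreg : ∀ i ∈ s, ∀ j ∈ s, i ≠ j → y i - y j ∈ nonZeroDivisors R) :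
    (∏ i ∈ s, (X - C (y i))) ∣ F := by
  classical
  induction s using Finset.induction_on with
  | empty => simp
  | insert i s his ih =>
    obtain ⟨Q, rfl⟩ := ih (fun j hj => hroot j (Finset.mem_insert_of_mem hj))
      fun j hj l hl => hreg j (Finset.mem_insert_of_mem hj) l (Finset.mem_insert_of_mem hl)
    have hQ : Q.eval (y i) = 0 := by
      have h := hroot i (Finset.mem_insert_self _ _)
      rw [eval_mul, eval_prod] at h
      refine (mul_left_mem_nonZeroDivisors_eq_zero_iff
        (prod_mem fun j hj => ?_ : ∏ j ∈ s, eval (y i) (X - C (y j)) ∈ nonZeroDivisors R)).mp h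
      simpa using hreg i (Finset.mem_insert_self _ _) j (Finset.mem_insert_of_mem hj)
        (by rintro rfl; exact his hj)
    rw [Finset.prod_insert his, mul_comm (X - C (y i))]
    exact mul_dvd_mul_left _ (dvd_iff_isRoot.mpr hQ)

open Polynomial in
/-- If `B` is an algebra of functions `Ω → ℂ[X]` containing, for each `x`, a nonzero function
supported at `x`, then `B / X B` has dimension at least `|Ω|`. -/
theorem card_le_finrank_of_ker_eq_span_X {Ω B G : Type} [Fintype Ω] [CommRing B]
    [Algebra ℂ[X] B] [CommRing G] [Algebra ℂ G] [Module.Finite ℂ G]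
    (ev : B →ₐ[ℂ[X]] (Ω → ℂ[X])) (hev : Function.Injective ev)
    (hB : ∀ x : Ω, ∃ b : B, ev b x ≠ 0 ∧ ∀ x' ≠ x, ev b x' = 0)
    (π : B →+* G) (hπ : ∀ c : ℂ, π (algebraMap ℂ[X] B (C c)) = algebraMap ℂ G c)
    (hker : RingHom.ker π = Ideal.span {algebraMap ℂ[X] B X}) :
    Fintype.card Ω ≤ Module.finrank ℂ G := by
  classical
  choose b hbx hb0 using hB
  have : Module.Finite ℂ[X] B := Module.Finite.of_injective ev.toLinearMap hev
  have : Module.IsTorsionFree ℂ[X] B := hev.moduleIsTorsionFree ev (fun c b => map_smul ev c b)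
  have : Module.Free ℂ[X] B := inferInstance
  have hli : LinearIndependent ℂ[X] b := by
    rw [Fintype.linearIndependent_iff]
    intro g hg x
    have h := congrFun (congrArg ev hg) x
    simp only [map_sum, map_smul, Finset.sum_apply, Pi.smul_apply, smul_eq_mul, map_zero,
      Pi.zero_apply] at h
    rw [Finset.sum_eq_single x (fun x' _ hne => by rw [hb0 x' x hne.symm, mul_zero])
      (by simp)] at h
    exact (mul_eq_zero.mp h).resolve_right (hbx x)
  let e := Module.Free.chooseBasis ℂ[X] B
  have hli' : LinearIndependent ℂ fun i => π (e i) := by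
    rw [Fintype.linearIndependent_iff]
    intro g hg i
    have h : ∑ i, (C (g i)) • e i ∈ RingHom.ker π := by
      rw [RingHom.mem_ker, map_sum, ← hg]
      refine Finset.sum_congr rfl fun i _ => ?_
      rw [Algebra.smul_def, map_mul, Algebra.smul_def, hπ]
    rw [hker] at h
    obtain ⟨c, hc⟩ := Ideal.mem_span_singleton'.mp h
    have h2 := congrArg (fun v => (e.repr v i).coeff 0) hc
    simp only [mul_comm c, ← Algebra.smul_def, map_smul, e.repr_sum_self] at h2
    simpa using h2.symm
  calc Fintype.card Ω ≤ Module.finrank ℂ[X] B := hli.fintype_card_le_finrank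
    _ = Fintype.card (Module.Free.ChooseBasisIndex ℂ[X] B) :=
      Module.finrank_eq_card_chooseBasisIndex _ _
    _ ≤ _ := hli'.fintype_card_le_finrank

open Polynomial in
/-- The Rees algebra form of `card_le_prod_descFactorial_of_triangular`. -/
theorem card_le_prod_descFactorial_of_adjoin_eq_top {Ω B : Type} [Fintype Ω] [CommRing B]
    [Algebra ℂ[X] B] (ev : B →ₐ[ℂ[X]] (Ω → ℂ[X])) (hev : Function.Injective ev) (y : ℕ → ℕ → B)
    (hadj : Algebra.adjoin ℂ[X] (Set.range fun p : ℕ × ℕ => y p.1 p.2) = ⊤)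
    (k : ℕ) (r : ℕ → ℕ) (z : Ω → ℕ → ℕ → ℂ) (hy : ∀ j s x, ev (y j s) x = X * C (z x j s))
    (hz : Function.Injective z)
    (hsupp : ∀ x, ∀ j s : ℕ, ¬(1 ≤ j ∧ j ≤ k ∧ 1 ≤ s ∧ s ≤ r j) → z x j s = 0)
    (hdist : ∀ x, ∀ j ∈ Finset.Icc 1 k, ∀ s ∈ Finset.Icc 1 (r j), ∀ u ∈ Finset.Icc 1 (r j),
      s ≠ u → z x j s ≠ z x j u)
    (hrel : ∀ j ∈ Finset.Icc 1 k, ∃ i, ∃ c : ℂ, r i < r (j + 1) ∧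
      ∀ x, ∀ s ∈ Finset.Icc 1 (r j), ∏ a ∈ Finset.Icc 1 (r (j + 1)), (z x j s - z x (j + 1) a) =
        c * ∏ b ∈ Finset.Icc 1 (r i), (z x j s - z x i b)) :
    Fintype.card Ω ≤ ∏ j ∈ Finset.Icc 1 k, (r (j + 1)).descFactorial (r j) := by
  classical
  let I : Ideal B := Ideal.span {algebraMap ℂ[X] B X}
  let π := Ideal.Quotient.mk I
  let _ : Algebra ℂ (B ⧸ I) := ((π.comp (algebraMap ℂ[X] B)).comp C).toAlgebra
  have hπ : ∀ c : ℂ, π (algebraMap ℂ[X] B (C c)) = algebraMap ℂ (B ⧸ I) c := fun _ => rfl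
  have hX : π (algebraMap ℂ[X] B X) = 0 :=
    Ideal.Quotient.eq_zero_iff_mem.mpr (Ideal.subset_span rfl)
  have hdvd : ∀ j ∈ Finset.Icc 1 k,
      (∏ s ∈ Finset.Icc 1 (r j), (X - C (π (y j s)))) ∣
      ∏ a ∈ Finset.Icc 1 (r (j + 1)), (X - C (π (y (j + 1) a))) := by
    intro j hj
    obtain ⟨i, c, hlt, hc⟩ := hrel j hj
    let F : B[X] := ∏ a ∈ Finset.Icc 1 (r (j + 1)), (X - C (y (j + 1) a)) -
      C (algebraMap ℂ[X] B (C c * X ^ (r (j + 1) - r i))) *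
        ∏ b ∈ Finset.Icc 1 (r i), (X - C (y i b))
    have hF : (∏ s ∈ Finset.Icc 1 (r j), (X - C (y j s))) ∣ F := by
      refine Polynomial.prod_X_sub_C_dvd_of_mem_nonZeroDivisors _ _ _ (fun s hs => ?_) ?_
      · refine hev (funext fun x => ?_)
        have hsub : ∀ i b, ev (y j s) x - ev (y i b) x = X * C (z x j s - z x i b) :=
          fun i b => by simp [hy, mul_sub]
        have h1 : ev (F.eval (y j s)) x =
            (∏ a ∈ Finset.Icc 1 (r (j + 1)), (ev (y j s) x - ev (y (j + 1) a) x)) -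
            C c * X ^ (r (j + 1) - r i) *
              ∏ b ∈ Finset.Icc 1 (r i), (ev (y j s) x - ev (y i b) x) := by
          simp [F, eval_prod]
        rw [h1]
        simp only [hsub, Finset.prod_mul_distrib, Finset.prod_const, Nat.card_Icc,
          Nat.add_sub_cancel, ← map_prod]
        rw [hc x s hs, map_mul]
        have hpow : (X : ℂ[X]) ^ r (j + 1) = X ^ (r (j + 1) - r i) * X ^ r i := by
          rw [← pow_add, Nat.sub_add_cancel hlt.le]
        rw [hpow, map_zero, Pi.zero_apply]
        ring
      · intro s hs u hu hsu
        rw [mem_nonZeroDivisors_iff_right]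
        intro b hb
        refine hev (funext fun x => ?_)
        have h := congrFun (congrArg ev hb) x
        simp only [map_mul, map_sub, Pi.mul_apply, Pi.sub_apply, hy, map_zero, Pi.zero_apply] at h
        rw [← mul_sub, ← C_sub] at h
        rw [map_zero, Pi.zero_apply]
        refine (mul_eq_zero.mp h).resolve_right ?_
        simpa [sub_eq_zero] using hdist x j hj s hs u hu hsu
    have hmapF : F.map (π) =
        ∏ a ∈ Finset.Icc 1 (r (j + 1)), (X - C (π (y (j + 1) a))) := by
      have h0 : π (algebraMap ℂ[X] B (C c * X ^ (r (j + 1) - r i))) = 0 := by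
        rw [map_mul, map_pow, map_mul, map_pow, hX, zero_pow (by omega), mul_zero]
      simp only [F, Polynomial.map_sub, Polynomial.map_mul, Polynomial.map_prod, map_X, map_C, h0,
        map_zero, zero_mul, sub_zero]
    have h := Polynomial.map_dvd (π) hF
    rw [hmapF, Polynomial.map_prod] at h
    simpa using h
  have hzero : ∀ j s : ℕ, ¬(1 ≤ j ∧ j ≤ k ∧ 1 ≤ s ∧ s ≤ r j) →
      π (y j s) = 0 := by
    intro j s h
    have : y j s = 0 := hev (funext fun x => by simp [hy, hsupp x j s h])
    rw [this, map_zero]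
  obtain ⟨D, _, _, _, φ, hfr, hmem⟩ := exists_algHom_mem_range_of_prod_dvd k r
    (fun j s => π (y j s)) (fun a => hzero _ _ (by omega)) hdvd
  have hmem' : ∀ j s, π (y j s) ∈ φ.range := by
    intro j s
    by_cases h : 1 ≤ j ∧ j ≤ k ∧ 1 ≤ s ∧ s ≤ r j
    · exact hmem j (by simp; omega) s (by simp; omega)
    · rw [hzero j s h]; exact zero_mem _
  have hsurj : Function.Surjective φ := by
    intro g
    obtain ⟨b, rfl⟩ := Ideal.Quotient.mk_surjective g
    change π b ∈ φ.range
    have hb : b ∈ Algebra.adjoin ℂ[X] (Set.range fun p : ℕ × ℕ => y p.1 p.2) :=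
      hadj ▸ Algebra.mem_top
    induction hb using Algebra.adjoin_induction with
    | mem b hb => obtain ⟨p, rfl⟩ := hb; exact hmem' p.1 p.2
    | algebraMap p =>
      have : π (algebraMap ℂ[X] B p) = algebraMap ℂ (B ⧸ I) (p.coeff 0) := by
        rw [← hπ, Ideal.Quotient.eq, ← map_sub]
        refine Ideal.mem_span_singleton.mpr (map_dvd _ ?_)
        rw [X_dvd_iff]
        simp
      exact this ▸ φ.range.algebraMap_mem _
    | add a b ha hb iha ihb => rw [map_add]; exact add_mem iha ihb
    | mul a b ha hb iha ihb => rw [map_mul]; exact mul_mem iha ihb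
  have : Module.Finite ℂ (B ⧸ I) := Module.Finite.of_surjective φ.toLinearMap hsurj
  refine le_trans (card_le_finrank_of_ker_eq_span_X ev hev (fun x => ?_) π hπ Ideal.mk_ker)
    ((LinearMap.finrank_le_finrank_of_surjective (f := φ.toLinearMap) hsurj).trans hfr)
  have hsep : ∀ x' : Ω, x' ≠ x → ∃ p : ℕ × ℕ, z x p.1 p.2 ≠ z x' p.1 p.2 := by
    intro x' hne
    by_contra! h
    exact hne (hz (funext fun j => funext fun s => h (j, s))).symm
  choose! p hp using hsep
  let b : B := ∏ x' ∈ Finset.univ.erase x,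
    (y (p x').1 (p x').2 - algebraMap ℂ[X] B (X * C (z x' (p x').1 (p x').2)))
  have hb : ∀ w, ev b w = ∏ x' ∈ Finset.univ.erase x,
      (X * C (z w (p x').1 (p x').2 - z x' (p x').1 (p x').2)) := by
    intro w
    simp [b, hy, mul_sub]
  refine ⟨b, ?_, fun x' hne => ?_⟩
  · rw [hb, Finset.prod_ne_zero_iff]
    intro x' hx'
    simpa [sub_eq_zero] using hp x' (Finset.ne_of_mem_erase hx')
  · rw [hb]
    exact Finset.prod_eq_zero (Finset.mem_erase.mpr ⟨hne, Finset.mem_univ x'⟩) (by simp)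

open Polynomial in
/-- A Bézout-type bound: the number of points `z x`, with pairwise distinct coordinates on each
level, satisfying triangular equations up to terms of lower degree. -/
theorem card_le_prod_descFactorial_of_triangular {Ω : Type} [Fintype Ω] (k : ℕ) (r : ℕ → ℕ)
    (z : Ω → ℕ → ℕ → ℂ) (hz : Function.Injective z)
    (hsupp : ∀ x, ∀ j s : ℕ, ¬(1 ≤ j ∧ j ≤ k ∧ 1 ≤ s ∧ s ≤ r j) → z x j s = 0)
    (hdist : ∀ x, ∀ j ∈ Finset.Icc 1 k, ∀ s ∈ Finset.Icc 1 (r j), ∀ u ∈ Finset.Icc 1 (r j),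
      s ≠ u → z x j s ≠ z x j u)
    (hrel : ∀ j ∈ Finset.Icc 1 k, ∃ i, ∃ c : ℂ, r i < r (j + 1) ∧
      ∀ x, ∀ s ∈ Finset.Icc 1 (r j), ∏ a ∈ Finset.Icc 1 (r (j + 1)), (z x j s - z x (j + 1) a) =
        c * ∏ b ∈ Finset.Icc 1 (r i), (z x j s - z x i b)) :
    Fintype.card Ω ≤ ∏ j ∈ Finset.Icc 1 k, (r (j + 1)).descFactorial (r j) := by
  let Y : ℕ → ℕ → Ω → ℂ[X] := fun j s x => X * C (z x j s)
  let A := Algebra.adjoin ℂ[X] (Set.range fun p : ℕ × ℕ => Y p.1 p.2)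
  refine card_le_prod_descFactorial_of_adjoin_eq_top A.val Subtype.val_injective
    (fun j s => ⟨Y j s, Algebra.subset_adjoin ⟨(j, s), rfl⟩⟩) ?_ k r z (fun _ _ _ => rfl) hz
    hsupp hdist hrel
  rw [← Algebra.adjoin_adjoin_coe_preimage]
  congr 1
  ext b
  simp [Subtype.ext_iff]

/-- The tuple `z`, extended by zero, solves the system `(P_q)` and has pairwise distinct
coordinates on each level. -/
def IsDistinctSolution (k : ℕ) (r : ℕ → ℕ) (q : ℕ → ℂ) (z : ℕ → ℕ → ℂ) : Prop :=
  (∀ j s : ℕ, ¬(1 ≤ j ∧ j ≤ k ∧ 1 ≤ s ∧ s ≤ r j) → z j s = 0) ∧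
  (∀ j ∈ Finset.Icc 1 k, ∀ s ∈ Finset.Icc 1 (r j),
    (∏ a ∈ Finset.Icc 1 (r (j + 1)), (z j s - z (j + 1) a)) -
      q j * ∏ b ∈ Finset.Icc 1 (r (j - 1)), (z j s - z (j - 1) b) = 0) ∧
  (∀ j ∈ Finset.Icc 1 k, ∀ s ∈ Finset.Icc 1 (r j), ∀ u ∈ Finset.Icc 1 (r j),
    s ≠ u → z j s ≠ z j u)

open Polynomial in
/-- The monic polynomial whose roots are the coordinates of `z` on level `j`. -/
noncomputable def levelPoly (r : ℕ → ℕ) (z : ℕ → ℕ → ℂ) (j : ℕ) : ℂ[X] :=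
  ∏ a ∈ Finset.Icc 1 (r j), (X - C (z j a))

open Polynomial in
theorem degree_levelPoly (r : ℕ → ℕ) (z : ℕ → ℕ → ℂ) (j : ℕ) :
    (levelPoly r z j).degree = r j := by
  rw [levelPoly, degree_prod_of_monic _ _ fun a _ => monic_X_sub_C _]
  simp

open Polynomial in
theorem eval_levelPoly (r : ℕ → ℕ) (z : ℕ → ℕ → ℂ) (j : ℕ) (w : ℂ) :
    (levelPoly r z j).eval w = ∏ a ∈ Finset.Icc 1 (r j), (w - z j a) := by
  simp [levelPoly, eval_prod]

open Polynomial in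
theorem degree_levelPoly_sub_lt (r : ℕ → ℕ) (z : ℕ → ℕ → ℂ) {i j : ℕ} (h : r i = r j) :
    (levelPoly r z i - levelPoly r z j).degree < r i := by
  rw [← degree_levelPoly r z i]
  have hm : ∀ j, (levelPoly r z j).Monic := fun j => monic_prod_X_sub_C _ _
  refine degree_sub_lt_left ?_ (hm i).ne_zero ?_
  · rw [degree_levelPoly, degree_levelPoly, h]
  · rw [(hm i).leadingCoeff, (hm j).leadingCoeff]

open Polynomial in
/-- Consecutive levels of equal size differ by a fixed multiple of a strictly smaller level. -/
theorem exists_levelPoly_sub_eq (k : ℕ) (r : ℕ → ℕ) (hr0 : r 0 = 0) (hr1 : 0 < r 1)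
    (hmono : ∀ j, 1 ≤ j → j ≤ k → r j ≤ r (j + 1)) (q : ℕ → ℂ) (j : ℕ) (hj : j + 1 ≤ k)
    (heq : r (j + 1) = r (j + 1 + 1)) :
    ∃ i, ∃ c : ℂ, r i < r (j + 1) ∧ ∀ z, IsDistinctSolution k r q z →
      levelPoly r z (j + 1 + 1) - levelPoly r z (j + 1) = C c * levelPoly r z i := by
  have key : ∀ z, IsDistinctSolution k r q z → ∀ D : ℂ[X], D.degree < r (j + 1) →
      (∀ s ∈ Finset.Icc 1 (r (j + 1)), D.eval (z (j + 1) s) = 0) → D = 0 := by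
    intro z hz D hD h
    refine eq_zero_of_degree_lt_of_eval_index_eq_zero (s := Finset.Icc 1 (r (j + 1)))
      (v := z (j + 1)) ?_ (by simpa using hD) h
    intro s hs u hu hsu
    by_contra hne
    exact hz.2.2 (j + 1) (by simp; omega) s hs u hu hne hsu
  have hroot : ∀ z, ∀ s ∈ Finset.Icc 1 (r (j + 1)),
      (levelPoly r z (j + 1)).eval (z (j + 1) s) = 0 := by
    intro z s hs
    rw [eval_levelPoly]
    exact Finset.prod_eq_zero hs (sub_self _)
  have hsol : ∀ z, IsDistinctSolution k r q z → ∀ s ∈ Finset.Icc 1 (r (j + 1)),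
      (levelPoly r z (j + 1 + 1)).eval (z (j + 1) s) =
        q (j + 1) * (levelPoly r z j).eval (z (j + 1) s) := by
    intro z hz s hs
    have h := hz.2.1 (j + 1) (by simp; omega) s hs
    rw [Nat.add_sub_cancel, sub_eq_zero] at h
    rw [eval_levelPoly, eval_levelPoly, h]
  have hle : r j ≤ r (j + 1) := by
    rcases Nat.eq_zero_or_pos j with rfl | hpos
    · omega
    · exact hmono j hpos (by omega)
  rcases hle.lt_or_eq with hlt | hjeq
  · refine ⟨j, q (j + 1), hlt, fun z hz => sub_eq_zero.mp (key z hz _ ?_ fun s hs => ?_)⟩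
    · refine (degree_sub_le _ _).trans_lt (max_lt ?_ ?_)
      · rw [heq]; exact degree_levelPoly_sub_lt r z heq.symm
      · refine (C_mul' (_ : ℂ) _ ▸ degree_smul_le _ _).trans_lt ?_
        rw [degree_levelPoly]; exact_mod_cast hlt
    · simp [hroot z s hs, hsol z hz s hs]
  · obtain ⟨j, rfl⟩ : ∃ i, j = i + 1 := Nat.exists_eq_succ_of_ne_zero (by
      rintro rfl
      simp only [hr0, zero_add] at hjeq
      omega)
    obtain ⟨i, c, hi, h⟩ := exists_levelPoly_sub_eq k r hr0 hr1 hmono q j (by omega) hjeq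
    refine ⟨i, -q (j + 1 + 1) * c, hi.trans_eq hjeq, fun z hz => ?_⟩
    rw [C_mul, mul_assoc, ← h z hz, ← sub_eq_zero]
    refine key z hz _ ?_ fun s hs => ?_
    · refine (degree_sub_le _ _).trans_lt (max_lt ?_ ?_)
      · rw [heq]; exact degree_levelPoly_sub_lt r z heq.symm
      · refine (C_mul' (_ : ℂ) _ ▸ degree_smul_le _ _).trans_lt ?_
        exact degree_levelPoly_sub_lt r z hjeq.symm
    · simp [hroot z s hs, hsol z hz s hs]

open Polynomial in
theorem card_le_of_isDistinctSolution (k : ℕ) (r : ℕ → ℕ) (hr0 : r 0 = 0) (hr1 : 0 < r 1)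
    (hmono : ∀ j, 1 ≤ j → j ≤ k → r j ≤ r (j + 1)) (q : ℕ → ℂ) (T : Finset (ℕ → ℕ → ℂ))
    (hT : ∀ z ∈ T, IsDistinctSolution k r q z) :
    T.card ≤ ∏ j ∈ Finset.Icc 1 k, (r (j + 1)).descFactorial (r j) := by
  rw [← Fintype.card_coe]
  refine card_le_prod_descFactorial_of_triangular k r (fun z : T => z.1) Subtype.val_injective
    (fun z => (hT z z.2).1) (fun z => (hT z z.2).2.2) fun j hj => ?_
  obtain ⟨j, rfl⟩ : ∃ i, j = i + 1 :=
    Nat.exists_eq_succ_of_ne_zero (by rintro rfl; simp at hj)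
  have hjk : j + 1 ≤ k := (Finset.mem_Icc.mp hj).2
  have hle : r j ≤ r (j + 1) := by
    rcases Nat.eq_zero_or_pos j with rfl | hpos
    · omega
    · exact hmono j hpos (by omega)
  have hle' : r (j + 1) ≤ r (j + 1 + 1) := hmono (j + 1) (by omega) hjk
  rcases (hle.trans hle').lt_or_eq with hlt | heq
  · refine ⟨j, q (j + 1), hlt, fun z s hs => ?_⟩
    have h := (hT z z.2).2.1 (j + 1) hj s hs
    rwa [Nat.add_sub_cancel, sub_eq_zero] at h
  · obtain ⟨i, c, hi, h⟩ :=
      exists_levelPoly_sub_eq k r hr0 hr1 hmono q j hjk (by omega)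
    refine ⟨i, c, by omega, fun z s hs => ?_⟩
    have hz := congrArg (eval (z.1 (j + 1) s)) (h z (hT z z.2))
    rw [eval_sub, eval_mul, eval_C, eval_levelPoly, eval_levelPoly, eval_levelPoly,
      Finset.prod_eq_zero (s := Finset.Icc 1 (r (j + 1))) hs (sub_self _), sub_zero] at hz
    exact hz

/-- Extension by zero of a family indexed by a finite set of pairs. -/
noncomputable def extendByZero (J : Finset (ℕ × ℕ)) (v : J → ℂ) : ℕ → ℕ → ℂ :=
  fun j s => if h : (j, s) ∈ J then v ⟨(j, s), h⟩ else 0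

/-- The Jacobian of the system `Ψ`, restricted to the coordinates in `J`, is injective at `z`. -/
def IsNondegenerateAt (J : Finset (ℕ × ℕ)) (Ψ : (ℕ → ℕ → ℂ) → ℕ → ℕ → ℂ) (z : ℕ → ℕ → ℂ) : Prop :=
  ∀ δ : ℕ → ℕ → ℂ, (∀ j s, (j, s) ∉ J → δ j s = 0) →
    (∀ p ∈ J, deriv (fun t : ℂ => Ψ (z + t • δ) p.1 p.2) 0 = 0) → δ = 0

theorem contDiff_extendByZero {E : Type*} [NormedAddCommGroup E] [NormedSpace ℂ E]
    (J : Finset (ℕ × ℕ)) (j s : ℕ) :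
    ContDiff ℂ 1 fun x : E × (J → ℂ) => extendByZero J x.2 j s := by
  unfold extendByZero
  split_ifs with h
  · exact (contDiff_apply ℂ ℂ _).comp contDiff_snd
  · exact contDiff_const

theorem continuous_extendByZero (J : Finset (ℕ × ℕ)) : Continuous (extendByZero J) := by
  refine continuous_pi fun j => continuous_pi fun s => ?_
  unfold extendByZero
  split_ifs with h
  · exact continuous_apply _
  · exact continuous_const

theorem extendByZero_restrict {J : Finset (ℕ × ℕ)} {z : ℕ → ℕ → ℂ}
    (hz : ∀ j s, (j, s) ∉ J → z j s = 0) : extendByZero J (fun p => z p.1.1 p.1.2) = z := by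
  funext j s
  unfold extendByZero
  split_ifs with h
  · rfl
  · exact (hz j s h).symm

theorem extendByZero_add_smul (J : Finset (ℕ × ℕ)) (v d : J → ℂ) (t : ℂ) :
    extendByZero J (v + t • d) = extendByZero J v + t • extendByZero J d := by
  funext j s
  simp only [extendByZero, Pi.add_apply, Pi.smul_apply]
  split_ifs <;> simp

/-- Nondegeneracy amounts to invertibility of the partial derivative. -/
theorem isNondegenerateAt_iff_isInvertible {E : Type*} [NormedAddCommGroup E] [NormedSpace ℂ E]
    (J : Finset (ℕ × ℕ)) (Φ : E → (ℕ → ℕ → ℂ) → ℕ → ℕ → ℂ) (F : E × (J → ℂ) → J → ℂ)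
    (hF : ∀ x p, F x p = Φ x.1 (extendByZero J x.2) p.1.1 p.1.2) (hd : Differentiable ℂ F)
    (e : E) (v : J → ℂ) :
    IsNondegenerateAt J (Φ e) (extendByZero J v) ↔
      ((fderiv ℂ F (e, v)) ∘L .inr ℂ E (J → ℂ)).IsInvertible := by
  set L := (fderiv ℂ F (e, v)) ∘L ContinuousLinearMap.inr ℂ E (J → ℂ) with hL
  have hderiv : ∀ (d : J → ℂ) (p : J),
      deriv (fun t : ℂ => Φ e (extendByZero J v + t • extendByZero J d) p.1.1 p.1.2) 0 = L d p := by
    intro d p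
    have hγ : HasDerivAt (fun t : ℂ => (e, v + t • d)) ((0 : E), d) 0 := by
      refine (hasDerivAt_const _ _).prodMk ?_
      simpa using ((hasDerivAt_id (0 : ℂ)).smul_const d).const_add v
    have hF' : HasFDerivAt F (fderiv ℂ F (e, v)) (e, v + (0 : ℂ) • d) := by
      rw [zero_smul, add_zero]
      exact (hd (e, v)).hasFDerivAt
    have h := hasDerivAt_pi.mp (hF'.comp_hasDerivAt (0 : ℂ) hγ) p
    have heq : (fun t : ℂ => Φ e (extendByZero J v + t • extendByZero J d) p.1.1 p.1.2) =
        fun t : ℂ => (F ∘ fun t : ℂ => (e, v + t • d)) t p := by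
      funext t
      simp [hF, extendByZero_add_smul]
    rw [heq, h.deriv]
    simp [hL]
  have hinj : IsNondegenerateAt J (Φ e) (extendByZero J v) ↔ Function.Injective L := by
    rw [injective_iff_map_eq_zero]
    constructor
    · intro h d hd
      have h0 := h (extendByZero J d) (fun j s hjs => by simp [extendByZero, hjs])
        fun p hp => by rw [hderiv d ⟨p, hp⟩, hd, Pi.zero_apply]
      funext p
      have := congrFun (congrFun h0 p.1.1) p.1.2
      simpa [extendByZero] using this
    · intro h δ hδ hz
      rw [← extendByZero_restrict hδ] at hz ⊢
      have h0 : (fun p : J => δ p.1.1 p.1.2) = 0 :=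
        h _ (funext fun p => by rw [← hderiv, hz p.1 p.2, Pi.zero_apply])
      rw [h0]
      funext j s
      simp [extendByZero]
  rw [hinj]
  constructor
  · intro h
    exact ⟨(LinearEquiv.ofInjectiveEndo (L : (J → ℂ) →ₗ[ℂ] (J → ℂ)) h).toContinuousLinearEquiv,
      by ext; rfl⟩
  · exact fun h => h.injective

open Filter Topology in
/-- Nondegenerate solutions persist, as nondegenerate solutions, under small changes of the
parameter. -/
theorem eventually_exists_isNondegenerateAt {E : Type*} [NormedAddCommGroup E] [NormedSpace ℂ E]
    [CompleteSpace E] (J : Finset (ℕ × ℕ)) (Φ : E → (ℕ → ℕ → ℂ) → ℕ → ℕ → ℂ)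
    (hΦ : ∀ p ∈ J,
      ContDiff ℂ 1 fun x : E × (J → ℂ) => Φ x.1 (extendByZero J x.2) p.1 p.2)
    (e₀ : E) (z₀ : ℕ → ℕ → ℂ) (hz₀ : ∀ j s, (j, s) ∉ J → z₀ j s = 0)
    (hzero : ∀ p ∈ J, Φ e₀ z₀ p.1 p.2 = 0) (hnd : IsNondegenerateAt J (Φ e₀) z₀)
    (W : Set (ℕ → ℕ → ℂ)) (hW : W ∈ 𝓝 z₀) :
    ∀ᶠ e in 𝓝 e₀, ∃ z ∈ W, (∀ j s, (j, s) ∉ J → z j s = 0) ∧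
      (∀ p ∈ J, Φ e z p.1 p.2 = 0) ∧ IsNondegenerateAt J (Φ e) z := by
  let F : E × (J → ℂ) → J → ℂ := fun x p => Φ x.1 (extendByZero J x.2) p.1.1 p.1.2
  have hF : ContDiff ℂ 1 F := contDiff_pi.mpr fun p => hΦ p.1 p.2
  have hd : Differentiable ℂ F := hF.differentiable one_ne_zero
  let v₀ : J → ℂ := fun p => z₀ p.1.1 p.1.2
  have hv₀ : extendByZero J v₀ = z₀ := extendByZero_restrict hz₀
  have hF₀ : F (e₀, v₀) = 0 := funext fun p => by simpa [F, hv₀] using hzero p.1 p.2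
  rw [← hv₀] at hnd hW
  have hiff := isNondegenerateAt_iff_isInvertible J Φ F (fun _ _ => rfl) hd
  have hinv := (hiff e₀ v₀).mp hnd
  have hs : HasStrictFDerivAt F (fderiv ℂ F (e₀, v₀)) (e₀, v₀) :=
    hF.contDiffAt.hasStrictFDerivAt one_ne_zero
  let ψ := hs.implicitFunctionOfProdDomain hinv
  have hψ : Tendsto ψ (𝓝 e₀) (𝓝 v₀) := hs.tendsto_implicitFunctionOfProdDomain hinv
  have hopen : ∀ᶠ x in 𝓝 (e₀, v₀),
      ((fderiv ℂ F x) ∘L .inr ℂ E (J → ℂ)).IsInvertible := by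
    have hcont : Continuous fun x => (fderiv ℂ F x) ∘L ContinuousLinearMap.inr ℂ E (J → ℂ) :=
      (hF.continuous_fderiv one_ne_zero).clm_comp continuous_const
    exact hcont.continuousAt.eventually
      (ContinuousLinearEquiv.isOpen.mem_nhds hinv)
  filter_upwards [hψ.eventually ((continuous_extendByZero J).continuousAt.eventually hW),
    hs.eventually_apply_implicitFunctionOfProdDomain hinv,
    (tendsto_id.prodMk_nhds hψ).eventually hopen] with e h₁ h₂ h₃
  refine ⟨extendByZero J (ψ e), h₁, fun j s h => by simp [extendByZero, h], fun p hp => ?_,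
    (hiff e (ψ e)).mpr h₃⟩
  rw [hF₀] at h₂
  exact congrFun h₂ ⟨p, hp⟩

open Filter Topology in
/-- A finite family of nondegenerate solutions persists under small changes of the parameter. -/
theorem eventually_exists_family_isNondegenerateAt {E ι : Type*} [NormedAddCommGroup E]
    [NormedSpace ℂ E] [CompleteSpace E] [Finite ι] (J : Finset (ℕ × ℕ))
    (Φ : E → (ℕ → ℕ → ℂ) → ℕ → ℕ → ℂ)
    (hΦ : ∀ p ∈ J,
      ContDiff ℂ 1 fun x : E × (J → ℂ) => Φ x.1 (extendByZero J x.2) p.1 p.2)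
    (e₀ : E) (x₀ : ι → ℕ → ℕ → ℂ) (hx₀ : ∀ i j s, (j, s) ∉ J → x₀ i j s = 0)
    (hzero : ∀ i, ∀ p ∈ J, Φ e₀ (x₀ i) p.1 p.2 = 0)
    (hnd : ∀ i, IsNondegenerateAt J (Φ e₀) (x₀ i))
    (W : Set (ι → ℕ → ℕ → ℂ)) (hW : W ∈ 𝓝 x₀) :
    ∀ᶠ e in 𝓝 e₀, ∃ x ∈ W, ∀ i, (∀ j s, (j, s) ∉ J → x i j s = 0) ∧
      (∀ p ∈ J, Φ e (x i) p.1 p.2 = 0) ∧ IsNondegenerateAt J (Φ e) (x i) := by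
  rw [nhds_pi, Filter.mem_pi] at hW
  obtain ⟨I, -, V, hV, hsub⟩ := hW
  have h := fun i => eventually_exists_isNondegenerateAt J Φ hΦ e₀ (x₀ i) (hx₀ i) (hzero i)
    (hnd i) (V i) (hV i)
  filter_upwards [eventually_all.mpr h] with e he
  choose x hxV hx using he
  exact ⟨x, hsub fun i _ => hxV i, hx⟩

open Topology in
/-- A finite family of functions which is injective, and each member of which is injective on
prescribed sets, keeps both properties on a neighbourhood; the distinctness of two members is
witnessed by a fixed coordinate. -/
theorem exists_separating_coordinates {ι : Type*} [Finite ι] (k : ℕ) (r : ℕ → ℕ)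
    (x₀ : ι → ℕ → ℕ → ℂ) (hinj : Function.Injective x₀)
    (hdist : ∀ i, ∀ j ∈ Finset.Icc 1 k, ∀ s ∈ Finset.Icc 1 (r j), ∀ u ∈ Finset.Icc 1 (r j),
      s ≠ u → x₀ i j s ≠ x₀ i j u) :
    ∃ c : ι → ι → ℕ × ℕ, {x : ι → ℕ → ℕ → ℂ |
      (∀ i i', i ≠ i' → x i (c i i').1 (c i i').2 ≠ x i' (c i i').1 (c i i').2) ∧
      ∀ i, ∀ j ∈ Finset.Icc 1 k, ∀ s ∈ Finset.Icc 1 (r j), ∀ u ∈ Finset.Icc 1 (r j),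
        s ≠ u → x i j s ≠ x i j u} ∈ 𝓝 x₀ := by
  have hc : ∀ i i', ∃ c : ℕ × ℕ, i ≠ i' → x₀ i c.1 c.2 ≠ x₀ i' c.1 c.2 := by
    intro i i'
    by_cases h : i = i'
    · exact ⟨0, fun h' => absurd h h'⟩
    · have := hinj.ne h
      rw [Function.ne_iff] at this
      obtain ⟨j, hj⟩ := this
      obtain ⟨s, hs⟩ := Function.ne_iff.mp hj
      exact ⟨(j, s), fun _ => hs⟩
  choose c hc using hc
  have hcont : ∀ i j s, Continuous fun x : ι → ℕ → ℕ → ℂ => x i j s := fun i j s => by fun_prop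
  refine ⟨c, Filter.inter_mem ?_ ?_⟩
  · refine Filter.eventually_all.mpr fun i => Filter.eventually_all.mpr fun i' => ?_
    by_cases h : i = i'
    · exact Filter.Eventually.of_forall fun x h' => absurd h h'
    · filter_upwards [((hcont i _ _).continuousAt.ne_iff_eventually_ne
        (hcont i' _ _).continuousAt).mp (hc i i' h)] with x hx _ using hx
  · refine Filter.eventually_all.mpr fun i => ?_
    refine (Finset.eventually_all _).mpr fun j hj => (Finset.eventually_all _).mpr fun s hs =>
      (Finset.eventually_all _).mpr fun u hu => ?_
    by_cases h : s = u
    · exact Filter.Eventually.of_forall fun x h' => absurd h h'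
    · filter_upwards [((hcont i _ _).continuousAt.ne_iff_eventually_ne
        (hcont i _ _).continuousAt).mp (hdist i j hj s hs u hu h)] with x hx _ using hx

/-- The pairs `(j, s)` with `1 ≤ j ≤ k` and `1 ≤ s ≤ r j`. -/
def levelIndex (k : ℕ) (r : ℕ → ℕ) : Finset (ℕ × ℕ) :=
  (Finset.Icc 1 k).biUnion fun j => (Finset.Icc 1 (r j)).image (Prod.mk j)

theorem mem_levelIndex {k : ℕ} {r : ℕ → ℕ} {j s : ℕ} :
    (j, s) ∈ levelIndex k r ↔ 1 ≤ j ∧ j ≤ k ∧ 1 ≤ s ∧ s ≤ r j := by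
  simp only [levelIndex, Finset.mem_biUnion, Finset.mem_image, Finset.mem_Icc, Prod.mk.injEq]
  constructor
  · rintro ⟨a, ha, b, hb, rfl, rfl⟩
    omega
  · rintro ⟨h₁, h₂, h₃, h₄⟩
    exact ⟨j, ⟨h₁, h₂⟩, s, ⟨h₃, h₄⟩, rfl, rfl⟩

/-- The left-hand side of the equation of `(P_q)` with index `(j, s)`. -/
noncomputable def levelEq (r : ℕ → ℕ) (q : ℕ → ℂ) (z : ℕ → ℕ → ℂ) (j s : ℕ) : ℂ :=
  (∏ a ∈ Finset.Icc 1 (r (j + 1)), (z j s - z (j + 1) a)) -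
    q j * ∏ b ∈ Finset.Icc 1 (r (j - 1)), (z j s - z (j - 1) b)

theorem contDiff_levelEq {X : Type*} [NormedAddCommGroup X] [NormedSpace ℂ X] (r : ℕ → ℕ)
    (q : X → ℕ → ℂ) (z : X → ℕ → ℕ → ℂ) (hq : ∀ j, ContDiff ℂ 1 fun x => q x j)
    (hz : ∀ j s, ContDiff ℂ 1 fun x => z x j s) (j s : ℕ) :
    ContDiff ℂ 1 fun x => levelEq r (q x) (z x) j s :=
  (contDiff_prod fun _ _ => (hz _ _).sub (hz _ _)).sub
    ((hq j).mul (contDiff_prod fun _ _ => (hz _ _).sub (hz _ _)))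

/-- Multiplication of level `l` by `τ`. -/
def scaleLevel (l : ℕ) (τ : ℂ) (x : ℕ → ℕ → ℂ) : ℕ → ℕ → ℂ :=
  fun j s => if j = l then τ * x j s else x j s

theorem scaleLevel_add_smul (l : ℕ) (τ t : ℂ) (x δ : ℕ → ℕ → ℂ) :
    scaleLevel l τ (x + t • δ) = scaleLevel l τ x + t • scaleLevel l τ δ := by
  funext j s
  simp only [scaleLevel, Pi.add_apply, Pi.smul_apply, smul_eq_mul]
  split_ifs <;> ring

theorem scaleLevel_inv (l : ℕ) {τ : ℂ} (hτ : τ ≠ 0) (x : ℕ → ℕ → ℂ) :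
    scaleLevel l τ⁻¹ (scaleLevel l τ x) = x := by
  funext j s
  simp only [scaleLevel]
  split_ifs <;> field_simp

/-- The system obtained from the first `l` levels of `(P_q)` by writing level `l` as `τ` times new
unknowns, taking `τ ^ r (l + 1)` for `q l`, and dividing the equations of level `l` by
`τ ^ r (l + 1)`. -/
noncomputable def rescaledEq (r : ℕ → ℕ) (q : ℕ → ℂ) (l : ℕ) (τ : ℂ) (x : ℕ → ℕ → ℂ) (j s : ℕ) :
    ℂ :=
  if j = l then x l s ^ r (l + 1) - ∏ b ∈ Finset.Icc 1 (r (l - 1)), (τ * x l s - x (l - 1) b)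
  else levelEq r q (scaleLevel l τ x) j s

theorem levelEq_scaleLevel (r : ℕ → ℕ) (q : ℕ → ℂ) {l : ℕ} (hl : 1 ≤ l) (τ : ℂ)
    (x : ℕ → ℕ → ℂ) (hx : ∀ a, x (l + 1) a = 0) (j s : ℕ) :
    levelEq r (Function.update q l (τ ^ r (l + 1))) (scaleLevel l τ x) j s =
      (if j = l then τ ^ r (l + 1) else 1) * rescaledEq r q l τ x j s := by
  by_cases h : j = l
  · subst h
    have h₁ : j - 1 ≠ j := by omega
    simp [levelEq, rescaledEq, scaleLevel, hx, h₁]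
    ring
  · simp [levelEq, rescaledEq, h]

theorem contDiff_rescaledEq (r : ℕ → ℕ) (q : ℕ → ℂ) (l : ℕ) (J : Finset (ℕ × ℕ)) (j s : ℕ) :
    ContDiff ℂ 1 fun x : ℂ × (J → ℂ) => rescaledEq r q l x.1 (extendByZero J x.2) j s := by
  have hz : ∀ j s, ContDiff ℂ 1 fun x : ℂ × (J → ℂ) => extendByZero J x.2 j s :=
    contDiff_extendByZero J
  unfold rescaledEq
  split_ifs with h
  · exact ((hz _ _).pow _).sub
      (contDiff_prod fun _ _ => (contDiff_fst.mul (hz _ _)).sub (hz _ _))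
  · refine contDiff_levelEq r (fun _ => q) _ (fun _ => contDiff_const) (fun j s => ?_) j s
    unfold scaleLevel
    split_ifs
    · exact contDiff_fst.mul (hz _ _)
    · exact hz _ _

theorem isNondegenerateAt_rescaledEq_zero {m : ℕ} {r : ℕ → ℕ} {q : ℕ → ℂ} {x : ℕ → ℕ → ℂ}
    (hr : 0 < r (m + 2))
    (hz : IsNondegenerateAt (levelIndex m r) (levelEq r q) (scaleLevel (m + 1) 0 x))
    (hx : ∀ s ∈ Finset.Icc 1 (r (m + 1)), x (m + 1) s ≠ 0) :
    IsNondegenerateAt (levelIndex (m + 1) r) (rescaledEq r q (m + 1) 0) x := by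
  intro δ hδ hd
  have h0 : scaleLevel (m + 1) 0 δ = 0 := by
    refine hz _ (fun j s hjs => ?_) fun p hp => ?_
    · simp only [scaleLevel]
      split_ifs with h
      · simp
      · exact hδ j s fun hjs' => hjs (mem_levelIndex.mpr (by
          have := mem_levelIndex.mp hjs'
          omega))
    · obtain ⟨j, s⟩ := p
      have hp' := mem_levelIndex.mp hp
      have h := hd (j, s) (mem_levelIndex.mpr (by omega))
      have hne : j ≠ m + 1 := by omega
      simpa [rescaledEq, hne, scaleLevel_add_smul] using h
  have hlow : ∀ j s, j ≠ m + 1 → δ j s = 0 := fun j s hj => by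
    simpa [scaleLevel, hj] using congrFun (congrFun h0 j) s
  funext j s
  by_cases hj : j = m + 1
  · subst hj
    by_cases hs : (m + 1, s) ∈ levelIndex (m + 1) r
    · have h := hd _ hs
      have hD : HasDerivAt (fun t : ℂ => rescaledEq r q (m + 1) 0 (x + t • δ) (m + 1) s)
          (r (m + 2) * x (m + 1) s ^ (r (m + 2) - 1) * δ (m + 1) s) 0 := by
        have h₁ : HasDerivAt (fun t : ℂ => x (m + 1) s + t * δ (m + 1) s) (δ (m + 1) s) 0 := by
          simpa using ((hasDerivAt_id (0 : ℂ)).mul_const (δ (m + 1) s)).const_add (x (m + 1) s)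
        have h₂ := (h₁.pow (r (m + 2))).sub_const
          (∏ b ∈ Finset.Icc 1 (r m), (0 - x m b))
        simpa [rescaledEq, hlow m _ (by omega)] using h₂
      rw [hD.deriv] at h
      have hs' := mem_levelIndex.mp hs
      have hxs := hx s (Finset.mem_Icc.mpr hs'.2.2)
      simpa [hr.ne', hxs] using h
    · exact hδ _ _ hs
  · exact hlow j s hj

theorem IsNondegenerateAt.scaleLevel {l : ℕ} (hl : 1 ≤ l) {r : ℕ → ℕ} {q : ℕ → ℂ} {τ : ℂ}
    (hτ : τ ≠ 0) {x : ℕ → ℕ → ℂ} (hx : ∀ j s, (j, s) ∉ levelIndex l r → x j s = 0)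
    (h : IsNondegenerateAt (levelIndex l r) (rescaledEq r q l τ) x) :
    IsNondegenerateAt (levelIndex l r) (levelEq r (Function.update q l (τ ^ r (l + 1))))
      (scaleLevel l τ x) := by
  intro δ hδ hd
  have htop : ∀ a, (l + 1, a) ∉ levelIndex l r := fun a ha => by
    have := mem_levelIndex.mp ha
    omega
  have hback : _root_.scaleLevel l τ (_root_.scaleLevel l τ⁻¹ δ) = δ := by
    simpa using scaleLevel_inv l (inv_ne_zero hτ) δ
  have h0 : _root_.scaleLevel l τ⁻¹ δ = 0 := by
    have hsupp : ∀ j s, (j, s) ∉ levelIndex l r → _root_.scaleLevel l τ⁻¹ δ j s = 0 :=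
      fun j s hjs => by simp [_root_.scaleLevel, hδ j s hjs]
    refine h _ hsupp fun p hp => ?_
    have hp' := hd p hp
    have heq : (fun t : ℂ => levelEq r (Function.update q l (τ ^ r (l + 1)))
        (_root_.scaleLevel l τ x + t • δ) p.1 p.2) = fun t : ℂ =>
        (if p.1 = l then τ ^ r (l + 1) else 1) *
          rescaledEq r q l τ (x + t • _root_.scaleLevel l τ⁻¹ δ) p.1 p.2 := by
      funext t
      rw [← levelEq_scaleLevel r q hl, scaleLevel_add_smul, hback]
      intro a
      simp [hx _ _ (htop a), hsupp _ _ (htop a)]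
    rw [heq, deriv_const_mul_field] at hp'
    refine (mul_eq_zero.mp hp').resolve_left ?_
    split_ifs
    · exact pow_ne_zero _ hτ
    · exact one_ne_zero
  rw [← hback, h0]
  funext j s
  simp [_root_.scaleLevel]

/-- Two consecutive levels of a solution cannot both contain `0`. -/
theorem IsDistinctSolution.not_zero_mem_consecutive {k : ℕ} {r : ℕ → ℕ} {q : ℕ → ℂ}
    {z : ℕ → ℕ → ℂ} (hr0 : r 0 = 0) (hq : ∀ j ∈ Finset.Icc 1 k, q j ≠ 0)
    (hz : IsDistinctSolution k r q z) {j : ℕ} (hj : j ≤ k) :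
    ¬((∃ a ∈ Finset.Icc 1 (r (j + 1)), z (j + 1) a = 0) ∧
      ∃ b ∈ Finset.Icc 1 (r j), z j b = 0) := by
  induction j with
  | zero => simp [hr0]
  | succ j ih =>
    rintro ⟨⟨a, ha, hza⟩, b, hb, hzb⟩
    have hmem : j + 1 ∈ Finset.Icc 1 k := Finset.mem_Icc.mpr ⟨by omega, hj⟩
    have h := hz.2.1 (j + 1) hmem b hb
    rw [Finset.prod_eq_zero ha (by rw [hza, hzb, sub_zero]), zero_sub, neg_eq_zero,
      mul_eq_zero] at h
    obtain ⟨c, hc, hzc⟩ := Finset.prod_eq_zero_iff.mp (h.resolve_left (hq _ hmem))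
    rw [hzb, zero_sub, neg_eq_zero] at hzc
    exact ih (by omega) ⟨⟨b, hb, hzb⟩, c, hc, hzc⟩

/-- Adjoining to a solution with `m` levels a level `m + 1` consisting of the numbers
`w * ζ ^ e s`. -/
noncomputable def appendLevel {r : ℕ → ℕ} {m N : ℕ} (z : ℕ → ℕ → ℂ) (w ζ : ℂ)
    (e : Finset.Icc 1 (r (m + 1)) ↪ Fin N) : ℕ → ℕ → ℂ :=
  fun j s => if h : j = m + 1 ∧ s ∈ Finset.Icc 1 (r (m + 1)) then
    w * ζ ^ (e ⟨s, h.2⟩ : ℕ) else z j s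

section appendLevel

variable {r : ℕ → ℕ} {m N : ℕ} {z : ℕ → ℕ → ℂ} {w ζ : ℂ}
  {e : Finset.Icc 1 (r (m + 1)) ↪ Fin N}

theorem appendLevel_of_ne {j : ℕ} (hj : j ≠ m + 1) (s : ℕ) :
    appendLevel z w ζ e j s = z j s := by
  simp [appendLevel, hj]

theorem appendLevel_top {s : ℕ} (hs : s ∈ Finset.Icc 1 (r (m + 1))) :
    appendLevel z w ζ e (m + 1) s = w * ζ ^ (e ⟨s, hs⟩ : ℕ) :=
  dif_pos ⟨rfl, hs⟩

theorem scaleLevel_zero_appendLevel (hz : ∀ s, z (m + 1) s = 0) :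
    scaleLevel (m + 1) 0 (appendLevel z w ζ e) = z := by
  funext j s
  by_cases hj : j = m + 1
  · simp [scaleLevel, hj, hz]
  · simp [scaleLevel, hj, appendLevel_of_ne hj]

theorem appendLevel_injective {ι : Type*} {x : ι → ℕ → ℕ → ℂ} {w : ι → ℂ}
    (hx : Function.Injective x) (htop : ∀ i s, x i (m + 1) s = 0) (hw : ∀ i, w i ≠ 0)
    (hζ : IsPrimitiveRoot ζ N) :
    Function.Injective fun p : ι × (Finset.Icc 1 (r (m + 1)) ↪ Fin N) =>
      appendLevel (x p.1) (w p.1) ζ p.2 := by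
  rintro ⟨i, e⟩ ⟨i', e'⟩ h
  replace h : appendLevel (x i) (w i) ζ e = appendLevel (x i') (w i') ζ e' := h
  obtain rfl : i = i' := hx <| by
    rw [← scaleLevel_zero_appendLevel (htop i) (w := w i) (ζ := ζ) (e := e), h,
      scaleLevel_zero_appendLevel (htop i')]
  refine Prod.ext rfl (DFunLike.ext _ _ fun s => ?_)
  have hs := congrFun (congrFun h (m + 1)) s
  rw [appendLevel_top s.2, appendLevel_top s.2] at hs
  exact Fin.ext (hζ.pow_inj (e s).2 (e' s).2 (mul_left_cancel₀ (hw i) hs))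

end appendLevel

open Topology in
/-- For a suitable `q` the system has the expected number of solutions, all nondegenerate. -/
theorem exists_family_isNondegenerateAt (r : ℕ → ℕ) (hr0 : r 0 = 0) (k : ℕ)
    (hpos : ∀ j, 1 ≤ j → j ≤ k + 1 → 0 < r j) :
    ∃ q : ℕ → ℂ, (∀ j ∈ Finset.Icc 1 k, q j ≠ 0) ∧ ∃ (ι : Type) (_ : Fintype ι)
      (x : ι → ℕ → ℕ → ℂ), Fintype.card ι = ∏ j ∈ Finset.Icc 1 k, (r (j + 1)).descFactorial (r j) ∧
      Function.Injective x ∧ ∀ i, IsDistinctSolution k r q (x i) ∧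
        IsNondegenerateAt (levelIndex k r) (levelEq r q) (x i) := by
  induction k with
  | zero =>
    refine ⟨1, by simp, Unit, inferInstance, 0, by simp, Function.injective_of_subsingleton _,
      fun i => ⟨⟨by simp, by simp, by simp⟩, fun δ hδ _ => ?_⟩⟩
    funext j s
    exact hδ j s (by simp [levelIndex])
  | succ m ih =>
    obtain ⟨q, hq, ι, _, x, hcard, hinj, hx⟩ := ih fun j h₁ h₂ => hpos j h₁ (by omega)
    have hr₁ : 0 < r (m + 1) := hpos (m + 1) (by omega) (by omega)
    have hr₂ : 0 < r (m + 2) := hpos (m + 2) (by omega) (by omega)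
    have htop : ∀ i s, x i (m + 1) s = 0 := fun i s => (hx i).1.1 _ _ (by omega)
    have hw : ∀ i, ∃ w : ℂ, w ^ r (m + 2) = ∏ b ∈ Finset.Icc 1 (r m), (0 - x i m b) :=
      fun i => IsAlgClosed.exists_pow_nat_eq _ hr₂
    choose w hw using hw
    have hw0 : ∀ i, w i ≠ 0 := by
      intro i h
      have h' := hw i
      rw [h, zero_pow hr₂.ne', eq_comm, Finset.prod_eq_zero_iff] at h'
      obtain ⟨b, hb, hzb⟩ := h'
      exact (hx i).1.not_zero_mem_consecutive hr0 hq le_rfl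
        ⟨⟨1, Finset.mem_Icc.mpr ⟨le_rfl, hr₁⟩, htop i 1⟩, b, hb, by simpa using hzb⟩
    have hζ := Complex.isPrimitiveRoot_exp (r (m + 2)) hr₂.ne'
    set ζ := Complex.exp (2 * Real.pi * Complex.I / (r (m + 2) : ℕ))
    have hζ0 : ζ ≠ 0 := hζ.ne_zero hr₂.ne'
    let y : ι × (Finset.Icc 1 (r (m + 1)) ↪ Fin (r (m + 2))) → ℕ → ℕ → ℂ :=
      fun p => appendLevel (x p.1) (w p.1) ζ p.2
    have hyinj : Function.Injective y := appendLevel_injective hinj htop hw0 hζ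
    have hyx : ∀ p, scaleLevel (m + 1) 0 (y p) = x p.1 :=
      fun p => scaleLevel_zero_appendLevel (htop p.1)
    have hysupp : ∀ p j s, (j, s) ∉ levelIndex (m + 1) r → y p j s = 0 := by
      intro p j s hjs
      rw [mem_levelIndex] at hjs
      rw [show y p j s = x p.1 j s from dif_neg fun h => hjs (by
        have := Finset.mem_Icc.mp h.2
        rw [h.1]
        omega)]
      exact (hx p.1).1.1 j s fun h => hjs (by omega)
    have hydist : ∀ p, ∀ j ∈ Finset.Icc 1 (m + 1), ∀ s ∈ Finset.Icc 1 (r j),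
        ∀ u ∈ Finset.Icc 1 (r j), s ≠ u → y p j s ≠ y p j u := by
      intro p j hj s hs u hu hsu
      rw [Finset.mem_Icc] at hj
      by_cases h : j = m + 1
      · subst h
        simp only [y]
        rw [appendLevel_top hs, appendLevel_top hu]
        intro heq
        have := p.2.injective (Fin.ext
          (hζ.pow_inj (p.2 _).2 (p.2 _).2 (mul_left_cancel₀ (hw0 p.1) heq)))
        exact hsu (congrArg Subtype.val this)
      · simp only [y]
        rw [appendLevel_of_ne h, appendLevel_of_ne h]
        exact (hx p.1).1.2.2 j (Finset.mem_Icc.mpr (by omega)) s hs u hu hsu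
    have hyzero : ∀ p, ∀ c ∈ levelIndex (m + 1) r,
        rescaledEq r q (m + 1) 0 (y p) c.1 c.2 = 0 := by
      rintro p ⟨j, s⟩ hjs
      rw [mem_levelIndex] at hjs
      by_cases h : j = m + 1
      · subst h
        have hlow : ∀ b, y p m b = x p.1 m b := fun b => appendLevel_of_ne (by omega) b
        have hs : y p (m + 1) s = _ := appendLevel_top (Finset.mem_Icc.mpr hjs.2.2)
        simp only [rescaledEq, if_true, Nat.add_sub_cancel, hlow, zero_mul]
        rw [hs, mul_pow, ← pow_mul, mul_comm _ (r (m + 2)), pow_mul, hζ.pow_eq_one, one_pow,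
          mul_one, hw, sub_self]
      · simp only [rescaledEq, h, if_false, hyx]
        exact (hx p.1).1.2.1 j (Finset.mem_Icc.mpr (by omega)) s (Finset.mem_Icc.mpr hjs.2.2)
    have hynd : ∀ p, IsNondegenerateAt (levelIndex (m + 1) r) (rescaledEq r q (m + 1) 0) (y p) := by
      refine fun p => isNondegenerateAt_rescaledEq_zero hr₂ ?_ fun s hs => ?_
      · rw [hyx]
        exact (hx p.1).2
      · simp only [y]
        rw [appendLevel_top hs]
        exact mul_ne_zero (hw0 p.1) (pow_ne_zero _ hζ0)
    obtain ⟨c, hc⟩ := exists_separating_coordinates (m + 1) r y hyinj hydist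
    have hev := eventually_exists_family_isNondegenerateAt (levelIndex (m + 1) r)
      (rescaledEq r q (m + 1)) (fun p _ => contDiff_rescaledEq r q (m + 1) _ p.1 p.2) 0 y hysupp
      hyzero hynd _ hc
    obtain ⟨τ, ⟨v, ⟨hvsep, hvdist⟩, hv⟩, hτ⟩ :=
      ((hev.filter_mono nhdsWithin_le_nhds).and
        (self_mem_nhdsWithin : {(0 : ℂ)}ᶜ ∈ 𝓝[≠] (0 : ℂ))).exists
    replace hτ : τ ≠ 0 := hτ
    refine ⟨Function.update q (m + 1) (τ ^ r (m + 2)), fun j hj => ?_, _, inferInstance,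
      fun p => scaleLevel (m + 1) τ (v p), ?_, ?_, fun p => ⟨⟨?_, ?_, ?_⟩, ?_⟩⟩
    · by_cases h : j = m + 1
      · subst h
        simpa using pow_ne_zero _ hτ
      · rw [Function.update_of_ne h]
        rw [Finset.mem_Icc] at hj
        exact hq j (Finset.mem_Icc.mpr (by omega))
    · rw [Fintype.card_prod, hcard, Fintype.card_embedding_eq, Finset.prod_Icc_succ_top (by omega)]
      simp
    · intro p p' hpp
      by_contra hne
      have : v p = v p' := by
        rw [← scaleLevel_inv (m + 1) hτ (v p), ← scaleLevel_inv (m + 1) hτ (v p')]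
        exact congrArg _ hpp
      exact hvsep p p' hne (by rw [this])
    · intro j s hjs
      have := (hv p).1 j s fun h => hjs (mem_levelIndex.mp h)
      simp [scaleLevel, this]
    · intro j hj s hs
      have hjs : (j, s) ∈ levelIndex (m + 1) r :=
        mem_levelIndex.mpr ⟨(Finset.mem_Icc.mp hj).1, (Finset.mem_Icc.mp hj).2,
          (Finset.mem_Icc.mp hs).1, (Finset.mem_Icc.mp hs).2⟩
      have h := levelEq_scaleLevel r q (l := m + 1) (by omega) τ (v p)
        (fun a => (hv p).1 _ _ fun h => by have := mem_levelIndex.mp h; omega) j s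
      rw [(hv p).2.1 _ hjs, mul_zero] at h
      exact h
    · intro j hj s hs u hu hsu h
      simp only [scaleLevel] at h
      refine hvdist p j hj s hs u hu hsu ?_
      split_ifs at h
      · exact mul_left_cancel₀ hτ h
      · exact h
    · exact (hv p).2.2.scaleLevel (by omega) hτ (hv p).1

open Topology in
/-- Given finitely many complex functions on a neighbourhood of a point of `ℂ ^ k`, there are, for
generic `q`, complex numbers satisfying all polynomial relations which hold between the coordinates
and the given functions. -/
theorem MvPolynomial.exists_ne_zero_forall_exists_relations {σ κ : Type} [Fintype σ] [Finite κ]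
    {e₀ : σ → ℂ} {U : Set (σ → ℂ)} (hU : U ∈ 𝓝 e₀) (f : κ → U → ℂ) :
    ∃ h : MvPolynomial σ ℂ, h ≠ 0 ∧ ∀ q : σ → ℂ, eval q h ≠ 0 → ∃ g : κ → ℂ,
      ∀ P : MvPolynomial (σ ⊕ κ) ℂ,
        (∀ u : U, eval (Sum.elim u.1 fun c => f c u) P = 0) → eval (Sum.elim q g) P = 0 := by
  let _ : Algebra (MvPolynomial σ ℂ) (U → ℂ) :=
    (RingHom.pi fun u : U => (eval u.1 : MvPolynomial σ ℂ →+* ℂ)).toAlgebra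
  have halg : ∀ (p : MvPolynomial σ ℂ) (u : U), algebraMap _ (U → ℂ) p u = eval u.1 p :=
    fun _ _ => rfl
  let S := Algebra.adjoin (MvPolynomial σ ℂ) (Set.range f)
  have : Algebra.FiniteType (MvPolynomial σ ℂ) S :=
    (Subalgebra.fg_iff_finiteType S).mp (Subalgebra.fg_def.mpr ⟨_, Set.finite_range f, rfl⟩)
  have hinj : Function.Injective (algebraMap (MvPolynomial σ ℂ) S) := by
    intro p p' h
    obtain ⟨ε, hε, hball⟩ := Metric.mem_nhds_iff.mp hU
    refine MvPolynomial.funext_set (fun i => Metric.ball (e₀ i) ε)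
      (fun i => infinite_of_mem_nhds (e₀ i) (Metric.ball_mem_nhds _ hε)) fun u hu => ?_
    rw [← ball_pi _ hε] at hu
    exact congrFun (congrArg (Subtype.val : S → U → ℂ) h) ⟨u, hball hu⟩
  obtain ⟨h, h0, hh⟩ := exists_ne_zero_forall_exists_ringHom_comp_eq_eval hinj
  refine ⟨h, h0, fun q hq => ?_⟩
  obtain ⟨φ, hφ⟩ := hh q hq
  let gen : κ → S := fun c => ⟨f c, Algebra.subset_adjoin ⟨c, rfl⟩⟩
  let θ : MvPolynomial (σ ⊕ κ) ℂ →+* S :=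
    eval₂Hom ((algebraMap (MvPolynomial σ ℂ) S).comp C)
      (Sum.elim (fun i => algebraMap (MvPolynomial σ ℂ) S (X i)) gen)
  have hφ' : ∀ p : MvPolynomial σ ℂ, φ (algebraMap _ S p) = eval q p :=
    fun p => RingHom.congr_fun hφ p
  refine ⟨fun c => φ (gen c), fun P hP => ?_⟩
  have h₁ : φ.comp θ = eval (Sum.elim q fun c => φ (gen c)) := by
    refine ringHom_ext (fun a => ?_) ?_
    · simp [θ, hφ']
    · rintro (i | c) <;> simp [θ, hφ']
  have h₂ : ∀ u : U, ((Pi.evalRingHom (fun _ : U => ℂ) u).comp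
      (S.val : S →+* (U → ℂ))).comp θ = eval (Sum.elim u.1 fun c => f c u) := by
    intro u
    refine ringHom_ext (fun a => ?_) ?_
    · simp [θ, halg]
    · rintro (i | c) <;> simp [θ, halg, gen]
  have h₃ : θ P = 0 := Subtype.ext (_root_.funext fun u => by
    have := RingHom.congr_fun (h₂ u) P
    rw [hP u] at this
    exact this)
  rw [← h₁, RingHom.comp_apply, h₃, map_zero]

theorem levelEq_congr {r : ℕ → ℕ} {q q' : ℕ → ℂ} {j : ℕ} (h : q j = q' j) (z : ℕ → ℕ → ℂ)
    (s : ℕ) : levelEq r q z j s = levelEq r q' z j s := by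
  rw [levelEq, levelEq, h]

/-- The parameter sequence `q` with `q (i + 1) = e i` for `i < k`. -/
def paramSeq {k : ℕ} (e : Fin k → ℂ) (j : ℕ) : ℂ :=
  if h : j - 1 < k then e ⟨j - 1, h⟩ else 0

theorem paramSeq_eq {k : ℕ} (q : ℕ → ℂ) {j : ℕ} (h₁ : 1 ≤ j) (h₂ : j ≤ k) :
    paramSeq (fun i : Fin k => q (i.1 + 1)) j = q j := by
  rw [paramSeq, dif_pos (by omega)]
  exact congrArg q (Nat.sub_add_cancel h₁)

/-- On a nonempty open set of parameters the system has a family of distinct solutions of the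
expected size, the distinctness being witnessed by fixed coordinates. -/
theorem exists_open_family (k : ℕ) (r : ℕ → ℕ) (hr0 : r 0 = 0)
    (hpos : ∀ j, 1 ≤ j → j ≤ k + 1 → 0 < r j) :
    ∃ (ι : Type) (_ : Fintype ι) (c : ι → ι → ℕ × ℕ) (e₀ : Fin k → ℂ),
      Fintype.card ι = ∏ j ∈ Finset.Icc 1 k, (r (j + 1)).descFactorial (r j) ∧
      ∀ᶠ e in nhds e₀, ∃ x : ι → ℕ → ℕ → ℂ,
        (∀ i i', i ≠ i' → x i (c i i').1 (c i i').2 ≠ x i' (c i i').1 (c i i').2) ∧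
        ∀ i, IsDistinctSolution k r (paramSeq e) (x i) := by
  obtain ⟨q, -, ι, _, x, hcard, hinj, hx⟩ := exists_family_isNondegenerateAt r hr0 k hpos
  obtain ⟨c, hc⟩ := exists_separating_coordinates k r x hinj fun i => (hx i).1.2.2
  refine ⟨ι, inferInstance, c, fun i => q (i.1 + 1), hcard, ?_⟩
  have heq : ∀ p ∈ levelIndex k r, ∀ z,
      levelEq r (paramSeq fun i : Fin k => q (i.1 + 1)) z p.1 p.2 = levelEq r q z p.1 p.2 :=
    fun p hp z => levelEq_congr
      (paramSeq_eq q (mem_levelIndex.mp hp).1 (mem_levelIndex.mp hp).2.1) z _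
  have hev := eventually_exists_family_isNondegenerateAt (levelIndex k r)
    (fun e : Fin k → ℂ => levelEq r (paramSeq e)) (fun p _ => ?_) (fun i => q (i.1 + 1)) x
    (fun i j s h => (hx i).1.1 j s fun h' => h (mem_levelIndex.mpr h')) (fun i p hp => ?_)
    (fun i δ hδ hd => (hx i).2 δ hδ fun p hp => ?_) _ hc
  · filter_upwards [hev] with e ⟨v, ⟨hsep, hdist⟩, hv⟩
    refine ⟨v, hsep, fun i => ⟨fun j s h => (hv i).1 j s fun h' => h (mem_levelIndex.mp h'),
      fun j hj s hs => (hv i).2.1 (j, s) ?_, hdist i⟩⟩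
    rw [Finset.mem_Icc] at hj hs
    exact mem_levelIndex.mpr ⟨hj.1, hj.2, hs⟩
  · refine contDiff_levelEq r _ _ (fun j => ?_) (contDiff_extendByZero _) p.1 p.2
    unfold paramSeq
    split_ifs
    · exact (contDiff_apply ℂ ℂ _).comp contDiff_fst
    · exact contDiff_const
  · have hp' := mem_levelIndex.mp hp
    rw [heq p hp]
    exact (hx i).1.2.1 p.1 (Finset.mem_Icc.mpr ⟨hp'.1, hp'.2.1⟩) p.2 (Finset.mem_Icc.mpr hp'.2.2)
  · simpa only [heq p hp] using hd p hp

/-- For generic `q` the system has at least the expected number of solutions. -/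
theorem exists_ne_zero_forall_exists_finset (k : ℕ) (r : ℕ → ℕ) (hr0 : r 0 = 0)
    (hpos : ∀ j, 1 ≤ j → j ≤ k + 1 → 0 < r j) :
    ∃ h : MvPolynomial (Fin k) ℂ, h ≠ 0 ∧ ∀ q : ℕ → ℂ,
      MvPolynomial.eval (fun i : Fin k => q (i.1 + 1)) h ≠ 0 →
      ∃ T : Finset (ℕ → ℕ → ℂ), (∀ z ∈ T, IsDistinctSolution k r q z) ∧
        T.card = ∏ j ∈ Finset.Icc 1 k, (r (j + 1)).descFactorial (r j) := by
  classical
  obtain ⟨ι, _, c, e₀, hcard, hev⟩ := exists_open_family k r hr0 hpos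
  set J := levelIndex k r
  obtain ⟨U, hU, hUx⟩ := Filter.eventually_iff_exists_mem.mp hev
  choose v hvsep hv using fun e : U => hUx e e.2
  have hvJ : ∀ e i j s, (j, s) ∉ J → v e i j s = 0 :=
    fun e i j s h => (hv e i).1 j s fun h' => h (mem_levelIndex.mpr h')
  let κ := (ι × J) ⊕ ((ι × J) × (ι × J))
  obtain ⟨h, h0, hh⟩ := MvPolynomial.exists_ne_zero_forall_exists_relations (κ := κ) hU
    (Sum.elim (fun p e => v e p.1 p.2.1.1 p.2.1.2) fun p e =>
      (v e p.1.1 p.1.2.1.1 p.1.2.1.2 - v e p.2.1 p.2.2.1.1 p.2.2.1.2)⁻¹)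
  refine ⟨h, h0, fun q hq => ?_⟩
  obtain ⟨g, hg⟩ := hh _ hq
  let z : ι → ℕ → ℕ → ℂ := fun i => extendByZero J fun p => g (Sum.inl (i, p))
  let Z : ι → ℕ → ℕ → MvPolynomial (Fin k ⊕ κ) ℂ := fun i j s =>
    if h : (j, s) ∈ J then MvPolynomial.X (Sum.inr (Sum.inl (i, ⟨(j, s), h⟩))) else 0
  have hZv : ∀ e i j s, MvPolynomial.eval (Sum.elim e.1 fun c : κ => Sum.elim
      (fun p e => v e p.1 p.2.1.1 p.2.1.2) (fun p e =>
        (v e p.1.1 p.1.2.1.1 p.1.2.1.2 - v e p.2.1 p.2.2.1.1 p.2.2.1.2)⁻¹) c e) (Z i j s) =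
      v e i j s := by
    intro e i j s
    by_cases h : (j, s) ∈ J
    · simp [Z, h]
    · simp [Z, h, hvJ e i j s h]
  have hZz : ∀ i j s, MvPolynomial.eval (Sum.elim (fun i : Fin k => q (i.1 + 1)) g) (Z i j s) =
      z i j s := by
    intro i j s
    by_cases h : (j, s) ∈ J <;> simp [Z, z, extendByZero, h]
  have hne : ∀ (i i' : ι) (p p' : J), (∀ e, v e i p.1.1 p.1.2 ≠ v e i' p'.1.1 p'.1.2) →
      z i p.1.1 p.1.2 ≠ z i' p'.1.1 p'.1.2 := by
    intro i i' p p' hne heq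
    have := hg ((Z i p.1.1 p.1.2 - Z i' p'.1.1 p'.1.2) *
      MvPolynomial.X (Sum.inr (Sum.inr ((i, p), (i', p')))) - 1) fun e => by
        rw [map_sub, map_mul, map_sub, hZv, hZv, MvPolynomial.eval_X, map_one]
        exact sub_eq_zero.mpr (mul_inv_cancel₀ (sub_ne_zero.mpr (hne e)))
    rw [map_sub, map_mul, map_sub, hZz, hZz, heq] at this
    simp at this
  have hzinj : Function.Injective z := by
    intro i i' hii
    by_contra hne'
    by_cases hc : c i i' ∈ J
    · exact hne i i' ⟨_, hc⟩ ⟨_, hc⟩ (fun e => hvsep e i i' hne') (by rw [hii])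
    · exact hvsep ⟨e₀, mem_of_mem_nhds hU⟩ i i' hne' (by rw [hvJ _ i _ _ hc, hvJ _ i' _ _ hc])
  refine ⟨Finset.univ.image z, fun y hy => ?_, by
    rw [Finset.card_image_of_injective _ hzinj, Finset.card_univ, hcard]⟩
  obtain ⟨i, -, rfl⟩ := Finset.mem_image.mp hy
  have hmem : ∀ j ∈ Finset.Icc 1 k, ∀ s ∈ Finset.Icc 1 (r j), (j, s) ∈ J := fun j hj s hs =>
    mem_levelIndex.mpr ⟨(Finset.mem_Icc.mp hj).1, (Finset.mem_Icc.mp hj).2, Finset.mem_Icc.mp hs⟩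
  refine ⟨fun j s hjs => dif_neg fun h => hjs (mem_levelIndex.mp h), fun j hj s hs => ?_,
    fun j hj s hs u hu hsu => hne i i ⟨_, hmem j hj s hs⟩ ⟨_, hmem j hj u hu⟩ fun e =>
      (hv e i).2.2 j hj s hs u hu hsu⟩
  have hjk : j - 1 < k := by
    rw [Finset.mem_Icc] at hj
    omega
  have hP := hg ((∏ a ∈ Finset.Icc 1 (r (j + 1)), (Z i j s - Z i (j + 1) a)) -
    MvPolynomial.X (Sum.inl ⟨j - 1, hjk⟩) *
      ∏ b ∈ Finset.Icc 1 (r (j - 1)), (Z i j s - Z i (j - 1) b)) fun e => by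
    simp only [map_sub, map_mul, map_prod, hZv, MvPolynomial.eval_X, Sum.elim_inl]
    have := (hv e i).2.1 j hj s hs
    rwa [paramSeq, dif_pos hjk] at this
  simp only [map_sub, map_mul, map_prod, hZz, MvPolynomial.eval_X, Sum.elim_inl] at hP
  rwa [Nat.sub_add_cancel (Finset.mem_Icc.mp hj).1] at hP

/-- For generic nonzero `q = (q_1,…,q_k)`, the system `(P_q)` has exactly
`∏_{j=1}^k r_{j+1}!/(r_{j+1}-r_j)!` solutions with pairwise distinct same-level coordinates. -/
theorem stmt_1 (k n : ℕ) (hk : 1 ≤ k) (r : ℕ → ℕ)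
    (hr0 : r 0 = 0) (hr1 : 0 < r 1)
    (hmono : ∀ j, 1 ≤ j → j ≤ k → r j ≤ r (j + 1))
    (hrn : r (k + 1) = n) :
    ∃ h : MvPolynomial (Fin k) ℂ, h ≠ 0 ∧
      ∀ q : ℕ → ℂ, (∀ j ∈ Finset.Icc 1 k, q j ≠ 0) →
        MvPolynomial.eval (fun i : Fin k => q (i.1 + 1)) h ≠ 0 →
        ∃ S : Finset (ℕ → ℕ → ℂ),
          (∀ z : ℕ → ℕ → ℂ, z ∈ S ↔
            ((∀ j s : ℕ, ¬(1 ≤ j ∧ j ≤ k ∧ 1 ≤ s ∧ s ≤ r j) → z j s = 0) ∧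
             (∀ j ∈ Finset.Icc 1 k, ∀ s ∈ Finset.Icc 1 (r j),
               (∏ a ∈ Finset.Icc 1 (r (j + 1)), (z j s - z (j + 1) a)) -
                 q j * ∏ b ∈ Finset.Icc 1 (r (j - 1)), (z j s - z (j - 1) b) = 0) ∧
             (∀ j ∈ Finset.Icc 1 k, ∀ s ∈ Finset.Icc 1 (r j), ∀ u ∈ Finset.Icc 1 (r j),
               s ≠ u → z j s ≠ z j u))) ∧
          S.card = ∏ j ∈ Finset.Icc 1 k,
            Nat.factorial (r (j + 1)) / Nat.factorial (r (j + 1) - r j) := by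
  have hpos : ∀ j, 1 ≤ j → j ≤ k + 1 → 0 < r j := by
    intro j h₁
    induction j, h₁ using Nat.le_induction with
    | base => exact fun _ => hr1
    | succ j h₁ ih => exact fun h₂ => (ih (by omega)).trans_le (hmono j h₁ (by omega))
  obtain ⟨h, h0, hh⟩ := exists_ne_zero_forall_exists_finset k r hr0 hpos
  refine ⟨h, h0, fun q _ hq => ?_⟩
  obtain ⟨T, hT, hcard⟩ := hh q hq
  refine ⟨T, fun z => ⟨hT z, fun hz => ?_⟩, ?_⟩
  · classical
    by_contra hzT
    have hle := card_le_of_isDistinctSolution k r hr0 hr1 hmono q (insert z T) fun y hy => by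
      rcases Finset.mem_insert.mp hy with rfl | hy
      · exact hz
      · exact hT y hy
    rw [Finset.card_insert_of_notMem hzT] at hle
    omega
  · rw [hcard]
    refine Finset.prod_congr rfl fun j hj => ?_
    rw [Finset.mem_Icc] at hj
    exact Nat.descFactorial_eq_div (hmono j hj.1 hj.2)
end

section
/- For every q = (q_1,…,q_k) ∈ ℂ^k with q_j ≠ 0 for all j, the set of tuples z = (z_{s,j}) ∈ ℂ^{|r|} satisfying the system (S0_q) is finite of cardinality exactly ∏_{j=1}^k r_{j+1}^{r_j}, and every solution has all coordinates nonzero, i.e. z_{s,j} ≠ 0 for all 1 ≤ j ≤ k and 1 ≤ s ≤ r_j. -/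
open Polynomial in
/-- A nonzero complex number has exactly `m` distinct `m`-th roots. -/
lemma exists_finset_roots {m : ℕ} (hm : 0 < m) {c : ℂ} (hc : c ≠ 0) :
    ∃ T : Finset ℂ, (∀ x, x ∈ T ↔ x ^ m = c) ∧ T.card = m := by
  have hp := Complex.isPrimitiveRoot_exp m hm.ne'
  refine ⟨(nthRoots m c).toFinset, fun x => by simp [mem_nthRoots hm], ?_⟩
  rw [Multiset.toFinset_card_of_nodup (hp.nthRoots_nodup hc), hp.card_nthRoots,
    if_pos (IsAlgClosed.exists_pow_nat_eq c hm)]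

/-- The functions vanishing off `A` and taking values in `T` on `A` form a finite set with
`T.card ^ A.card` elements. -/
lemma exists_finset_functions {α β : Type*} [DecidableEq α] [Zero β]
    (A : Finset α) (T : Finset β) :
    ∃ F : Finset (α → β), (∀ w, w ∈ F ↔ (∀ s, s ∉ A → w s = 0) ∧ ∀ s ∈ A, w s ∈ T) ∧
      F.card = T.card ^ A.card := by
  classical
  refine ⟨(A.pi fun _ => T).image fun f s => if h : s ∈ A then f s h else 0, fun w => ?_, ?_⟩
  · simp only [Finset.mem_image, Finset.mem_pi]
    constructor
    · rintro ⟨f, hf, rfl⟩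
      exact ⟨fun s hs => by simp [hs], fun s hs => by simpa [hs] using hf s hs⟩
    · rintro ⟨h0, hT⟩
      refine ⟨fun s _ => w s, hT, funext fun s => ?_⟩
      by_cases hs : s ∈ A
      · simp [hs]
      · simp [hs, h0 s hs]
  · rw [Finset.card_image_of_injective, Finset.card_pi, Finset.prod_const]
    intro f g hfg
    funext s hs
    simpa [hs] using congrFun hfg s

/-- Solving the triangular system level by level. -/
lemma exists_finset_solutions (r : ℕ → ℕ) (q : ℕ → ℂ) (hr0 : r 0 = 0) (k : ℕ)
    (hr : ∀ j ∈ Finset.Icc 1 k, 0 < r (j + 1)) (hq : ∀ j ∈ Finset.Icc 1 k, q j ≠ 0) :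
    ∃ S : Finset (ℕ → ℕ → ℂ),
      (∀ z : ℕ → ℕ → ℂ, z ∈ S ↔
        ((∀ j s : ℕ, ¬(1 ≤ j ∧ j ≤ k ∧ 1 ≤ s ∧ s ≤ r j) → z j s = 0) ∧
         ∀ j ∈ Finset.Icc 1 k, ∀ s ∈ Finset.Icc 1 (r j),
           z j s ^ r (j + 1) =
             (-1 : ℂ) ^ r (j - 1) * q j * ∏ b ∈ Finset.Icc 1 (r (j - 1)), z (j - 1) b)) ∧
      S.card = ∏ j ∈ Finset.Icc 1 k, r (j + 1) ^ r j ∧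
      ∀ z ∈ S, ∀ j ∈ Finset.Icc 1 k, ∀ s ∈ Finset.Icc 1 (r j), z j s ≠ 0 := by
  classical
  induction k with
  | zero =>
    refine ⟨{0}, fun z => ?_, by simp, by simp⟩
    rw [Finset.mem_singleton]
    constructor
    · rintro rfl
      simp
    · rintro ⟨h, -⟩
      funext j s
      exact h j s (by omega)
  | succ k ih =>
    have hsub : ∀ j ∈ Finset.Icc 1 k, j ∈ Finset.Icc 1 (k + 1) := fun j hj => by
      rw [Finset.mem_Icc] at hj ⊢
      omega
    obtain ⟨S, hS, hcard, hne⟩ := ih (fun j hj => hr j (hsub j hj)) (fun j hj => hq j (hsub j hj))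
    have hlast : k + 1 ∈ Finset.Icc 1 (k + 1) := by simp
    let c : (ℕ → ℕ → ℂ) → ℂ := fun z =>
      (-1 : ℂ) ^ r k * q (k + 1) * ∏ b ∈ Finset.Icc 1 (r k), z k b
    have hc : ∀ z ∈ S, c z ≠ 0 := fun z hz => by
      refine mul_ne_zero (mul_ne_zero (pow_ne_zero _ (by norm_num)) (hq _ hlast))
        (Finset.prod_ne_zero_iff.2 fun b hb => ?_)
      rcases Nat.eq_zero_or_pos k with rfl | hk
      · simp [hr0] at hb
      · exact hne z hz k (Finset.mem_Icc.2 ⟨hk, le_rfl⟩) b hb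
    have hF : ∀ z : ℕ → ℕ → ℂ, ∃ F : Finset (ℕ → ℂ), z ∈ S →
        (∀ w, w ∈ F ↔ (∀ s, s ∉ Finset.Icc 1 (r (k + 1)) → w s = 0) ∧
          ∀ s ∈ Finset.Icc 1 (r (k + 1)), w s ^ r (k + 2) = c z) ∧
        F.card = r (k + 2) ^ r (k + 1) := fun z => by
      by_cases hz : z ∈ S
      · obtain ⟨T, hT, hTc⟩ := exists_finset_roots (hr _ hlast) (hc z hz)
        obtain ⟨F, hF, hFc⟩ := exists_finset_functions (Finset.Icc 1 (r (k + 1))) T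
        refine ⟨F, fun _ => ⟨fun w => ?_, by simpa [hTc] using hFc⟩⟩
        simp only [hF, hT]
      · exact ⟨∅, fun h => absurd h hz⟩
    choose F hF using hF
    have hmem : ∀ z : ℕ → ℕ → ℂ,
        z ∈ (S.sigma F).image (fun p => Function.update p.1 (k + 1) p.2) ↔
        ((∀ j s : ℕ, ¬(1 ≤ j ∧ j ≤ k + 1 ∧ 1 ≤ s ∧ s ≤ r j) → z j s = 0) ∧
         ∀ j ∈ Finset.Icc 1 (k + 1), ∀ s ∈ Finset.Icc 1 (r j),
           z j s ^ r (j + 1) =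
             (-1 : ℂ) ^ r (j - 1) * q j *
               ∏ b ∈ Finset.Icc 1 (r (j - 1)), z (j - 1) b) := fun z => by
      simp only [Finset.mem_image, Finset.mem_sigma, Sigma.exists]
      constructor
      · rintro ⟨y, w, ⟨hy, hw⟩, rfl⟩
        obtain ⟨hy0, hyeq⟩ := (hS y).1 hy
        obtain ⟨hw0, hweq⟩ := ((hF y hy).1 w).1 hw
        refine ⟨fun j s hjs => ?_, fun j hj s hs => ?_⟩
        · rcases eq_or_ne j (k + 1) with rfl | hj
          · rw [Function.update_self]
            exact hw0 s (by rw [Finset.mem_Icc]; omega)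
          · rw [Function.update_of_ne hj]
            exact hy0 j s (by omega)
        · have hj' := Finset.mem_Icc.1 hj
          rw [Function.update_of_ne (show j - 1 ≠ k + 1 by omega)]
          rcases eq_or_ne j (k + 1) with rfl | hne'
          · rw [Function.update_self]
            exact hweq s hs
          · rw [Function.update_of_ne hne']
            exact hyeq j (Finset.mem_Icc.2 (by omega)) s hs
      · rintro ⟨hz0, hzeq⟩
        have hy : Function.update z (k + 1) 0 ∈ S := by
          refine (hS _).2 ⟨fun j s hjs => ?_, fun j hj s hs => ?_⟩
          · rcases eq_or_ne j (k + 1) with rfl | hj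
            · simp
            · rw [Function.update_of_ne hj]
              exact hz0 j s (by omega)
          · have hj' := Finset.mem_Icc.1 hj
            rw [Function.update_of_ne (show j - 1 ≠ k + 1 by omega),
              Function.update_of_ne (show j ≠ k + 1 by omega)]
            exact hzeq j (hsub j hj) s hs
        refine ⟨Function.update z (k + 1) 0, z (k + 1), ⟨hy, ?_⟩, by simp⟩
        refine ((hF _ hy).1 _).2 ⟨fun s hs => hz0 _ s ?_, fun s hs => ?_⟩
        · rw [Finset.mem_Icc] at hs
          omega
        · simp only [c]
          rw [Function.update_of_ne (show k ≠ k + 1 by omega)]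
          exact hzeq (k + 1) hlast s hs
    refine ⟨_, hmem, ?_, fun z hz j hj s hs => ?_⟩
    · rw [Finset.card_image_of_injOn, Finset.card_sigma,
        Finset.sum_congr rfl fun z hz => (hF z hz).2, Finset.sum_const, hcard,
        Finset.prod_Icc_succ_top (by omega), smul_eq_mul]
      rintro ⟨y, w⟩ hp ⟨y', w'⟩ hp' h
      have hy := (Finset.mem_sigma.1 hp).1
      have hy' := (Finset.mem_sigma.1 hp').1
      simp only at h hy hy'
      have hw : w = w' := by simpa using congrFun h (k + 1)
      have hyy : y = y' := by
        funext j s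
        rcases eq_or_ne j (k + 1) with rfl | hj
        · rw [((hS y).1 hy).1 _ _ (by omega), ((hS y').1 hy').1 _ _ (by omega)]
        · simpa [hj] using congrFun (congrFun h j) s
      subst hw hyy
      rfl
    · obtain ⟨⟨y, w⟩, hp, rfl⟩ := Finset.mem_image.1 hz
      obtain ⟨hy, hw⟩ := Finset.mem_sigma.1 hp
      simp only at hy hw ⊢
      rcases eq_or_ne j (k + 1) with rfl | hne'
      · rw [Function.update_self]
        intro h0
        have := (((hF y hy).1 w).1 hw).2 s hs
        rw [h0, zero_pow (hr _ hlast).ne'] at this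
        exact hc y hy this.symm
      · rw [Function.update_of_ne hne']
        rw [Finset.mem_Icc] at hj
        exact hne y hy j (Finset.mem_Icc.2 (by omega)) s hs


/-- For every nonzero `q`, the degenerate system `(S0_q)` has exactly
`∏_{j=1}^k r_{j+1}^{r_j}` solutions, and all coordinates of every solution are nonzero. -/
theorem stmt_2 (k n : ℕ) (hk : 1 ≤ k) (r : ℕ → ℕ)
    (hr0 : r 0 = 0) (hr1 : 0 < r 1)
    (hmono : ∀ j, 1 ≤ j → j ≤ k → r j ≤ r (j + 1))
    (hrn : r (k + 1) = n)
    (q : ℕ → ℂ) (hq : ∀ j ∈ Finset.Icc 1 k, q j ≠ 0) :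
    ∃ S : Finset (ℕ → ℕ → ℂ),
      (∀ z : ℕ → ℕ → ℂ, z ∈ S ↔
        ((∀ j s : ℕ, ¬(1 ≤ j ∧ j ≤ k ∧ 1 ≤ s ∧ s ≤ r j) → z j s = 0) ∧
         ∀ j ∈ Finset.Icc 1 k, ∀ s ∈ Finset.Icc 1 (r j),
           z j s ^ r (j + 1) -
             (-1 : ℂ) ^ r (j - 1) * q j * ∏ b ∈ Finset.Icc 1 (r (j - 1)), z (j - 1) b = 0)) ∧
      S.card = ∏ j ∈ Finset.Icc 1 k, r (j + 1) ^ r j ∧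
      ∀ z ∈ S, ∀ j ∈ Finset.Icc 1 k, ∀ s ∈ Finset.Icc 1 (r j), z j s ≠ 0 := by
  have hpos : ∀ j, j ≤ k → 0 < r (j + 1) := fun j => by
    induction j with
    | zero => exact fun _ => hr1
    | succ j ih => exact fun hj => (ih (by omega)).trans_le (hmono (j + 1) (by omega) hj)
  simp only [sub_eq_zero]
  exact exists_finset_solutions r q hr0 k (fun j hj => hpos j (Finset.mem_Icc.1 hj).2) hq
end

section
/- For every q = (q_1,…,q_k) ∈ ℂ^k with q_j ≠ 0 for all j, the set of tuples z = (z_{s,j}) ∈ ℂ^{|r|} satisfying the system (S0_q) and moreover satisfying z_{s,j} ≠ z_{u,j} for every 1 ≤ j ≤ k and all 1 ≤ s ≠ u ≤ r_j, is finite and has cardinality exactly ∏_{j=1}^k r_{j+1}! / (r_{j+1} − r_j)!. -/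
open Finset Classical in
/-- The functions supported on `{1, …, m}` and injective there, with values in `T`. -/
noncomputable def injectiveRows (m : ℕ) (T : Finset ℂ) : Finset (ℕ → ℂ) :=
  (univ : Finset (Icc 1 m ↪ T)).image
    fun e s => if h : s ∈ Icc 1 m then (e ⟨s, h⟩ : ℂ) else 0

theorem mem_injectiveRows {m : ℕ} {T : Finset ℂ} {w : ℕ → ℂ} :
    w ∈ injectiveRows m T ↔
      (∀ s ∉ Finset.Icc 1 m, w s = 0) ∧ (∀ s ∈ Finset.Icc 1 m, w s ∈ T) ∧
        Set.InjOn w (Finset.Icc 1 m) := by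
  simp only [injectiveRows, Finset.mem_image, Finset.mem_univ, true_and]
  constructor
  · rintro ⟨e, rfl⟩
    refine ⟨fun s hs => dif_neg hs, fun s hs => ?_, fun s hs u hu h => ?_⟩
    · simp only [dif_pos hs, Finset.coe_mem]
    · have hs' := Finset.mem_coe.1 hs
      have hu' := Finset.mem_coe.1 hu
      simp only [dif_pos hs', dif_pos hu'] at h
      exact congrArg Subtype.val (e.injective (Subtype.ext h))
  · rintro ⟨h0, hT, hinj⟩
    refine ⟨⟨fun s => ⟨w s, hT s s.2⟩, fun s u h => ?_⟩, ?_⟩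
    · exact Subtype.ext (hinj s.2 u.2 (congrArg Subtype.val h))
    · funext s
      by_cases hs : s ∈ Finset.Icc 1 m
      · exact dif_pos hs
      · simp only [dif_neg hs, h0 s hs]

theorem card_injectiveRows (m : ℕ) (T : Finset ℂ) :
    (injectiveRows m T).card = T.card.descFactorial m := by
  classical
  rw [injectiveRows, Finset.card_image_of_injective]
  · simp [Fintype.card_embedding_eq]
  · intro e f h
    ext s
    have hs := congrFun h s
    simpa only [dif_pos s.2] using hs

theorem card_nthRoots_toFinset_of_ne_zero {N : ℕ} (hN : 0 < N) {c : ℂ} (hc : c ≠ 0) :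
    (Polynomial.nthRoots N c).toFinset.card = N := by
  have hprim := Complex.isPrimitiveRoot_exp N hN.ne'
  rw [Multiset.toFinset_card_of_nodup (hprim.nthRoots_nodup hc), hprim.card_nthRoots,
    if_pos (IsAlgClosed.exists_pow_nat_eq c hN)]

/-- The right-hand side of the equations at level `j`. -/
noncomputable def levelConstant (r : ℕ → ℕ) (q : ℕ → ℂ) (z : ℕ → ℕ → ℂ) (j : ℕ) : ℂ :=
  (-1 : ℂ) ^ r (j - 1) * q j * ∏ b ∈ Finset.Icc 1 (r (j - 1)), z (j - 1) b

theorem levelConstant_congr {r : ℕ → ℕ} {q : ℕ → ℂ} {z y : ℕ → ℕ → ℂ} {j : ℕ}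
    (h : z (j - 1) = y (j - 1)) : levelConstant r q z j = levelConstant r q y j := by
  simp only [levelConstant, h]

/-- The rows that can stand at level `j` above the lower levels of `z`. -/
noncomputable def levelRows (r : ℕ → ℕ) (q : ℕ → ℂ) (z : ℕ → ℕ → ℂ) (j : ℕ) :
    Finset (ℕ → ℂ) :=
  injectiveRows (r j) (Polynomial.nthRoots (r (j + 1)) (levelConstant r q z j)).toFinset

/-- `z` is supported on the first `k` levels, and each of these levels is a row of distinct
solutions above the previous level. -/
def IsTower (r : ℕ → ℕ) (q : ℕ → ℂ) (k : ℕ) (z : ℕ → ℕ → ℂ) : Prop :=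
  (∀ j, j ∉ Finset.Icc 1 k → z j = 0) ∧ ∀ j ∈ Finset.Icc 1 k, z j ∈ levelRows r q z j

theorem mem_levelRows {r : ℕ → ℕ} {q : ℕ → ℂ} {z : ℕ → ℕ → ℂ} {j : ℕ} (hj : 0 < r (j + 1))
    {w : ℕ → ℂ} :
    w ∈ levelRows r q z j ↔
      (∀ s ∉ Finset.Icc 1 (r j), w s = 0) ∧
      (∀ s ∈ Finset.Icc 1 (r j), w s ^ r (j + 1) = levelConstant r q z j) ∧
        Set.InjOn w (Finset.Icc 1 (r j)) := by
  simp only [levelRows, mem_injectiveRows, Multiset.mem_toFinset, Polynomial.mem_nthRoots hj]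

theorem IsTower.levelConstant_ne_zero {r : ℕ → ℕ} {q : ℕ → ℂ} {k : ℕ} {z : ℕ → ℕ → ℂ}
    (hr0 : r 0 = 0) (hpos : ∀ j, 1 ≤ j → j ≤ k + 1 → 0 < r j) (h : IsTower r q k z) (j : ℕ)
    (hj : j ≤ k) (hq : ∀ i, 1 ≤ i → i ≤ j + 1 → q i ≠ 0) :
    levelConstant r q z (j + 1) ≠ 0 := by
  induction j with
  | zero => simpa [levelConstant, hr0] using hq 1 le_rfl le_rfl
  | succ j ih =>
    have hc := ih (by omega) fun i h1 h2 => hq i h1 (by omega)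
    have hrow := (mem_levelRows (hpos (j + 2) (by omega) (by omega))).1
      (h.2 (j + 1) (Finset.mem_Icc.2 ⟨by omega, hj⟩))
    refine mul_ne_zero (mul_ne_zero (by simp) (hq _ (by omega) le_rfl)) ?_
    refine Finset.prod_ne_zero_iff.2 fun b hb hz => hc ?_
    rw [← hrow.2.1 b hb]
    exact (congrArg (· ^ _) hz).trans
      (zero_pow (hpos (j + 2) (by omega) (by omega)).ne')

theorem isTower_succ_iff {r : ℕ → ℕ} {q : ℕ → ℂ} {k : ℕ} {z : ℕ → ℕ → ℂ} :
    IsTower r q (k + 1) z ↔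
      ∃ y w, IsTower r q k y ∧ w ∈ levelRows r q y (k + 1) ∧ Function.update y (k + 1) w = z := by
  have hrows : ∀ (y : ℕ → ℕ → ℂ) (w : ℕ → ℂ) (j : ℕ), 1 ≤ j → j ≤ k + 1 →
      levelRows r q (Function.update y (k + 1) w) j = levelRows r q y j := by
    intro y w j h1 hj
    rw [levelRows, levelRows,
      levelConstant_congr (Function.update_of_ne (by omega : j - 1 ≠ k + 1) w y)]
  constructor
  · rintro ⟨h0, h⟩
    refine ⟨Function.update z (k + 1) 0, z (k + 1), ⟨fun j hj => ?_, fun j hj => ?_⟩, ?_, ?_⟩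
    · by_cases hjk : j = k + 1
      · subst hjk
        simp
      · rw [Function.update_of_ne hjk]
        exact h0 j fun hj' => hj (by simp only [Finset.mem_Icc] at hj' ⊢; omega)
    · rw [Finset.mem_Icc] at hj
      rw [hrows _ _ _ hj.1 (by omega), Function.update_of_ne (by omega)]
      exact h j (Finset.mem_Icc.2 ⟨hj.1, by omega⟩)
    · rw [hrows _ _ _ (by omega) le_rfl]
      exact h _ (Finset.mem_Icc.2 ⟨by omega, le_rfl⟩)
    · simp
  · rintro ⟨y, w, ⟨h0, h⟩, hw, rfl⟩
    refine ⟨fun j hj => ?_, fun j hj => ?_⟩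
    · rw [Finset.mem_Icc] at hj
      by_cases hjk : j = k + 1
      · omega
      · rw [Function.update_of_ne hjk]
        exact h0 j fun hj' => hj (by simp only [Finset.mem_Icc] at hj'; omega)
    · rw [Finset.mem_Icc] at hj
      rw [hrows _ _ _ hj.1 hj.2]
      by_cases hjk : j = k + 1
      · subst hjk
        simpa using hw
      · rw [Function.update_of_ne hjk]
        exact h j (Finset.mem_Icc.2 ⟨hj.1, by omega⟩)

theorem exists_finset_isTower {r : ℕ → ℕ} {q : ℕ → ℂ} (k : ℕ) (hr0 : r 0 = 0)
    (hpos : ∀ j, 1 ≤ j → j ≤ k + 1 → 0 < r j) (hq : ∀ j, 1 ≤ j → j ≤ k → q j ≠ 0) :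
    ∃ S : Finset (ℕ → ℕ → ℂ), (∀ z, z ∈ S ↔ IsTower r q k z) ∧
      S.card = ∏ j ∈ Finset.Icc 1 k, (r (j + 1)).descFactorial (r j) := by
  classical
  induction k with
  | zero =>
    refine ⟨{0}, fun z => ?_, by simp⟩
    simp [IsTower, funext_iff]
  | succ k ih =>
    obtain ⟨S, hS, hcard⟩ := ih (fun j h1 h2 => hpos j h1 (by omega))
      fun j h1 h2 => hq j h1 (by omega)
    refine ⟨(S.sigma fun y => levelRows r q y (k + 1)).image
      fun p => Function.update p.1 (k + 1) p.2, fun z => ?_, ?_⟩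
    · simp only [isTower_succ_iff, Finset.mem_image, Finset.mem_sigma, Sigma.exists, hS, and_assoc]
    · rw [Finset.card_image_of_injOn, Finset.card_sigma, Finset.prod_Icc_succ_top (by omega),
        ← hcard, ← smul_eq_mul]
      · refine Finset.sum_const_nat fun y hy => ?_
        rw [levelRows, card_injectiveRows, card_nthRoots_toFinset_of_ne_zero
          (hpos _ (by omega) le_rfl)]
        exact ((hS y).1 hy).levelConstant_ne_zero hr0 (fun j h1 h2 => hpos j h1 (by omega)) k
          le_rfl hq
      · rintro ⟨y, w⟩ hy ⟨y', w'⟩ hy' h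
        simp only [Finset.coe_sigma, Set.mem_sigma_iff, Finset.mem_coe, hS] at hy hy' h
        have hw : w = w' := by simpa using congrFun h (k + 1)
        have hyy : y = y' := by
          funext j
          by_cases hj : j = k + 1
          · rw [hy.1.1 j (by simp [hj]), hy'.1.1 j (by simp [hj])]
          · simpa [hj] using congrFun h j
        rw [hw, hyy]

/-- For every nonzero `q`, the degenerate system `(S0_q)` has exactly
`∏_{j=1}^k r_{j+1}!/(r_{j+1}-r_j)!` solutions with pairwise distinct same-level coordinates. -/
theorem stmt_3 (k n : ℕ) (hk : 1 ≤ k) (r : ℕ → ℕ)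
    (hr0 : r 0 = 0) (hr1 : 0 < r 1)
    (hmono : ∀ j, 1 ≤ j → j ≤ k → r j ≤ r (j + 1))
    (hrn : r (k + 1) = n)
    (q : ℕ → ℂ) (hq : ∀ j ∈ Finset.Icc 1 k, q j ≠ 0) :
    ∃ S : Finset (ℕ → ℕ → ℂ),
      (∀ z : ℕ → ℕ → ℂ, z ∈ S ↔
        ((∀ j s : ℕ, ¬(1 ≤ j ∧ j ≤ k ∧ 1 ≤ s ∧ s ≤ r j) → z j s = 0) ∧
         (∀ j ∈ Finset.Icc 1 k, ∀ s ∈ Finset.Icc 1 (r j),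
           z j s ^ r (j + 1) -
             (-1 : ℂ) ^ r (j - 1) * q j * ∏ b ∈ Finset.Icc 1 (r (j - 1)), z (j - 1) b = 0) ∧
         (∀ j ∈ Finset.Icc 1 k, ∀ s ∈ Finset.Icc 1 (r j), ∀ u ∈ Finset.Icc 1 (r j),
           s ≠ u → z j s ≠ z j u))) ∧
      S.card = ∏ j ∈ Finset.Icc 1 k,
        Nat.factorial (r (j + 1)) / Nat.factorial (r (j + 1) - r j) := by
  have hpos : ∀ j, 1 ≤ j → j ≤ k + 1 → 0 < r j := by
    intro j h1
    induction j, h1 using Nat.le_induction with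
    | base => exact fun _ => hr1
    | succ j h1 ih => exact fun h => (ih (by omega)).trans_le (hmono j h1 (by omega))
  obtain ⟨S, hS, hcard⟩ := exists_finset_isTower k hr0 hpos
    fun j h1 h2 => hq j (Finset.mem_Icc.2 ⟨h1, h2⟩)
  refine ⟨S, fun z => (hS z).trans ?_, hcard.trans (Finset.prod_congr rfl fun j hj => ?_)⟩
  · have hrow : ∀ j ∈ Finset.Icc 1 k, 0 < r (j + 1) := fun j hj =>
      hpos _ (by omega) (by simp only [Finset.mem_Icc] at hj; omega)
    constructor
    · rintro ⟨h0, h⟩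
      refine ⟨fun j s hjs => ?_, fun j hj s hs => ?_, fun j hj s hs u hu hsu heq => ?_⟩
      · by_cases hj : j ∈ Finset.Icc 1 k
        · refine ((mem_levelRows (hrow j hj)).1 (h j hj)).1 s fun hs => hjs ?_
          simp only [Finset.mem_Icc] at hj hs
          omega
        · rw [h0 j hj, Pi.zero_apply]
      · exact sub_eq_zero.2 (((mem_levelRows (hrow j hj)).1 (h j hj)).2.1 s hs)
      · exact hsu (((mem_levelRows (hrow j hj)).1 (h j hj)).2.2 hs hu heq)
    · rintro ⟨h0, heqn, hne⟩
      refine ⟨fun j hj => funext fun s => h0 j s fun h => hj (Finset.mem_Icc.2 ⟨h.1, h.2.1⟩),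
        fun j hj => (mem_levelRows (hrow j hj)).2 ⟨fun s hs => h0 j s fun h => hs ?_,
          fun s hs => sub_eq_zero.1 (heqn j hj s hs), fun s hs u hu heq => ?_⟩⟩
      · exact Finset.mem_Icc.2 h.2.2
      · by_contra hsu
        exact hne j hj s hs u hu hsu heq
  · rw [Finset.mem_Icc] at hj
    exact Nat.descFactorial_eq_div (hmono j hj.1 hj.2)
end

section
/- Let t ∈ ℂ with t ≠ 0, q = (q_1,…,q_k) ∈ ℂ^k, and set ρ_j := r_{j+1} − r_{j-1}. A tuple z = (z_{s,j}) ∈ ℂ^{|r|} satisfies the equations ∏_{a=1}^{r_{j+1}} (z_{s,j} − t·z_{a,j+1}) − q_j · ∏_{b=1}^{r_{j-1}} (t·z_{s,j} − z_{b,j-1}) = 0 for all 1 ≤ j ≤ k and 1 ≤ s ≤ r_j (with the convention z_{a,k+1} := 0, and the product over b empty when j = 1) if and only if the rescaled tuple z' defined by z'_{s,j} := t^j · z_{s,j} satisfies the system (P_{q'}) with parameters q'_j := t^{jρ_j + r_{j-1}} · q_j. -/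
/-- The rescaled system with parameter `t ≠ 0` is equivalent, under `z'_{s,j} = t^j z_{s,j}`,
to the system `(P_{q'})` with `q'_j = t^{jρ_j + r_{j-1}} q_j`. -/
theorem stmt_5 (k n : ℕ) (hk : 1 ≤ k) (r : ℕ → ℕ)
    (hr0 : r 0 = 0) (hr1 : 0 < r 1)
    (hmono : ∀ j, 1 ≤ j → j ≤ k → r j ≤ r (j + 1))
    (hrn : r (k + 1) = n)
    (t : ℂ) (ht : t ≠ 0) (q : ℕ → ℂ) (z : ℕ → ℕ → ℂ) :
    (∀ j ∈ Finset.Icc 1 k, ∀ s ∈ Finset.Icc 1 (r j),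
      (∏ a ∈ Finset.Icc 1 (r (j + 1)),
        (z j s - t * (if j < k then z (j + 1) a else 0))) -
        q j * ∏ b ∈ Finset.Icc 1 (r (j - 1)), (t * z j s - z (j - 1) b) = 0)
    ↔
    (∀ j ∈ Finset.Icc 1 k, ∀ s ∈ Finset.Icc 1 (r j),
      (∏ a ∈ Finset.Icc 1 (r (j + 1)),
        (t ^ j * z j s - (if j < k then t ^ (j + 1) * z (j + 1) a else 0))) -
        (t ^ (j * (r (j + 1) - r (j - 1)) + r (j - 1)) * q j) *
          ∏ b ∈ Finset.Icc 1 (r (j - 1)), (t ^ j * z j s - t ^ (j - 1) * z (j - 1) b) = 0) := by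
  refine forall₂_congr fun j hj => forall₂_congr fun s _ => ?_
  obtain ⟨hj1, hjk⟩ := Finset.mem_Icc.mp hj
  obtain ⟨i, rfl⟩ : ∃ i, j = i + 1 := ⟨j - 1, by omega⟩
  simp only [Nat.add_sub_cancel]
  have hle : r i ≤ r (i + 1 + 1) := by
    rcases Nat.eq_zero_or_pos i with rfl | hi
    · simp [hr0]
    · exact (hmono i hi (by omega)).trans (hmono (i + 1) hj1 hjk)
  have hupper : ∏ a ∈ Finset.Icc 1 (r (i + 1 + 1)), (t ^ (i + 1) * z (i + 1) s -
        (if i + 1 < k then t ^ (i + 1 + 1) * z (i + 1 + 1) a else 0)) =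
      t ^ ((i + 1) * r (i + 1 + 1)) * ∏ a ∈ Finset.Icc 1 (r (i + 1 + 1)),
        (z (i + 1) s - t * (if i + 1 < k then z (i + 1 + 1) a else 0)) := by
    have hconst : t ^ ((i + 1) * r (i + 1 + 1)) =
        ∏ _a ∈ Finset.Icc 1 (r (i + 1 + 1)), t ^ (i + 1) := by simp [pow_mul]
    rw [hconst, ← Finset.prod_mul_distrib]
    refine Finset.prod_congr rfl fun a _ => ?_
    split_ifs <;> ring
  have hlower : ∏ b ∈ Finset.Icc 1 (r i), (t ^ (i + 1) * z (i + 1) s - t ^ i * z i b) =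
      t ^ (i * r i) * ∏ b ∈ Finset.Icc 1 (r i), (t * z (i + 1) s - z i b) := by
    have hconst : t ^ (i * r i) = ∏ _b ∈ Finset.Icc 1 (r i), t ^ i := by simp [pow_mul]
    rw [hconst, ← Finset.prod_mul_distrib]
    exact Finset.prod_congr rfl fun b _ => by ring
  have hexp : t ^ ((i + 1) * r (i + 1 + 1)) =
      t ^ ((i + 1) * (r (i + 1 + 1) - r i) + r i) * t ^ (i * r i) := by
    rw [← pow_add]
    obtain ⟨d, hd⟩ := Nat.exists_eq_add_of_le hle
    rw [hd, Nat.add_sub_cancel_left]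
    congr 1
    ring
  rw [hupper, hlower, mul_mul_mul_comm, ← hexp, ← mul_sub, mul_eq_zero,
    or_iff_right (pow_ne_zero _ ht)]
end

section
/- Let R be a commutative ring, n ≥ 1 and g ≥ 1 integers, and M an n × n matrix with entries in R. Then ∑_{f : {1,…,n} → {1,…,g}} ∑_{σ ∈ S_n, f∘σ = f} sgn(σ) ∏_{h=1}^n M_{h,σ(h)} = ∑_{f : {1,…,n} → {1,…,g}} ∏_{l=1}^g det(M_{f^{-1}(l), f^{-1}(l)}), where for a subset A ⊆ {1,…,n}, M_{A,A} denotes the principal submatrix of M with rows and columns indexed by A, and the determinant of the empty matrix is 1. -/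
/-- The part of the Leibniz expansion supported on the permutations preserving the fibres of `f`
is the product of the principal minors indexed by these fibres. -/
theorem sum_perm_comp_eq_prod_det {R ι α : Type*} [CommRing R] [Fintype ι] [DecidableEq ι]
    [Fintype α] [LinearOrder α] (M : Matrix ι ι R) (f : ι → α) :
    ∑ σ ∈ Finset.univ.filter (fun σ : Equiv.Perm ι => f ∘ σ = f),
        ((Equiv.Perm.sign σ : ℤ) : R) * ∏ h, M h (σ h) =
      ∏ l, Matrix.det (M.submatrix (fun i : {x // f x = l} => (i : ι))
        (fun i : {x // f x = l} => (i : ι))) := by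
  let N : Matrix ι ι R := Matrix.of fun i j => if f i = f j then M i j else 0
  have hN : N.BlockTriangular f := fun i j hij => if_neg hij.ne'
  have hdet : N.det = ∏ l, Matrix.det (M.submatrix (fun i : {x // f x = l} => (i : ι))
      (fun i : {x // f x = l} => (i : ι))) := by
    rw [hN.det_fintype]
    refine Finset.prod_congr rfl fun l _ => congrArg Matrix.det ?_
    ext i j
    exact if_pos (i.2.trans j.2.symm)
  rw [← hdet, ← Matrix.det_transpose, Matrix.det_apply', Finset.sum_filter]
  refine Finset.sum_congr rfl fun σ _ => ?_
  split_ifs with h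
  · congr 1
    exact Finset.prod_congr rfl fun i _ => (if_pos (congrFun h i).symm).symm
  · obtain ⟨i, hi⟩ := Function.ne_iff.mp h
    rw [Finset.prod_eq_zero (Finset.mem_univ i), mul_zero]
    exact if_neg (Ne.symm hi)

/-- Fiberwise-determinant expansion: the sum over functions `f : [n] → [g]` and permutations
preserving `f` of signed products equals the sum over ordered partitions of products of
principal minors. -/
theorem stmt_9 (R : Type*) [CommRing R] (n g : ℕ) (hn : 1 ≤ n) (hg : 1 ≤ g)
    (M : Matrix (Fin n) (Fin n) R) :
    ∑ f : Fin n → Fin g,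
      ∑ σ ∈ Finset.univ.filter (fun σ : Equiv.Perm (Fin n) => f ∘ σ = f),
        ((Equiv.Perm.sign σ : ℤ) : R) * ∏ h : Fin n, M h (σ h) =
    ∑ f : Fin n → Fin g,
      ∏ l : Fin g,
        Matrix.det (M.submatrix (fun i : {x : Fin n // f x = l} => (i : Fin n))
          (fun i : {x : Fin n // f x = l} => (i : Fin n))) := by
  exact Finset.sum_congr rfl fun f _ => sum_perm_comp_eq_prod_det M f
end

section
/- Let R be a commutative ℚ-algebra and ω_1,…,ω_m ∈ R nilpotent elements such that ∑_{i=1}^m ω_i^l = 0 for every integer l ≥ 2. Set α := ω_1 + … + ω_m. Then for every natural number N with α^N = 0, one has ∏_{i=1}^m (1 + ω_i) = ∑_{j=0}^{N−1} α^j / j!. -/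
/-- Newton's identity for a family whose power sums of exponent at least two vanish. -/
theorem succ_mul_sum_powersetCard_prod {R ι : Type*} [CommRing R] [Fintype ι] (ω : ι → R)
    (hpow : ∀ l : ℕ, 2 ≤ l → ∑ i, ω i ^ l = 0) (k : ℕ) :
    ((k + 1 : ℕ) : R) * ∑ t ∈ Finset.powersetCard (k + 1) Finset.univ, ∏ i ∈ t, ω i =
      (∑ t ∈ Finset.powersetCard k Finset.univ, ∏ i ∈ t, ω i) * ∑ i, ω i := by
  have newton := congrArg (MvPolynomial.aeval ω) (MvPolynomial.mul_esymm_eq_sum ι R (k + 1))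
  simp only [map_mul, map_natCast, map_pow, map_neg, map_one, map_sum, MvPolynomial.esymm,
    MvPolynomial.psum, map_prod, MvPolynomial.aeval_X] at newton
  rw [newton, Finset.sum_eq_single_of_mem (k, 1) (by simp)]
  · simp only [pow_one, ← mul_assoc, ← pow_add]
    rw [Even.neg_one_pow ⟨k + 1, by ring⟩, one_mul]
  · rintro ⟨a, b⟩ hab hne
    obtain ⟨hsum, hlt⟩ := Finset.mem_filter.mp hab
    replace hsum : a + b = k + 1 := Finset.HasAntidiagonal.mem_antidiagonal.mp hsum
    replace hlt : a < k + 1 := hlt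
    have hb : 2 ≤ b := by
      by_contra hb
      exact hne (Prod.ext (by lia) (by lia))
    rw [hpow b hb, mul_zero]

/-- If the power sums of exponent at least two vanish, the elementary symmetric functions are the
divided powers of the sum. -/
theorem sum_powersetCard_prod_eq_inv_factorial_smul {R ι : Type*} [CommRing R] [Algebra ℚ R]
    [Fintype ι] (ω : ι → R) (hpow : ∀ l : ℕ, 2 ≤ l → ∑ i, ω i ^ l = 0) (k : ℕ) :
    ∑ t ∈ Finset.powersetCard k Finset.univ, ∏ i ∈ t, ω i =
      (k.factorial : ℚ)⁻¹ • (∑ i, ω i) ^ k := by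
  induction k with
  | zero => simp
  | succ k ih =>
    have newton := succ_mul_sum_powersetCard_prod ω hpow k
    have hk : ((k + 1 : ℕ) : ℚ) ≠ 0 := by positivity
    rw [ih, smul_mul_assoc, ← pow_succ, ← nsmul_eq_mul, ← Nat.cast_smul_eq_nsmul ℚ] at newton
    rw [Nat.factorial_succ, Nat.cast_mul, mul_inv, mul_smul, ← newton, inv_smul_smul₀ hk]

/-- If `ω_1,…,ω_m` are nilpotent with `∑ ω_i^l = 0` for all `l ≥ 2` and `α = ∑ ω_i`,
then `∏ (1+ω_i) = ∑_{j=0}^{N-1} α^j/j!` whenever `α^N = 0`. -/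
theorem stmt_11 (R : Type*) [CommRing R] [Algebra ℚ R] (m : ℕ) (ω : Fin m → R)
    (hnil : ∀ i, IsNilpotent (ω i))
    (hpow : ∀ l : ℕ, 2 ≤ l → ∑ i, ω i ^ l = 0) :
    ∀ N : ℕ, (∑ i, ω i) ^ N = 0 →
      ∏ i, (1 + ω i) =
        ∑ j ∈ Finset.range N, ((j.factorial : ℚ))⁻¹ • (∑ i, ω i) ^ j := by
  intro N hN
  have hesymm := sum_powersetCard_prod_eq_inv_factorial_smul ω hpow
  rw [Finset.prod_one_add, Finset.sum_powerset, Finset.card_univ, Fintype.card_fin]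
  simp only [hesymm]
  rcases le_total N (m + 1) with h | h
  · refine (Finset.sum_subset (Finset.range_mono h) fun j _ hj => ?_).symm
    rw [pow_eq_zero_of_le (by simpa using hj) hN, smul_zero]
  · refine Finset.sum_subset (Finset.range_mono h) fun j _ hj => ?_
    rw [← hesymm, Finset.powersetCard_eq_empty.mpr (by simpa using hj), Finset.sum_empty]
end

section
/- Let n ≥ 2. There exists a nonzero polynomial h ∈ ℂ[q_1,q_2] such that for every (q_1,q_2) ∈ ℂ² with q_1 ≠ 0, q_2 ≠ 0 and h(q_1,q_2) ≠ 0 the following holds: whenever ζ, η_1,…,η_{n−1} ∈ ℂ satisfy ∏_{i=1}^{n−1} (ζ − η_i) = q_1, η_i^n + (−1)^n q_2 (η_i − ζ) = 0 for all 1 ≤ i ≤ n−1, and η_1,…,η_{n−1} are pairwise distinct, then there exists w ∈ ℂ with w ≠ 0, w^n q_2 = q_1, ζ^{n−1} w = q_1 (w + 1), and Q(η_i) = 0 for every 1 ≤ i ≤ n−1, where Q(Y) := ∑_{m=0}^{n−1} (−ζ/w)^{n−1−m} Y^m + (−1)^n q_2. -/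
open Polynomial in
/-- If `η` lists `n - 1` distinct roots of `Y ^ n + c (Y - ζ)` and `θ` is the remaining root, then
`∏ (Y - η i)` is the divided difference of this polynomial at `θ`. -/
lemma exists_complementary_root (n : ℕ) (hn : 2 ≤ n) (c ζ : ℂ) (η : Fin (n - 1) → ℂ)
    (hη : ∀ i, η i ^ n + c * (η i - ζ) = 0) (hinj : Function.Injective η) :
    ∃ θ : ℂ, θ ^ n + c * (θ - ζ) = 0 ∧ ζ ^ n = (ζ - θ) * ∏ i, (ζ - η i) ∧
      ∀ x, ∏ i, (x - η i) = (∑ m ∈ Finset.range n, θ ^ (n - 1 - m) * x ^ m) + c := by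
  set D : ℂ[X] := ∏ i, (X - C (η i)) with hD
  set P : ℂ[X] := X ^ n + C c * (X - C ζ) with hP
  have hlow : (C c * (X - C ζ)).degree < (n : WithBot ℕ) := by
    refine lt_of_le_of_lt (b := ((1 : ℕ) : WithBot ℕ)) ?_ (by exact_mod_cast hn)
    compute_degree
    exact le_rfl
  have hPmonic : P.Monic := monic_X_pow_add hlow
  have hPdeg : P.natDegree = n := by
    refine natDegree_eq_of_degree_eq_some ?_
    rw [hP, degree_add_eq_left_of_degree_lt (by simpa using hlow), degree_X_pow]
  have hDmonic : D.Monic := monic_prod_of_monic _ _ fun i _ => monic_X_sub_C _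
  have hDdeg : D.natDegree = n - 1 := by
    rw [hD, natDegree_prod_of_monic _ _ fun i _ => monic_X_sub_C _]
    simp
  have hdvd : D ∣ P := by
    refine Finset.prod_dvd_of_coprime
      (fun i _ j _ hij => pairwise_coprime_X_sub_C hinj hij) fun i _ => ?_
    rw [dvd_iff_isRoot]
    simpa [hP, IsRoot] using hη i
  obtain ⟨R, hR⟩ := hdvd
  have hRmonic : R.Monic := hDmonic.of_mul_monic_left (hR ▸ hPmonic)
  have hRdeg : R.natDegree = 1 := by
    have h := hDmonic.natDegree_mul hRmonic
    rw [← hR, hPdeg, hDdeg] at h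
    omega
  have hReq : R = X - C (-R.coeff 0) := by
    conv_lhs => rw [hRmonic.eq_X_add_C hRdeg]
    simp
  set θ := -R.coeff 0
  have hPθ : θ ^ n + c * (θ - ζ) = 0 := by
    have h := congrArg (eval θ) hR
    rw [hReq] at h
    simpa [hP] using h
  refine ⟨θ, hPθ, ?_, fun x => ?_⟩
  · have h := congrArg (eval ζ) hR
    rw [hReq] at h
    simp only [hP, hD, eval_add, eval_mul, eval_sub, eval_pow, eval_X, eval_C, eval_prod, sub_self,
      mul_zero, add_zero] at h
    rw [h, mul_comm]
  · have hQ : (∑ m ∈ Finset.range n, X ^ m * C θ ^ (n - 1 - m)) + C c = D := by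
      refine mul_left_cancel₀ (X_sub_C_ne_zero θ) ?_
      have hC := congrArg (C : ℂ → ℂ[X]) hPθ
      simp only [C_add, C_mul, C_sub, C_pow, C_0] at hC
      rw [mul_add, (Commute.all _ _).mul_geom_sum₂, mul_comm _ D, ← hReq, ← hR, hP]
      linear_combination C c * hReq - hC
    have h := congrArg (eval x) hQ
    simpa [hD, eval_finsetSum, eval_prod, mul_comm] using h.symm

/-- For generic `(q_1,q_2)` with `q_1 q_2 ≠ 0`, every non-degenerate solution of the system
for ranks `(1,n-1)` is described by an `n`-th root `w` of `q_1/q_2`. -/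
theorem stmt_13 (n : ℕ) (hn : 2 ≤ n) :
    ∃ h : MvPolynomial (Fin 2) ℂ, h ≠ 0 ∧
      ∀ q₁ q₂ : ℂ, q₁ ≠ 0 → q₂ ≠ 0 → MvPolynomial.eval ![q₁, q₂] h ≠ 0 →
        ∀ (ζ : ℂ) (η : Fin (n - 1) → ℂ),
          (∏ i, (ζ - η i)) = q₁ →
          (∀ i, η i ^ n + (-1 : ℂ) ^ n * q₂ * (η i - ζ) = 0) →
          Function.Injective η →
          ∃ w : ℂ, w ≠ 0 ∧ w ^ n * q₂ = q₁ ∧ ζ ^ (n - 1) * w = q₁ * (w + 1) ∧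
            ∀ i, (∑ m ∈ Finset.range n, (-(ζ / w)) ^ (n - 1 - m) * η i ^ m) +
              (-1 : ℂ) ^ n * q₂ = 0 := by
  refine ⟨1, one_ne_zero, fun q₁ q₂ hq₁ hq₂ _ ζ η hprod hη hinj => ?_⟩
  obtain ⟨θ, hθ, hζ, hQ⟩ := exists_complementary_root n hn _ ζ η hη hinj
  rw [hprod] at hζ
  have hroot (i) : (∑ m ∈ Finset.range n, θ ^ (n - 1 - m) * η i ^ m) + (-1 : ℂ) ^ n * q₂ = 0 := by
    rw [← hQ]
    exact Finset.prod_eq_zero (Finset.mem_univ i) (sub_self _)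
  have hn0 : n ≠ 0 := by omega
  by_cases hζ0 : ζ = 0
  · subst hζ0
    have hθ0 : θ = 0 := by simpa [hn0, hq₁] using hζ
    subst hθ0
    refine ⟨-1, by simp, ?_, ?_, fun i => by simpa using hroot i⟩
    · rw [← hprod, hQ, Finset.sum_eq_zero, zero_add]
      intro m _
      rcases eq_or_ne m 0 with rfl | hm
      · rw [zero_pow (by omega), zero_mul]
      · rw [zero_pow hm, mul_zero]
    · rw [zero_pow (by omega)]; simp
  · have hθ0 : θ ≠ 0 := by
      rintro rfl
      simp [hn0, hq₂, hζ0] at hθ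
    have hw : -(ζ / (-(ζ / θ))) = θ := by field_simp
    refine ⟨-(ζ / θ), by simp [hζ0, hθ0], ?_, ?_, fun i => by rw [hw]; exact hroot i⟩
    · rw [neg_pow, div_pow]
      field_simp
      rw [hζ]
      linear_combination -q₁ * hθ
    · obtain ⟨k, rfl⟩ : ∃ k, n = k + 1 := ⟨n - 1, by omega⟩
      rw [pow_succ] at hζ
      simp only [Nat.add_sub_cancel]
      field_simp
      linear_combination -hζ
end

section
/- Let n ≥ 2 and let q_1, q_2, ζ, w be nonzero complex numbers with w^n q_2 = q_1 and ζ^{n−1} w = q_1 (w + 1). Suppose η_1,…,η_{n−1} ∈ ℂ satisfy the polynomial identity (Y + ζ/w) · ∏_{i=1}^{n−1} (Y − η_i) = Y^n + (−1)^n q_2 (Y − ζ) in ℂ[Y]. Then the elementary symmetric polynomials of η_1,…,η_{n−1} satisfy e_i(η_1,…,η_{n−1}) = (ζ/w)^i for every 1 ≤ i ≤ n−2, and e_{n−1}(η_1,…,η_{n−1}) = q_2 w. -/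
open Polynomial in
/-- The Vieta formula for a finite product of linear factors `X - C (r i)`. -/
theorem Finset.prod_X_sub_C_coeff_card_sub {R σ : Type*} [CommRing R] (s : Finset σ) (r : σ → R)
    {k : ℕ} (h : k ≤ s.card) :
    (∏ i ∈ s, (X - C (r i))).coeff (s.card - k) =
      (-1) ^ k * ∑ A ∈ s.powersetCard k, ∏ j ∈ A, r j := by
  have hcoeff := Finset.prod_X_add_C_coeff s (fun i => -r i) (Nat.sub_le s.card k)
  simp only [map_neg, ← sub_eq_add_neg, Nat.sub_sub_self h] at hcoeff
  rw [hcoeff, Finset.mul_sum]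
  refine Finset.sum_congr rfl fun A hA => ?_
  rw [Finset.prod_neg, (Finset.mem_powersetCard.mp hA).2]

/-- Elementary symmetric functions of `η_1,…,η_{n-1}`:
`e_i = (ζ/w)^i` for `1 ≤ i ≤ n-2` and `e_{n-1} = q_2 w`. -/
theorem stmt_14 (n : ℕ) (hn : 2 ≤ n) (q₁ q₂ ζ w : ℂ)
    (hq₁ : q₁ ≠ 0) (hq₂ : q₂ ≠ 0) (hζ : ζ ≠ 0) (hw : w ≠ 0)
    (h1 : w ^ n * q₂ = q₁) (h2 : ζ ^ (n - 1) * w = q₁ * (w + 1))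
    (η : Fin (n - 1) → ℂ)
    (hpoly : (Polynomial.X + Polynomial.C (ζ / w)) *
        ∏ i, (Polynomial.X - Polynomial.C (η i)) =
      Polynomial.X ^ n + Polynomial.C ((-1 : ℂ) ^ n * q₂) *
        (Polynomial.X - Polynomial.C ζ)) :
    (∀ i : ℕ, 1 ≤ i → i ≤ n - 2 →
      ∑ A ∈ Finset.powersetCard i (Finset.univ : Finset (Fin (n - 1))),
        ∏ j ∈ A, η j = (ζ / w) ^ i) ∧
    ∑ A ∈ Finset.powersetCard (n - 1) (Finset.univ : Finset (Fin (n - 1))),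
      ∏ j ∈ A, η j = q₂ * w := by
  generalize hm : n - 1 = m at *
  obtain rfl : n = m + 1 := by omega
  have vieta : ∀ k ≤ m, (∏ i, (Polynomial.X - Polynomial.C (η i))).coeff (m - k) =
      (-1) ^ k * ∑ A ∈ Finset.powersetCard k (Finset.univ : Finset (Fin m)), ∏ j ∈ A, η j := by
    intro k hk
    simpa using Finset.prod_X_sub_C_coeff_card_sub Finset.univ η (k := k) (by simpa using hk)
  generalize (∏ i, (Polynomial.X - Polynomial.C (η i))) = P at hpoly vieta
  constructor
  · intro i _ hi
    replace hi : i + 1 ≤ m := by omega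
    clear * - vieta hpoly hi
    induction i with
    | zero => simp
    | succ i ih =>
      have hco := congrArg (Polynomial.coeff · (m - (i + 1) + 1)) hpoly
      have hne : m - (i + 1) ≠ m := by omega
      have hpos : m - (i + 1) ≠ 0 := by omega
      simp only [add_mul, Polynomial.coeff_add, Polynomial.coeff_X_mul, Polynomial.coeff_C_mul,
        Polynomial.coeff_X_pow, Polynomial.coeff_sub, Polynomial.coeff_X, Polynomial.coeff_C,
        Nat.add_right_cancel_iff, hne, right_eq_add, hpos, if_false, Nat.succ_ne_zero,
        sub_zero, mul_zero, add_zero] at hco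
      rw [vieta _ (by omega), show m - (i + 1) + 1 = m - i by omega, vieta _ (by omega),
        ih (by omega)] at hco
      refine mul_left_cancel₀ (pow_ne_zero (i + 1) (neg_ne_zero.mpr (one_ne_zero (α := ℂ)))) ?_
      linear_combination hco
  · have hco := congrArg (Polynomial.coeff · 0) hpoly
    have hv := vieta m le_rfl
    rw [Nat.sub_self] at hv
    simp only [Polynomial.mul_coeff_zero, Polynomial.coeff_add, Polynomial.coeff_X_zero,
      Polynomial.coeff_C_zero, Polynomial.coeff_sub, Polynomial.coeff_X_pow,
      (Nat.succ_ne_zero m).symm, if_false, zero_add, zero_sub, hv] at hco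
    refine mul_left_cancel₀ (pow_ne_zero m (neg_ne_zero.mpr (one_ne_zero (α := ℂ)))) ?_
    field_simp at hco
    linear_combination hco
end

section
/- Let n ≥ 2. There exists a nonzero polynomial h ∈ ℂ[q_1,q_2] such that for every (q_1,q_2) ∈ ℂ² with q_1 ≠ 0, q_2 ≠ 0 and h(q_1,q_2) ≠ 0 the following holds: let ζ, w be nonzero complex numbers with w^n q_2 = q_1 and ζ^{n−1} w = q_1 (w + 1), and let η_1,…,η_{n−1} ∈ ℂ be pairwise distinct with ∏_{i=1}^{n−1} (ζ − η_i) = q_1 and η_i^n + (−1)^n q_2 (η_i − ζ) = 0 for all i. Define the n × n complex matrix M with rows and columns indexed by 0,1,…,n−1 by: M_{0,0} = ∑_{i=1}^{n−1} ∏_{j≠i, j≤n−1} (ζ − η_j); M_{0,i} = −∏_{j≠i, j≤n−1} (ζ − η_j) for 1 ≤ i ≤ n−1; M_{i,0} = (−1)^{n−1} q_2 for 1 ≤ i ≤ n−1; M_{i,i} = n η_i^{n−1} + (−1)^n q_2 for 1 ≤ i ≤ n−1; and M_{i,j} = 0 for 1 ≤ i ≠ j ≤ n−1. Then det(M) = n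 (n−1) q_2 w ζ^{n−2} · ∏_{1 ≤ i ≠ j ≤ n−1} (η_i − η_j). -/
open Polynomial in
/-- Lagrange interpolation of `x ↦ x⁻¹` at the nodes `y i`, evaluated at `ν`. -/
theorem mul_sum_inv_mul_lagrange {ι K : Type*} [Fintype ι] [DecidableEq ι] [Field K]
    {y : ι → K} (hy : Function.Injective y) (hy0 : ∀ i, y i ≠ 0) (ν : K) :
    ν * ∑ i, (y i)⁻¹ * ∏ j ∈ Finset.univ.erase i, ((y i - y j)⁻¹ * (ν - y j)) =
      1 - ∏ i, ((0 - y i)⁻¹ * (ν - y i)) := by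
  have hv : Function.Injective (fun o : Option ι => o.elim 0 y) := by
    rintro (_ | i) (_ | j) h
    · rfl
    · exact absurd h.symm (hy0 j)
    · exact absurd h (hy0 i)
    · exact congrArg some (hy h)
  have key := congrArg (eval ν) (Lagrange.sum_basis (s := Finset.univ) hv.injOn
    ⟨none, Finset.mem_univ _⟩)
  have hnone : (Finset.univ : Finset (Option ι)).erase none =
      Finset.univ.map Function.Embedding.some := by
    ext o; cases o <;> simp
  have hsome (i : ι) : (Finset.univ : Finset (Option ι)).erase (some i) =
      insert none ((Finset.univ.erase i).map Function.Embedding.some) := by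
    ext o; cases o <;> simp
  rw [eval_finsetSum, Fintype.sum_option] at key
  simp only [Lagrange.basis, Lagrange.basisDivisor, hnone, hsome, eval_prod, Finset.prod_map,
    eval_one, eval_mul, eval_C, eval_sub, eval_X, Function.Embedding.some_apply,
    Option.elim] at key
  rw [← key, add_sub_cancel_left, Finset.mul_sum]
  refine Finset.sum_congr rfl fun i _ => ?_
  rw [Finset.prod_insert (by simp), Finset.prod_map]
  simp
  ring

open Matrix in
theorem Matrix.det_arrow_of_ne_zero {ι K : Type*} [Fintype ι] [DecidableEq ι] [Field K]
    (a : K) (b c d : ι → K) (hd : ∀ i, d i ≠ 0) :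
    (fromBlocks (of fun _ _ : Unit => a) (of fun _ j => b j) (of fun i _ => c i)
      (diagonal d)).det =
      a * ∏ i, d i - ∑ i, b i * c i * ∏ j ∈ Finset.univ.erase i, d j := by
  let d' : Invertible d := ⟨fun i => (d i)⁻¹, by ext i; simp [hd], by ext i; simp [hd]⟩
  let := diagonalInvertible d
  rw [det_fromBlocks₂₂, det_diagonal, det_unique, invOf_diagonal_eq]
  rw [sub_apply, mul_apply]
  simp only [mul_diagonal, of_apply, mul_sub, Finset.mul_sum]
  rw [mul_comm]
  congr 1
  refine Finset.sum_congr rfl fun i _ => ?_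
  rw [← Finset.mul_prod_erase _ _ (Finset.mem_univ i)]
  have : (⅟d) i = (d i)⁻¹ := rfl
  rw [this]
  field_simp [hd i]

open Matrix Filter Topology in
/-- Determinant of an arrow matrix. -/
theorem Matrix.det_arrow {ι : Type*} [Fintype ι] [DecidableEq ι] (a : ℂ) (b c d : ι → ℂ) :
    (fromBlocks (of fun _ _ : Unit => a) (of fun _ j => b j) (of fun i _ => c i)
      (diagonal d)).det =
      a * ∏ i, d i - ∑ i, b i * c i * ∏ j ∈ Finset.univ.erase i, d j := by
  let F : ℂ → ℂ := fun t => (fromBlocks (of fun _ _ : Unit => a) (of fun _ j => b j)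
    (of fun i _ => c i) (diagonal fun i => d i + t)).det
  let G : ℂ → ℂ := fun t =>
    a * ∏ i, (d i + t) - ∑ i, b i * c i * ∏ j ∈ Finset.univ.erase i, (d j + t)
  have hF : Continuous F := by
    refine Continuous.matrix_det (Continuous.matrix_fromBlocks ?_ ?_ ?_ ?_)
    · fun_prop
    · fun_prop
    · fun_prop
    · exact Continuous.matrix_diagonal (by fun_prop)
  have hG : Continuous G := by fun_prop
  have hev : F =ᶠ[𝓝[≠] 0] G := by
    have hfin : (Set.range fun i => -d i).Finite := Set.finite_range _
    have : ∀ᶠ t in 𝓝[≠] (0 : ℂ), t ∉ (Set.range fun i => -d i) \ {0} := by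
      exact nhdsWithin_le_nhds
        ((hfin.subset Set.sdiff_subset).isClosed.isOpen_compl.mem_nhds (by simp))
    filter_upwards [this, self_mem_nhdsWithin] with t ht ht0
    refine det_arrow_of_ne_zero _ _ _ _ fun i hi => ht ⟨⟨i, ?_⟩, ht0⟩
    exact neg_eq_of_add_eq_zero_right hi
  have h0 := tendsto_nhds_unique ((hF.tendsto 0).mono_left nhdsWithin_le_nhds)
    (((hG.tendsto 0).mono_left nhdsWithin_le_nhds).congr' hev.symm)
  simpa [F, G] using h0

open Polynomial in
/-- A monic polynomial vanishing at distinct nodes, of degree one more than their number, is the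
nodal polynomial times a linear factor. -/
theorem exists_eq_X_sub_C_mul_nodal {ι K : Type*} [Fintype ι] [Field K]
    {y : ι → K} (hy : Function.Injective y) {P : K[X]} (hP : P.Monic)
    (hdeg : P.natDegree = Fintype.card ι + 1) (hroot : ∀ i, P.eval (y i) = 0) :
    ∃ ν, P = (X - C ν) * Lagrange.nodal Finset.univ y := by
  have hdvd : Lagrange.nodal Finset.univ y ∣ P :=
    Finset.prod_dvd_of_coprime
      (fun i _ j _ hij => pairwise_coprime_X_sub_C hy hij)
      fun i _ => dvd_iff_isRoot.2 (hroot i)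
  obtain ⟨Q, hQ⟩ := hdvd
  have hQm : Q.Monic := Lagrange.nodal_monic.of_mul_monic_left (hQ ▸ hP)
  have hQd : Q.natDegree = 1 := by
    have := Lagrange.nodal_monic (s := Finset.univ) (v := y) |>.natDegree_mul hQm
    rw [← hQ, hdeg, Lagrange.natDegree_nodal, Finset.card_univ] at this
    omega
  refine ⟨-Q.coeff 0, ?_⟩
  rw [hQ, mul_comm]
  congr 1
  rw [C_neg, sub_neg_eq_add]
  exact hQm.eq_X_add_C hQd

open Polynomial in
/-- The right-hand side of the arrow determinant, evaluated at a solution of the system. -/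
theorem arrow_det_eq_of_solution {ι : Type*} [Fintype ι] [DecidableEq ι] {k : ℕ}
    (hι : Fintype.card ι = k + 1) {q₁ q₂ ζ w : ℂ} {y : ι → ℂ} (hq₁ : q₁ ≠ 0) (hq₂ : q₂ ≠ 0)
    (hζ : ζ ≠ 0) (hζw : ζ ^ (k + 1) * w = q₁ * (w + 1))
    (hy : Function.Injective y) (hprod : ∏ i, (ζ - y i) = q₁)
    (hroot : ∀ i, y i ^ (k + 2) + (-1) ^ k * q₂ * (y i - ζ) = 0) :
    (∑ i, ∏ j ∈ Finset.univ.erase i, (ζ - y j)) *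
        ∏ i, ((k + 2) * y i ^ (k + 1) + (-1) ^ k * q₂) -
      ∑ i, (-∏ j ∈ Finset.univ.erase i, (ζ - y j)) * (-((-1) ^ k * q₂)) *
        ∏ j ∈ Finset.univ.erase i, ((k + 2) * y j ^ (k + 1) + (-1) ^ k * q₂) =
      (k + 2) * (k + 1) * q₂ * w * ζ ^ k * ∏ i, ∏ j ∈ Finset.univ.erase i, (y i - y j) := by
  set c : ℂ := (-1) ^ k * q₂ with hc
  have hc0 : c ≠ 0 := mul_ne_zero (pow_ne_zero _ (by norm_num)) hq₂
  have hy0 (i : ι) : y i ≠ 0 := fun h => by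
    have := hroot i
    simp [h, hc0, hζ] at this
  let P : ℂ[X] := X ^ (k + 2) + (C c * X - C (c * ζ))
  have hlow : (C c * X - C (c * ζ)).degree < ((k + 2 : ℕ) : WithBot ℕ) := by
    rw [sub_eq_add_neg, ← C_neg]
    exact degree_linear_le.trans_lt (by norm_cast; omega)
  have hPm : P.Monic := monic_X_pow_add hlow
  have hPd : P.natDegree = k + 2 := by
    rw [natDegree_add_eq_left_of_degree_lt (by simpa only [degree_X_pow] using hlow),
      natDegree_X_pow]
  have hPe (x : ℂ) : P.eval x = x ^ (k + 2) + c * (x - ζ) := by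
    simp [P]; ring
  have hPd' (x : ℂ) : P.derivative.eval x = (k + 2) * x ^ (k + 1) + c := by
    simp only [P, derivative_add, derivative_X_pow, derivative_sub, derivative_C_mul,
      derivative_X, derivative_C, eval_add, eval_mul, eval_C, eval_pow, eval_X, eval_sub,
      eval_one, eval_zero]
    push_cast
    ring
  obtain ⟨ν, hν⟩ := exists_eq_X_sub_C_mul_nodal hy hPm (by rw [hPd, hι])
    (fun i => by rw [hPe]; exact hroot i)
  have hfac (x : ℂ) : x ^ (k + 2) + c * (x - ζ) = (x - ν) * ∏ i, (x - y i) := by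
    rw [← hPe, hν, eval_mul, Lagrange.eval_nodal]; simp
  have hder (x : ℂ) : (k + 2) * x ^ (k + 1) + c = ∏ i, (x - y i) +
      (x - ν) * (Lagrange.nodal Finset.univ y).derivative.eval x := by
    rw [← hPd', hν, derivative_mul, eval_add, eval_mul, eval_mul, Lagrange.eval_nodal]; simp
  have hD (i : ι) : (k + 2) * y i ^ (k + 1) + c =
      (y i - ν) * ∏ j ∈ Finset.univ.erase i, (y i - y j) := by
    rw [hder, Lagrange.eval_nodal_derivative_eval_node_eq (Finset.mem_univ i),
      Lagrange.eval_nodal, Finset.prod_eq_zero (Finset.mem_univ i) (sub_self _), zero_add]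
  have hζν : ζ ^ (k + 2) = (ζ - ν) * q₁ := by
    have := hfac ζ
    rwa [hprod, sub_self, mul_zero, add_zero] at this
  have hνw : ν * w = -ζ := by
    apply mul_left_cancel₀ hq₁
    linear_combination w * hζν - ζ * hζw
  have hν0 : ν ≠ 0 := by
    rintro rfl
    simp at hνw
    exact hζ hνw
  have hA0 : (∏ i, (0 - y i)) * ν = c * ζ := by
    have := hfac 0
    rw [zero_pow (by omega)] at this
    linear_combination this
  have hAν : ∏ i, (ν - y i) = (k + 2) * ν ^ (k + 1) + c := by rw [hder]; ring
  have hPν : ν ^ (k + 2) + c * (ν - ζ) = 0 := by rw [hfac]; ring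
  set E : ι → ℂ := fun i => ∏ j ∈ Finset.univ.erase i, (y i - y j) with hE
  have hE0 (i : ι) : E i ≠ 0 := Finset.prod_ne_zero_iff.2 fun j hj =>
    sub_ne_zero.2 (hy.ne (Finset.ne_of_mem_erase hj).symm)
  have hterm (i : ι) : (∏ j ∈ Finset.univ.erase i, (ζ - y j)) * ((k + 2) * y i ^ (k + 1)) =
      (k + 2) * c * q₁ * (y i)⁻¹ := by
    rw [eq_mul_inv_iff_mul_eq₀ (hy0 i), ← hprod,
      ← Finset.mul_prod_erase _ _ (Finset.mem_univ i)]
    linear_combination (k + 2) * (∏ j ∈ Finset.univ.erase i, (ζ - y j)) * hroot i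
  have herase (i : ι) : ∏ j ∈ Finset.univ.erase i, ((k + 2) * y j ^ (k + 1) + c) =
      (-1) ^ k * (∏ j, E j) * ∏ j ∈ Finset.univ.erase i, ((y i - y j)⁻¹ * (ν - y j)) := by
    simp only [hD]
    rw [Finset.prod_mul_distrib, Finset.prod_mul_distrib, Finset.prod_inv_distrib,
      ← Finset.mul_prod_erase _ E (Finset.mem_univ i)]
    have hneg : ∏ j ∈ Finset.univ.erase i, (y j - ν) =
        (-1) ^ k * ∏ j ∈ Finset.univ.erase i, (ν - y j) := by
      rw [← Finset.prod_congr rfl fun j _ => neg_sub ν (y j), Finset.prod_neg,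
        Finset.card_erase_of_mem (Finset.mem_univ i), Finset.card_univ, hι, Nat.add_sub_cancel]
    have hEi : E i * (∏ j ∈ Finset.univ.erase i, (y i - y j))⁻¹ = 1 := mul_inv_cancel₀ (hE0 i)
    rw [hneg]
    linear_combination (-(-1) ^ k * (∏ j ∈ Finset.univ.erase i, (ν - y j)) *
      ∏ j ∈ Finset.univ.erase i, E j) * hEi
  have hS := mul_sum_inv_mul_lagrange hy hy0 ν
  set S := ∑ i, (y i)⁻¹ * ∏ j ∈ Finset.univ.erase i, ((y i - y j)⁻¹ * (ν - y j))
  have hLHS : (∑ i, ∏ j ∈ Finset.univ.erase i, (ζ - y j)) *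
        ∏ i, ((k + 2) * y i ^ (k + 1) + c) -
      ∑ i, (-∏ j ∈ Finset.univ.erase i, (ζ - y j)) * (-c) *
        ∏ j ∈ Finset.univ.erase i, ((k + 2) * y j ^ (k + 1) + c) =
      (k + 2) * c * q₁ * ((-1) ^ k * ∏ j, E j) * S := by
    rw [Finset.sum_mul, ← Finset.sum_sub_distrib, Finset.mul_sum]
    refine Finset.sum_congr rfl fun i _ => ?_
    rw [← Finset.mul_prod_erase _ (fun j => (k + 2) * y j ^ (k + 1) + c) (Finset.mem_univ i),
      herase]
    linear_combination ((-1) ^ k * (∏ j, E j) *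
      ∏ j ∈ Finset.univ.erase i, ((y i - y j)⁻¹ * (ν - y j))) * hterm i
  have hA0' : ∏ i, (0 - y i) ≠ 0 := Finset.prod_ne_zero_iff.2 fun i _ => by simp [hy0 i]
  have hS' : ν * S * ζ = -(k + 1) * (ζ - ν) := by
    rw [Finset.prod_mul_distrib, Finset.prod_inv_distrib, hAν] at hS
    have h1 : (∏ i, (0 - y i)) * (∏ i, (0 - y i))⁻¹ = 1 := mul_inv_cancel₀ hA0'
    apply mul_left_cancel₀ hc0
    rw [hS]
    linear_combination (∏ i, (0 - y i))⁻¹ * ((k + 2) * ν ^ (k + 1) + c) * hA0 -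
      ν * ((k + 2) * ν ^ (k + 1) + c) * h1 - (k + 2) * hPν
  have hsq : ((-1 : ℂ) ^ k) * (-1) ^ k = 1 := by rw [← mul_pow]; simp
  rw [hLHS]
  apply mul_left_cancel₀ (mul_ne_zero hν0 hζ)
  rw [hc]
  linear_combination ((k + 2) * q₂ * q₁ * ∏ j, E j) * (ν * S * ζ * hsq + hS') +
    ((k + 2) * (k + 1) * q₂ * ∏ j, E j) * (hζν - ζ ^ (k + 1) * hνw)

/-- For generic `(q₁,q₂)`, the Jacobian determinant of the rank `(1,n-1)` system at a
non-degenerate solution equals `n(n-1) q₂ w ζ^{n-2} ∏_{i≠j}(η_i - η_j)`. -/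
theorem stmt_16 (n : ℕ) (hn : 2 ≤ n) :
    ∃ h : MvPolynomial (Fin 2) ℂ, h ≠ 0 ∧
      ∀ q₁ q₂ : ℂ, q₁ ≠ 0 → q₂ ≠ 0 → MvPolynomial.eval ![q₁, q₂] h ≠ 0 →
        ∀ (ζ w : ℂ) (η : ℕ → ℂ) (M : Matrix (Fin n) (Fin n) ℂ),
          ζ ≠ 0 → w ≠ 0 → w ^ n * q₂ = q₁ → ζ ^ (n - 1) * w = q₁ * (w + 1) →
          (∀ i ∈ Finset.Icc 1 (n - 1), ∀ j ∈ Finset.Icc 1 (n - 1), i ≠ j → η i ≠ η j) →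
          (∏ i ∈ Finset.Icc 1 (n - 1), (ζ - η i)) = q₁ →
          (∀ i ∈ Finset.Icc 1 (n - 1), η i ^ n + (-1 : ℂ) ^ n * q₂ * (η i - ζ) = 0) →
          (∀ i j : Fin n, M i j =
            if (i : ℕ) = 0 then
              (if (j : ℕ) = 0 then
                ∑ a ∈ Finset.Icc 1 (n - 1), ∏ b ∈ (Finset.Icc 1 (n - 1)).erase a, (ζ - η b)
              else -∏ b ∈ (Finset.Icc 1 (n - 1)).erase (j : ℕ), (ζ - η b))
            else
              (if (j : ℕ) = 0 then (-1 : ℂ) ^ (n - 1) * q₂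
              else if (i : ℕ) = (j : ℕ) then
                (n : ℂ) * η (i : ℕ) ^ (n - 1) + (-1 : ℂ) ^ n * q₂
              else 0)) →
          Matrix.det M =
            (n : ℂ) * ((n : ℂ) - 1) * q₂ * w * ζ ^ (n - 2) *
              ∏ i ∈ Finset.Icc 1 (n - 1), ∏ j ∈ (Finset.Icc 1 (n - 1)).erase i, (η i - η j) := by
  obtain ⟨k, rfl⟩ : ∃ k, n = k + 2 := ⟨n - 2, by omega⟩
  refine ⟨1, one_ne_zero, fun q₁ q₂ hq₁ hq₂ _ ζ w η M hζ _ _ hζw hη hprod hroot hM => ?_⟩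
  let shift : Fin (k + 1) ↪ ℕ := ⟨fun i => i + 1, fun i j h => by simpa [Fin.ext_iff] using h⟩
  have hshift (i : Fin (k + 1)) : shift i = i + 1 := rfl
  have hIcc : Finset.Icc 1 (k + 2 - 1) = Finset.univ.map shift := by
    ext i
    simp only [Finset.mem_Icc, Finset.mem_map, Finset.mem_univ, true_and]
    constructor
    · rintro ⟨h1, h2⟩
      exact ⟨⟨i - 1, by omega⟩, by rw [hshift]; dsimp only; omega⟩
    · rintro ⟨j, rfl⟩
      rw [hshift]; omega
  have herase (i : Fin (k + 1)) : (Finset.univ.map shift).erase ((i : ℕ) + 1) =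
      (Finset.univ.erase i).map shift := by
    rw [Finset.map_erase, hshift]
  rw [hIcc] at hη hprod hroot hM ⊢
  simp only [Finset.prod_map, Finset.sum_map, hshift, herase] at hprod hM ⊢
  have hmem (i : Fin (k + 1)) : (i : ℕ) + 1 ∈ Finset.univ.map shift :=
    Finset.mem_map_of_mem shift (Finset.mem_univ i)
  have hpow : (-1 : ℂ) ^ (k + 2) = (-1) ^ k := by rw [pow_add]; norm_num
  have hpow_odd : (-1 : ℂ) ^ (k + 1) = -(-1) ^ k := by rw [pow_succ]; ring
  have hsol := arrow_det_eq_of_solution (y := fun i : Fin (k + 1) => η (i + 1)) (by simp) hq₁ hq₂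
    hζ hζw
    (fun i j h => by
      by_contra hij
      exact hη _ (hmem i) _ (hmem j) (by simpa [Fin.ext_iff] using hij) h)
    hprod (fun i => by rw [← hpow]; exact hroot _ (hmem i))
  rw [← Matrix.det_arrow] at hsol
  let e : Unit ⊕ Fin (k + 1) ≃ Fin (k + 2) :=
    (Equiv.sumComm _ _).trans ((Equiv.optionEquivSumPUnit _).symm.trans (finSuccEquiv _).symm)
  rw [← Matrix.det_submatrix_equiv_self e]
  convert hsol using 2
  · ext (i | i) (j | j)
    · simp [hM, e]
    · simp [hM, e, herase, -Finset.map_erase, hshift]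
    · simp [hM, e, hpow_odd]
    · rcases eq_or_ne i j with rfl | hij
      · simp [hM, e, hpow]
      · simp [hM, e, hij, Fin.val_inj]
  · push_cast
    ring
end
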